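/- Let X be a subshift on the alphabet of positive integers. If the set C_X contains a real algebraic number of degree at least three, then the complexity function of X satisfies lim_{n→∞} (p_X(n) − n) = +∞; that is, for every constant C there exists N such that for all n ≥ N the number of distinct blocks of n consecutive letters occurring in elements of X is at least n + C. -/

import Mathlib

open Filter Topology

/-- Denominators of the convergents of the continued fraction `[0; a 0, a 1, ...]`,
where `a i` denotes the `(i+1)`-st partial quotient `a_{i+1}` of the paper:
`q_0 = 1`, `q_1 = a_1`, `q_{ℓ+1} = a_{ℓ+1} q_ℓ + q_{ℓ-1}`. -/
def cfQ (a : ℕ → ℕ) : ℕ → ℕ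
  | 0 => 1
  | 1 => a 0
  | n + 2 => a (n + 1) * cfQ a (n + 1) + cfQ a n

/-- Numerators of the convergents of the continued fraction `[0; a 0, a 1, ...]`:
`p_0 = 0`, `p_1 = 1`, `p_{ℓ+1} = a_{ℓ+1} p_ℓ + p_{ℓ-1}`. -/
def cfP (a : ℕ → ℕ) : ℕ → ℕ
  | 0 => 0
  | 1 => 1
  | n + 2 => a (n + 1) * cfP a (n + 1) + cfP a n


/-- The finite word `W` occurs in the infinite word `x` at position `i`
(0-indexed). -/
def Occurs {A : Type*} (x : ℕ → A) (W : List A) (i : ℕ) : Prop :=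
  ∀ t < W.length, W[t]? = some (x (i + t))


set_option linter.all false

namespace Sub6
open MvPolynomial

section L1
variable {σ τ R : Type*} [SeminormedCommRing R]

/-- sum of the norms of the coefficients -/
noncomputable def l1 (p : MvPolynomial σ R) : ℝ := ∑ m ∈ p.support, ‖coeff m p‖

lemma l1_nonneg (p : MvPolynomial σ R) : 0 ≤ l1 p := Finset.sum_nonneg fun _ _ => norm_nonneg _

lemma l1_eq_sum (p : MvPolynomial σ R) (S : Finset (σ →₀ ℕ)) (h : p.support ⊆ S) :
    l1 p = ∑ m ∈ S, ‖coeff m p‖ := by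
  apply Finset.sum_subset h
  intro m _ hm
  rw [notMem_support_iff.1 hm, norm_zero]

lemma norm_coeff_le_l1 (p : MvPolynomial σ R) (m : σ →₀ ℕ) : ‖coeff m p‖ ≤ l1 p := by
  by_cases h : m ∈ p.support
  · exact Finset.single_le_sum (f := fun m => ‖coeff m p‖) (fun _ _ => norm_nonneg _) h
  · rw [notMem_support_iff.1 h, norm_zero]; exact l1_nonneg p

lemma sum_coeff_le_l1 (p : MvPolynomial σ R) (S : Finset (σ →₀ ℕ)) :
    ∑ m ∈ S, ‖coeff m p‖ ≤ l1 p := by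
  classical
  rw [l1_eq_sum p (p.support ∪ S) Finset.subset_union_left]
  exact Finset.sum_le_sum_of_subset_of_nonneg Finset.subset_union_right
    fun _ _ _ => norm_nonneg _

lemma l1_add (p q : MvPolynomial σ R) : l1 (p + q) ≤ l1 p + l1 q := by
  classical
  have h1 := support_add (p := p) (q := q)
  rw [l1_eq_sum _ _ h1, l1_eq_sum p (p.support ∪ q.support) Finset.subset_union_left,
    l1_eq_sum q (p.support ∪ q.support) Finset.subset_union_right, ← Finset.sum_add_distrib]
  apply Finset.sum_le_sum
  intro m _
  rw [coeff_add]; exact norm_add_le _ _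

@[simp] lemma l1_zero : l1 (0 : MvPolynomial σ R) = 0 := by simp [l1]

lemma l1_neg (p : MvPolynomial σ R) : l1 (-p) = l1 p := by
  classical
  rw [l1_eq_sum (-p) p.support (by rw [support_neg]), l1]
  simp

lemma l1_sum {ι : Type*} (s : Finset ι) (f : ι → MvPolynomial σ R) :
    l1 (∑ i ∈ s, f i) ≤ ∑ i ∈ s, l1 (f i) := by
  classical
  induction s using Finset.induction_on with
  | empty => simp
  | insert a s ha ih =>
    rw [Finset.sum_insert ha, Finset.sum_insert ha]
    exact (l1_add _ _).trans (by linarith)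

lemma l1_monomial (m : σ →₀ ℕ) (a : R) : l1 (monomial m a) = ‖a‖ := by
  classical
  rw [l1_eq_sum _ {m} support_monomial_subset]
  simp

lemma l1_C (a : R) : l1 (C a : MvPolynomial σ R) = ‖a‖ := l1_monomial 0 a

lemma l1_mul (p q : MvPolynomial σ R) : l1 (p * q) ≤ l1 p * l1 q := by
  conv_lhs => rw [← support_sum_monomial_coeff p, ← support_sum_monomial_coeff q,
    Finset.sum_mul_sum]
  have e : l1 p * l1 q = ∑ i ∈ p.support, ∑ j ∈ q.support, ‖coeff i p‖ * ‖coeff j q‖ := by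
    rw [l1, l1, Finset.sum_mul_sum]
  rw [e]
  refine (l1_sum _ _).trans (Finset.sum_le_sum fun m _ => ?_)
  refine (l1_sum _ _).trans (Finset.sum_le_sum fun n _ => ?_)
  rw [monomial_mul, l1_monomial]
  exact norm_mul_le _ _

lemma l1_X [NormOneClass R] (i : σ) : l1 (X i : MvPolynomial σ R) = 1 := by
  rw [X, l1_monomial, norm_one]

lemma l1_one [NormOneClass R] : l1 (1 : MvPolynomial σ R) = 1 := by
  rw [← C_1, l1_C, norm_one]

lemma l1_pow [NormOneClass R] (p : MvPolynomial σ R) (k : ℕ) : l1 (p ^ k) ≤ l1 p ^ k := by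
  induction k with
  | zero => simp [l1_one]
  | succ k ih =>
    rw [pow_succ, pow_succ]
    exact (l1_mul _ _).trans (mul_le_mul_of_nonneg_right ih (l1_nonneg _))

lemma l1_prod [NormOneClass R] {ι : Type*} (s : Finset ι) (f : ι → MvPolynomial σ R) :
    l1 (∏ i ∈ s, f i) ≤ ∏ i ∈ s, l1 (f i) := by
  classical
  induction s using Finset.induction_on with
  | empty => simp [l1_one]
  | insert a s ha ih =>
    rw [Finset.prod_insert ha, Finset.prod_insert ha]
    exact (l1_mul _ _).trans (mul_le_mul_of_nonneg_left ih (l1_nonneg _))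

lemma l1_smul (a : R) (p : MvPolynomial σ R) : l1 (a • p) ≤ ‖a‖ * l1 p := by
  rw [smul_eq_C_mul]
  exact (l1_mul _ _).trans (by rw [l1_C])

/-- bound for a substitution -/
lemma l1_eval₂ [NormOneClass R] {S : Type*} [CommRing S] [Fintype τ] (φ : S →+* R)
    (g : τ → MvPolynomial σ R) (p : MvPolynomial τ S) :
    l1 (eval₂ (C.comp φ) g p) ≤ ∑ m ∈ p.support, ‖φ (coeff m p)‖ * ∏ h, l1 (g h) ^ m h := by
  rw [eval₂_eq']
  refine (l1_sum _ _).trans (Finset.sum_le_sum fun m _ => ?_)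
  refine (l1_mul _ _).trans ?_
  rw [RingHom.comp_apply, l1_C]
  refine mul_le_mul_of_nonneg_left ?_ (norm_nonneg _)
  refine (l1_prod _ _).trans (Finset.prod_le_prod (fun _ _ => l1_nonneg _) fun h _ => ?_)
  exact l1_pow _ _

lemma l1_det [NormOneClass R] {s : ℕ} (M : Matrix (Fin s) (Fin s) (MvPolynomial σ R)) (B : ℝ)
    (hM : ∀ i j, l1 (M i j) ≤ B) : l1 M.det ≤ s.factorial * B ^ s := by
  rw [Matrix.det_apply]
  refine (l1_sum _ _).trans ?_
  have : ∀ π ∈ (Finset.univ : Finset (Equiv.Perm (Fin s))),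
      l1 (Equiv.Perm.sign π • ∏ i, M (π i) i) ≤ B ^ s := by
    intro π _
    have h1 : l1 (Equiv.Perm.sign π • ∏ i, M (π i) i) = l1 (∏ i, M (π i) i) := by
      rcases Int.units_eq_one_or (Equiv.Perm.sign π) with h | h
      · rw [h, one_smul]
      · rw [h, Units.neg_smul, one_smul, l1_neg]
    rw [h1]
    refine (l1_prod _ _).trans ?_
    refine (Finset.prod_le_prod (fun _ _ => l1_nonneg _) fun i _ => hM (π i) i).trans ?_
    simp
  refine (Finset.sum_le_sum this).trans ?_
  simp [Fintype.card_perm]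

lemma one_le_l1 (p : MvPolynomial σ ℤ) (hp : p ≠ 0) : 1 ≤ l1 p := by
  obtain ⟨m, hm⟩ := ne_zero_iff.1 hp
  refine le_trans ?_ (norm_coeff_le_l1 p m)
  rw [Int.norm_eq_abs]
  exact_mod_cast Int.one_le_abs hm
end L1

section Wge
variable {σ R : Type*} [CommRing R]

/-- every monomial has weight at least `c` -/
def Wge (w : (σ →₀ ℕ) →+ ℝ) (c : ℝ) (p : MvPolynomial σ R) : Prop :=
  ∀ m, coeff m p ≠ 0 → c ≤ w m

variable {w : (σ →₀ ℕ) →+ ℝ} {c d : ℝ} {p q : MvPolynomial σ R}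

lemma Wge.mono (h : Wge w c p) (hd : d ≤ c) : Wge w d p := fun m hm => hd.trans (h m hm)

lemma Wge.zero : Wge w c (0 : MvPolynomial σ R) := fun m hm => absurd (coeff_zero m) hm

lemma Wge.add (hp : Wge w c p) (hq : Wge w c q) : Wge w c (p + q) := by
  intro m hm
  rw [coeff_add] at hm
  by_cases h : coeff m p = 0
  · rw [h, zero_add] at hm; exact hq m hm
  · exact hp m h

lemma Wge.sum {ι : Type*} (s : Finset ι) (f : ι → MvPolynomial σ R)
    (h : ∀ i ∈ s, Wge w c (f i)) : Wge w c (∑ i ∈ s, f i) := by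
  classical
  induction s using Finset.induction_on with
  | empty => exact Wge.zero
  | insert a s ha ih =>
    rw [Finset.sum_insert ha]
    exact (h a (Finset.mem_insert_self _ _)).add
      (ih fun i hi => h i (Finset.mem_insert_of_mem hi))

lemma Wge.mul (hp : Wge w c p) (hq : Wge w d q) : Wge w (c + d) (p * q) := by
  classical
  intro m hm
  obtain ⟨a, ha, b, hb, rfl⟩ := Finset.mem_add.1 (support_mul p q (mem_support_iff.2 hm))
  rw [map_add]
  exact add_le_add (hp a (mem_support_iff.1 ha)) (hq b (mem_support_iff.1 hb))

lemma Wge.neg (hp : Wge w c p) : Wge w c (-p) := by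
  intro m hm
  apply hp m
  simpa using hm

lemma Wge.one : Wge w 0 (1 : MvPolynomial σ R) := by
  classical
  intro m hm
  rw [coeff_one] at hm
  have : m = 0 := by by_contra h; exact hm (if_neg (Ne.symm h))
  rw [this, map_zero]

lemma Wge.prod {ι : Type*} (s : Finset ι) (f : ι → MvPolynomial σ R) (c : ι → ℝ)
    (h : ∀ i ∈ s, Wge w (c i) (f i)) : Wge w (∑ i ∈ s, c i) (∏ i ∈ s, f i) := by
  classical
  induction s using Finset.induction_on with
  | empty => simpa using Wge.one
  | insert a s ha ih =>
    rw [Finset.sum_insert ha, Finset.prod_insert ha]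
    exact (h a (Finset.mem_insert_self _ _)).mul
      (ih fun i hi => h i (Finset.mem_insert_of_mem hi))

/-- determinant whose columns have weights at least `c k` -/
lemma Wge.det {s : ℕ} (M : Matrix (Fin s) (Fin s) (MvPolynomial σ R)) (c : Fin s → ℝ)
    (h : ∀ l k, Wge w (c k) (M l k)) : Wge w (∑ k, c k) M.det := by
  rw [Matrix.det_apply]
  apply Wge.sum
  intro π _
  have := Wge.prod Finset.univ (fun i => M (π i) i) c (fun i _ => h (π i) i)
  rcases Int.units_eq_one_or (Equiv.Perm.sign π) with hs | hs
  · rw [hs, one_smul]; exact this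
  · rw [hs, Units.neg_smul, one_smul]; exact this.neg
end Wge

section Dl
variable {σ R S : Type*} [CommRing R] [CommRing S] [Fintype σ]

/-- product of binomials -/
def mch (n i : σ →₀ ℕ) : ℕ := ∏ h, (n h).choose (i h)

lemma mch_eq_zero {n i : σ →₀ ℕ} (h : ¬ i ≤ n) : mch n i = 0 := by
  rw [Finsupp.le_def, not_forall] at h
  obtain ⟨a, ha⟩ := h
  exact Finset.prod_eq_zero (Finset.mem_univ a) (Nat.choose_eq_zero_of_lt (not_le.1 ha))

/-- Hasse derivative -/
noncomputable def Dl (i : σ →₀ ℕ) : MvPolynomial σ R →ₗ[R] MvPolynomial σ R :=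
  (basisMonomials σ R).constr R fun n => monomial (n - i) (mch n i : R)

lemma Dl_monomial (i n : σ →₀ ℕ) (a : R) :
    Dl i (monomial n a) = monomial (n - i) (a * mch n i) := by
  have h : (monomial n a : MvPolynomial σ R) = a • basisMonomials σ R n := by
    rw [coe_basisMonomials, smul_monomial, smul_eq_mul, mul_one]
  rw [h, map_smul, Dl, Module.Basis.constr_basis, smul_monomial, smul_eq_mul]

lemma coeff_Dl (i k : σ →₀ ℕ) (f : MvPolynomial σ R) :
    coeff k (Dl i f) = coeff (k + i) f * mch (k + i) i := by
  classical
  induction f using MvPolynomial.induction_on' with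
  | monomial n a =>
    rw [Dl_monomial, coeff_monomial, coeff_monomial]
    by_cases h : i ≤ n
    · have : n - i = k ↔ n = k + i := by
        constructor
        · intro h'; rw [← h', tsub_add_cancel_of_le h]
        · intro h'; rw [h', add_tsub_cancel_right]
      by_cases h2 : n = k + i
      · rw [if_pos (this.2 h2), if_pos h2, h2]
      · rw [if_neg (fun h' => h2 (this.1 h')), if_neg h2, zero_mul]
    · rw [mch_eq_zero h, if_neg (fun h' : n = k + i => h (h' ▸ le_add_self))]
      simp
  | add p q hp hq => rw [map_add, coeff_add, hp, hq, coeff_add, add_mul]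

lemma Dl_map (φ : R →+* S) (i : σ →₀ ℕ) (f : MvPolynomial σ R) :
    Dl i (map φ f) = map φ (Dl i f) := by
  ext k
  rw [coeff_Dl, coeff_map, coeff_map, coeff_Dl, map_mul, map_natCast]

lemma Dl_C (i : σ →₀ ℕ) (a : R) : Dl i (C a : MvPolynomial σ R) = if i = 0 then C a else 0 := by
  classical
  rw [C_apply, Dl_monomial]
  split_ifs with h
  · rw [h]; simp [mch]
  · rw [mch_eq_zero (fun h' => h (nonpos_iff_eq_zero.1 h'))]; simp

lemma mch_pascal [DecidableEq σ] (m i : σ →₀ ℕ) (h : σ) (hi : i h ≠ 0) :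
    mch (m + Finsupp.single h 1) i = mch m i + mch m (i - Finsupp.single h 1) := by
  unfold mch
  have e0 : ∀ f : σ → ℕ, ∏ a, f a = f h * ∏ a ∈ Finset.univ.erase h, f a :=
    fun f => (Finset.mul_prod_erase _ _ (Finset.mem_univ h)).symm
  rw [e0, e0 (fun a => (m a).choose (i a)), e0 (fun a => (m a).choose _)]
  have e1 : ∏ x ∈ Finset.univ.erase h, ((m + Finsupp.single h 1 : σ →₀ ℕ) x).choose (i x)
      = ∏ x ∈ Finset.univ.erase h, (m x).choose (i x) := by
    refine Finset.prod_congr rfl fun x hx => ?_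
    have : x ≠ h := Finset.ne_of_mem_erase hx
    simp [Finsupp.single_apply, Ne.symm this]
  have e2 : ∏ x ∈ Finset.univ.erase h, (m x).choose ((i - Finsupp.single h 1 : σ →₀ ℕ) x)
      = ∏ x ∈ Finset.univ.erase h, (m x).choose (i x) := by
    refine Finset.prod_congr rfl fun x hx => ?_
    have : x ≠ h := Finset.ne_of_mem_erase hx
    simp [Finsupp.single_apply, Ne.symm this]
  rw [e1, e2, ← add_mul]
  congr 1
  obtain ⟨j, hj⟩ := Nat.exists_eq_succ_of_ne_zero hi
  simp only [Finsupp.add_apply, Finsupp.single_eq_same, Finsupp.tsub_apply, hj]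
  rw [Nat.choose_succ_succ]
  simp [add_comm]

lemma mch_same [DecidableEq σ] (m i : σ →₀ ℕ) (h : σ) (hi : i h = 0) :
    mch (m + Finsupp.single h 1) i = mch m i := by
  unfold mch
  refine Finset.prod_congr rfl fun x _ => ?_
  by_cases hx : x = h
  · subst hx; simp [hi]
  · simp [Finsupp.single_apply, Ne.symm hx]

lemma Dl_mul_X [DecidableEq σ] (i : σ →₀ ℕ) (f : MvPolynomial σ R) (h : σ) :
    Dl i (f * X h) = Dl i f * X h + if i h = 0 then 0 else Dl (i - Finsupp.single h 1) f := by
  induction f using MvPolynomial.induction_on' with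
  | add p q hp hq =>
    rw [add_mul, map_add, hp, hq, map_add, add_mul]
    split_ifs
    · ring
    · rw [map_add]; ring
  | monomial m a =>
    rw [X, monomial_mul, Dl_monomial, Dl_monomial, monomial_mul, Dl_monomial]
    split_ifs with hi
    · rw [mch_same m i h hi, add_zero]
      by_cases hle : i ≤ m
      · rw [tsub_add_eq_add_tsub hle, mul_one, mul_one]
      · rw [mch_eq_zero hle]; simp
    · rw [mch_pascal m i h hi]
      have hle1 : Finsupp.single h 1 ≤ i := by
        rw [Finsupp.single_le_iff]; omega
      have e2 : m - (i - Finsupp.single h 1) = m + Finsupp.single h 1 - i := by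
        ext x
        simp only [Finsupp.tsub_apply, Finsupp.add_apply]
        have := hle1 x
        omega
      rw [e2]
      by_cases hle : i ≤ m
      · rw [tsub_add_eq_add_tsub hle, ← map_add]
        congr 1
        push_cast; ring
      · rw [mch_eq_zero hle]; simp

/-- translation -/
noncomputable def Tr (ξ : σ → R) : MvPolynomial σ R →ₐ[R] MvPolynomial σ R :=
  aeval fun h => X h + C (ξ h)

lemma Tr_X (ξ : σ → R) (h : σ) : Tr ξ (X h) = X h + C (ξ h) := by simp [Tr]

lemma Tr_C (ξ : σ → R) (a : R) : Tr ξ (C a) = C a := by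
  rw [Tr, algHom_C]; rfl

lemma Dl_Tr (ξ : σ → R) (i : σ →₀ ℕ) (f : MvPolynomial σ R) :
    Dl i (Tr ξ f) = Tr ξ (Dl i f) := by
  classical
  induction f using MvPolynomial.induction_on generalizing i with
  | C a =>
    rw [Tr_C, Dl_C]
    split_ifs
    · rw [Tr_C]
    · rw [map_zero]
  | add p q hp hq => rw [map_add, map_add, hp, hq, map_add, map_add]
  | mul_X p h ih =>
    have e : Dl i (Tr ξ p * C (ξ h)) = C (ξ h) * Tr ξ (Dl i p) := by
      rw [mul_comm, ← smul_eq_C_mul, map_smul, ih, smul_eq_C_mul]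
    rw [map_mul, Tr_X, mul_add, map_add, e, Dl_mul_X, ih, Dl_mul_X, map_add, map_mul, Tr_X]
    split_ifs
    · rw [map_zero]; ring
    · rw [ih]; ring

lemma Tr_neg_Tr (ξ : σ → R) (f : MvPolynomial σ R) : Tr (-ξ) (Tr ξ f) = f := by
  have : (Tr (-ξ)).comp (Tr ξ) = AlgHom.id R _ := by
    apply algHom_ext
    intro h
    rw [AlgHom.comp_apply, Tr_X, map_add, Tr_X, Tr_C]
    simp
  exact DFunLike.congr_fun this f

lemma Tr_ne_zero (ξ : σ → R) {f : MvPolynomial σ R} (hf : f ≠ 0) : Tr ξ f ≠ 0 := by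
  intro h
  apply hf
  rw [← Tr_neg_Tr ξ f, h, map_zero]

lemma Wge.Dl {w : (σ →₀ ℕ) →+ ℝ} {c : ℝ} {f : MvPolynomial σ R} (h : Wge w c f)
    (i : σ →₀ ℕ) : Wge w (c - w i) (Dl i f) := by
  intro m hm
  rw [coeff_Dl] at hm
  have := h (m + i) (left_ne_zero_of_mul hm)
  rw [map_add] at this
  linarith

lemma l1_Dl (i : σ →₀ ℕ) (f : MvPolynomial σ ℤ) (r : σ → ℕ)
    (hr : ∀ m, coeff m f ≠ 0 → ∀ h, m h ≤ r h) : l1 (Sub6.Dl i f) ≤ 2 ^ (∑ h, r h) * l1 f := by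
  conv_lhs => rw [← support_sum_monomial_coeff f, map_sum]
  refine (l1_sum _ _).trans ?_
  rw [l1, Finset.mul_sum]
  refine Finset.sum_le_sum fun m hm => ?_
  rw [Dl_monomial, l1_monomial, norm_mul, mul_comm]
  refine mul_le_mul_of_nonneg_right ?_ (norm_nonneg _)
  rw [Int.norm_natCast, mch, ← Finset.prod_pow_eq_pow_sum]
  push_cast
  refine Finset.prod_le_prod (fun _ _ => by positivity) fun h _ => ?_
  have h1 : (m h).choose (i h) ≤ 2 ^ m h := Nat.choose_le_two_pow _ _
  have h2 : 2 ^ m h ≤ 2 ^ r h := Nat.pow_le_pow_right (by norm_num) (hr m (mem_support_iff.1 hm) h)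
  exact_mod_cast h1.trans h2
end Dl
end Sub6

namespace Sub6
open MvPolynomial

/-- choosing rows in spans -/
lemma det_rows {A : Type*} [CommRing A] {s : ℕ} (M : Matrix (Fin s) (Fin s) A)
    (V : Fin s → Set (Fin s → A)) (hM : M.det ≠ 0)
    (hV : ∀ l, M l ∈ Submodule.span A (V l)) :
    ∃ N : Matrix (Fin s) (Fin s) A, (∀ l, N l ∈ V l) ∧ N.det ≠ 0 := by
  classical
  have key : ∀ T : Finset (Fin s), ∃ N : Matrix (Fin s) (Fin s) A,
      (∀ l ∈ T, N l ∈ V l) ∧ (∀ l, l ∉ T → N l = M l) ∧ N.det ≠ 0 := by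
    intro T
    induction T using Finset.induction_on with
    | empty => exact ⟨M, by simp, by simp, hM⟩
    | insert a T ha ih =>
      obtain ⟨N, h1, h2, h3⟩ := ih
      by_contra hcon
      push Not at hcon
      apply h3
      have h4 : ∀ v ∈ Submodule.span A (V a), (N.updateRow a v).det = 0 := by
        intro v hv
        induction hv using Submodule.span_induction with
        | mem v hv =>
          apply hcon
          · intro l hl
            by_cases hla : l = a
            · subst hla; rw [Matrix.updateRow_self]; exact hv
            · rw [Matrix.updateRow_ne hla]
              exact h1 l (Finset.mem_of_mem_insert_of_ne hl hla)
          · intro l hl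
            have hla : l ≠ a := fun h => hl (h ▸ Finset.mem_insert_self _ _)
            rw [Matrix.updateRow_ne hla]
            exact h2 l (fun h => hl (Finset.mem_insert_of_mem h))
        | zero => exact Matrix.det_eq_zero_of_row_eq_zero a (by simp)
        | add x y _ _ hx hy => rw [Matrix.det_updateRow_add, hx, hy, add_zero]
        | smul c x _ hx => rw [Matrix.det_updateRow_smul, hx, mul_zero]
      have h5 := h4 (N a) (by rw [h2 a ha]; exact hV a)
      rwa [Matrix.updateRow_eq_self] at h5
  obtain ⟨N, h1, _, h3⟩ := key Finset.univ
  exact ⟨N, fun l => h1 l (Finset.mem_univ l), h3⟩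

section W
variable {n : ℕ}

/-- diagonal operator -/
noncomputable def dg (c : (Fin n →₀ ℕ) → ℚ) : MvPolynomial (Fin n) ℚ →ₗ[ℚ] MvPolynomial (Fin n) ℚ :=
  (basisMonomials (Fin n) ℚ).constr ℚ fun m => monomial m (c m)

lemma dg_monomial (c : (Fin n →₀ ℕ) → ℚ) (m : Fin n →₀ ℕ) (a : ℚ) :
    dg c (monomial m a) = monomial m (a * c m) := by
  have h : (monomial m a : MvPolynomial (Fin n) ℚ) = a • basisMonomials (Fin n) ℚ m := by
    rw [coe_basisMonomials, smul_monomial, smul_eq_mul, mul_one]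
  rw [h, map_smul, dg, Module.Basis.constr_basis, smul_monomial, smul_eq_mul]

lemma coeff_dg (c : (Fin n →₀ ℕ) → ℚ) (k : Fin n →₀ ℕ) (f : MvPolynomial (Fin n) ℚ) :
    coeff k (dg c f) = coeff k f * c k := by
  classical
  induction f using MvPolynomial.induction_on' with
  | monomial m a =>
    rw [dg_monomial, coeff_monomial, coeff_monomial]
    split_ifs with h
    · rw [h]
    · simp
  | add p q hp hq => rw [map_add, coeff_add, hp, hq, coeff_add, add_mul]

lemma exists_lam (S : Finset (Fin n →₀ ℕ)) : ∃ c : Fin n → ℚ,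
    Set.InjOn (fun m : Fin n →₀ ℕ => ∑ h, (m h : ℚ) * c h) S := by
  classical
  let v : (S ×ˢ S).filter (fun p => p.1 ≠ p.2) → (Fin n → ℚ) :=
    fun p h => (p.1.1 h : ℚ) - p.1.2 h
  obtain ⟨f, hf⟩ := Module.exists_dual_forall_apply_ne_zero (K := ℚ) v (by
    rintro ⟨⟨a, b⟩, hab⟩ h0
    apply (Finset.mem_filter.1 hab).2
    ext h
    have := congrFun h0 h
    simp only [v, Pi.zero_apply] at this
    exact_mod_cast sub_eq_zero.1 this)
  refine ⟨fun h => f (Pi.single h 1), ?_⟩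
  have hfs : ∀ x : Fin n → ℚ, f x = ∑ h, x h * f (Pi.single h 1) := by
    intro x
    conv_lhs => rw [pi_eq_sum_univ' x, map_sum]
    simp
  intro a ha b hb hab
  by_contra hne
  apply hf ⟨(a, b), Finset.mem_filter.2 ⟨Finset.mem_product.2 ⟨ha, hb⟩, hne⟩⟩
  rw [hfs]
  simp only [v, sub_mul, Finset.sum_sub_distrib]
  exact sub_eq_zero.2 hab

lemma det_dg_ne_zero {s : ℕ} (f : Fin s → MvPolynomial (Fin n) ℚ) (hf : LinearIndependent ℚ f)
    (lam : (Fin n →₀ ℕ) → ℚ)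
    (hlam : Set.InjOn lam ↑(Finset.univ.biUnion fun j => (f j).support)) :
    (Matrix.of fun l j : Fin s => dg (fun m => lam m ^ (l : ℕ)) (f j)).det ≠ 0 := by
  classical
  intro hdet
  obtain ⟨a, ha, haM⟩ := Matrix.exists_vecMul_eq_zero_iff.2 hdet
  have haM' : ∀ c : Fin s → ℚ, ∑ l, a l * dg (fun m => lam m ^ (l : ℕ)) (∑ j, c j • f j) = 0 := by
    intro c
    have : ∀ j, ∑ l, a l * dg (fun m => lam m ^ (l : ℕ)) (f j) = 0 := by
      intro j
      exact congrFun haM j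
    calc ∑ l, a l * dg (fun m => lam m ^ (l : ℕ)) (∑ j, c j • f j)
        = ∑ l, ∑ j, c j • (a l * dg (fun m => lam m ^ (l : ℕ)) (f j)) := by
          refine Finset.sum_congr rfl fun l _ => ?_
          rw [map_sum, Finset.mul_sum]
          refine Finset.sum_congr rfl fun j _ => ?_
          rw [map_smul, mul_smul_comm]
      _ = ∑ j, c j • ∑ l, a l * dg (fun m => lam m ^ (l : ℕ)) (f j) := by
          rw [Finset.sum_comm]
          simp_rw [Finset.smul_sum]
      _ = 0 := by simp [this]
  let o : MonomialOrder (Fin n) := MonomialOrder.lex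
  obtain ⟨l1, hl1⟩ := Function.ne_iff.1 ha
  obtain ⟨l0, hl0, hmax⟩ := Finset.exists_max_image
    (Finset.univ.filter fun l => a l ≠ 0) (fun l => o.toSyn (o.degree (a l)))
    ⟨l1, Finset.mem_filter.2 ⟨Finset.mem_univ _, hl1⟩⟩
  set μ := o.degree (a l0) with hμ
  have hle : ∀ l, o.toSyn (o.degree (a l)) ≤ o.toSyn μ := by
    intro l
    by_cases h : a l = 0
    · rw [h, MonomialOrder.degree_zero, map_zero]; exact bot_le
    · exact hmax l (Finset.mem_filter.2 ⟨Finset.mem_univ _, h⟩)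
  let χ : Polynomial ℚ := ∑ l : Fin s, Polynomial.monomial (l : ℕ) (coeff μ (a l))
  have hχc : ∀ l : Fin s, χ.coeff l = coeff μ (a l) := by
    intro l
    simp only [χ, Polynomial.finset_sum_coeff, Polynomial.coeff_monomial]
    rw [Finset.sum_eq_single l]
    · simp
    · intro b _ hb
      rw [if_neg]
      exact fun h => hb (Fin.ext h)
    · simp
  have hχ0 : χ ≠ 0 := by
    intro h
    have h1 := hχc l0
    rw [h, Polynomial.coeff_zero] at h1
    exact (MonomialOrder.coeff_degree_ne_zero_iff (m := o)).2 (Finset.mem_filter.1 hl0).2 h1.symm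
  have hχd : χ.degree < s := by
    refine lt_of_le_of_lt (Polynomial.degree_sum_le _ _) ?_
    rw [Finset.sup_lt_iff (by exact_mod_cast WithBot.bot_lt_coe s)]
    intro l _
    refine lt_of_le_of_lt (Polynomial.degree_monomial_le _ _) ?_
    exact_mod_cast l.2
  set S := Finset.univ.biUnion fun j => (f j).support with hS
  let D := S.filter fun m => χ.eval (lam m) = 0
  have hD : D.card < s := by
    have h1 : (D.image lam) ⊆ χ.roots.toFinset := by
      intro x hx
      obtain ⟨m, hm, rfl⟩ := Finset.mem_image.1 hx
      rw [Multiset.mem_toFinset, Polynomial.mem_roots hχ0]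
      exact (Finset.mem_filter.1 hm).2
    have h2 : (D.image lam).card = D.card := Finset.card_image_of_injOn
      (hlam.mono (by intro x hx; exact (Finset.mem_filter.1 hx).1))
    rw [← h2]
    have h3 := (Finset.card_le_card h1).trans (Multiset.toFinset_card_le _)
    have h4 := Polynomial.card_roots hχ0
    have h5 : ((D.image lam).card : WithBot ℕ) < s :=
      lt_of_le_of_lt (le_trans (by exact_mod_cast h3) h4) hχd
    exact_mod_cast h5
  let L : (Fin s → ℚ) →ₗ[ℚ] (D → ℚ) :=
    LinearMap.pi fun m => ∑ j, (coeff m.1 (f j)) • LinearMap.proj j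
  have hker := LinearMap.ker_ne_bot_of_finrank_lt (f := L) (by simpa using hD)
  obtain ⟨c, hc, hc0⟩ := Submodule.exists_mem_ne_zero_of_ne_bot hker
  set g := ∑ j, c j • f j with hg
  have hg0 : g ≠ 0 := by
    intro h
    apply hc0
    exact funext fun j => (Fintype.linearIndependent_iff.1 hf) c h j
  have hgc : ∀ m, coeff m g = ∑ j, coeff m (f j) * c j := by
    intro m
    rw [hg, coeff_sum]
    refine Finset.sum_congr rfl fun j _ => ?_
    rw [coeff_smul, smul_eq_mul, mul_comm]
  set ν := o.degree g with hν
  have hνc : coeff ν g ≠ 0 := (MonomialOrder.coeff_degree_ne_zero_iff (m := o)).2 hg0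
  have hνS : ν ∈ S := by
    rw [hgc] at hνc
    obtain ⟨j, _, hj⟩ := Finset.exists_ne_zero_of_sum_ne_zero hνc
    exact Finset.mem_biUnion.2 ⟨j, Finset.mem_univ _, mem_support_iff.2 (left_ne_zero_of_mul hj)⟩
  have hroot : χ.eval (lam ν) = 0 := by
    have h1 := haM' c
    rw [← hg] at h1
    have h2 := congrArg (coeff (μ + ν)) h1
    rw [coeff_sum, coeff_zero] at h2
    have h3 : ∀ l : Fin s, coeff (μ + ν) (a l * dg (fun m => lam m ^ (l : ℕ)) g)
        = coeff μ (a l) * (coeff ν g * lam ν ^ (l : ℕ)) := by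
      intro l
      rw [MonomialOrder.coeff_mul_of_add_of_degree_le (hle l), coeff_dg]
      rw [MonomialOrder.degree_le_iff]
      intro b hb
      apply MonomialOrder.le_degree
      rw [mem_support_iff, coeff_dg] at hb
      exact mem_support_iff.2 (left_ne_zero_of_mul hb)
    simp_rw [h3] at h2
    have h4 : χ.eval (lam ν) = ∑ l : Fin s, coeff μ (a l) * lam ν ^ (l : ℕ) := by
      simp only [χ, Polynomial.eval_finset_sum, Polynomial.eval_monomial]
    have h5 : coeff ν g * χ.eval (lam ν) = 0 := by
      rw [h4, Finset.mul_sum, ← h2]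
      refine Finset.sum_congr rfl fun l _ => ?_
      ring
    exact (mul_eq_zero.1 h5).resolve_left hνc
  have hνD : ν ∈ D := Finset.mem_filter.2 ⟨hνS, hroot⟩
  have hz := congrFun (LinearMap.mem_ker.1 hc) ⟨ν, hνD⟩
  apply hνc
  rw [hgc]
  simpa [L] using hz

/-- functions spanned by binomials of order at most `l` -/
def Gd (n l : ℕ) : Submodule ℚ ((Fin n →₀ ℕ) → ℚ) :=
  Submodule.span ℚ {c | ∃ i : Fin n →₀ ℕ, ∑ h, i h ≤ l ∧ c = fun m => (mch m i : ℚ)}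

lemma mch_mul (m i : Fin n →₀ ℕ) (h : Fin n) :
    (m h : ℚ) * mch m i = (i h + 1) * mch m (i + Finsupp.single h 1) + i h * mch m i := by
  classical
  unfold mch
  have e0 : ∀ f : Fin n → ℕ, ∏ a, f a = f h * ∏ a ∈ Finset.univ.erase h, f a :=
    fun f => (Finset.mul_prod_erase _ _ (Finset.mem_univ h)).symm
  rw [e0, e0 (fun a => (m a).choose ((i + Finsupp.single h 1 : Fin n →₀ ℕ) a))]
  have e1 : ∏ x ∈ Finset.univ.erase h, (m x).choose ((i + Finsupp.single h 1 : Fin n →₀ ℕ) x)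
      = ∏ x ∈ Finset.univ.erase h, (m x).choose (i x) := by
    refine Finset.prod_congr rfl fun x hx => ?_
    have : x ≠ h := Finset.ne_of_mem_erase hx
    simp [Finsupp.single_apply, Ne.symm this]
  rw [e1]
  simp only [Finsupp.add_apply, Finsupp.single_eq_same]
  have e2 := Nat.choose_succ_right_eq (m h) (i h)
  have e3 : ((m h).choose (i h + 1) : ℚ) * (i h + 1) = (m h).choose (i h) * (m h - i h) := by
    by_cases hle : i h ≤ m h
    · have : (((m h).choose (i h + 1) * (i h + 1) : ℕ) : ℚ)
        = (((m h).choose (i h) * (m h - i h) : ℕ) : ℚ) := by exact_mod_cast e2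
      push_cast [Nat.cast_sub hle] at this
      exact this
    · rw [Nat.choose_eq_zero_of_lt (by omega : m h < i h),
        Nat.choose_eq_zero_of_lt (by omega : m h < i h + 1)]
      simp
  push_cast
  linear_combination (-(∏ x ∈ Finset.univ.erase h, (m x).choose (i x) : ℚ)) * e3

lemma Gd_step (l : ℕ) (c : (Fin n →₀ ℕ) → ℚ) (hc : c ∈ Gd n l) (h : Fin n) :
    (fun m => (m h : ℚ) * c m) ∈ Gd n (l + 1) := by
  induction hc using Submodule.span_induction with
  | mem c hc =>
    obtain ⟨i, hi, rfl⟩ := hc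
    have : (fun m : Fin n →₀ ℕ => (m h : ℚ) * mch m i)
        = ((i h : ℚ) + 1) • (fun m => (mch m (i + Finsupp.single h 1) : ℚ))
          + (i h : ℚ) • (fun m => (mch m i : ℚ)) := by
      funext m
      simp only [Pi.add_apply, Pi.smul_apply, smul_eq_mul]
      exact mch_mul m i h
    rw [this]
    refine Submodule.add_mem _ (Submodule.smul_mem _ _ (Submodule.subset_span ⟨_, ?_, rfl⟩))
      (Submodule.smul_mem _ _ (Submodule.subset_span ⟨i, by omega, rfl⟩))
    simp only [Finsupp.add_apply, Finset.sum_add_distrib]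
    have : ∑ x, (Finsupp.single h 1 : Fin n →₀ ℕ) x = 1 := by
      simp [Finsupp.single_apply]
    omega
  | zero => simp only [Pi.zero_apply, mul_zero]; exact Submodule.zero_mem _
  | add x y _ _ hx hy =>
    have := Submodule.add_mem _ hx hy
    convert this using 1
    funext m; simp [mul_add]
  | smul a x _ hx =>
    have := Submodule.smul_mem _ a hx
    convert this using 1
    funext m; simp; ring

lemma Gd_pow (c : Fin n → ℚ) (l : ℕ) :
    (fun m : Fin n →₀ ℕ => (∑ h, (m h : ℚ) * c h) ^ l) ∈ Gd n l := by
  induction l with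
  | zero =>
    apply Submodule.subset_span
    refine ⟨0, by simp, ?_⟩
    funext m; simp [mch]
  | succ l ih =>
    have : (fun m : Fin n →₀ ℕ => (∑ h, (m h : ℚ) * c h) ^ (l + 1))
        = ∑ h, c h • (fun m : Fin n →₀ ℕ => (m h : ℚ) * (∑ h, (m h : ℚ) * c h) ^ l) := by
      funext m
      rw [Finset.sum_apply]
      simp only [Pi.smul_apply, smul_eq_mul]
      rw [pow_succ, mul_comm, Finset.sum_mul]
      refine Finset.sum_congr rfl fun h _ => by ring
    rw [this]
    exact Submodule.sum_mem _ fun h _ => Submodule.smul_mem _ _ (Gd_step l _ ih h)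

lemma dg_mch (i : Fin n →₀ ℕ) (f : MvPolynomial (Fin n) ℚ) :
    dg (fun m => (mch m i : ℚ)) f = monomial i 1 * Dl i f := by
  classical
  induction f using MvPolynomial.induction_on' with
  | monomial m a =>
    rw [dg_monomial, Dl_monomial, monomial_mul, one_mul]
    by_cases h : i ≤ m
    · rw [add_tsub_cancel_of_le h]
    · rw [mch_eq_zero h]; simp
  | add p q hp hq => rw [map_add, hp, hq, map_add, mul_add]

lemma row_mem {s : ℕ} (f : Fin s → MvPolynomial (Fin n) ℚ) (l : ℕ) (c : (Fin n →₀ ℕ) → ℚ)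
    (hc : c ∈ Gd n l) : (fun j => dg c (f j)) ∈
      Submodule.span (MvPolynomial (Fin n) ℚ)
        {v : Fin s → MvPolynomial (Fin n) ℚ | ∃ i : Fin n →₀ ℕ, ∑ h, i h ≤ l ∧
          v = fun j => Dl i (f j)} := by
  induction hc using Submodule.span_induction with
  | mem c hc =>
    obtain ⟨i, hi, rfl⟩ := hc
    have : (fun j => dg (fun m => (mch m i : ℚ)) (f j))
        = (monomial i 1 : MvPolynomial (Fin n) ℚ) • fun j => Dl i (f j) := by
      funext j; rw [dg_mch]; rfl
    rw [this]
    exact Submodule.smul_mem _ _ (Submodule.subset_span ⟨i, hi, rfl⟩)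
  | zero =>
    convert Submodule.zero_mem _ using 1
    funext j; ext k; rw [coeff_dg]; simp
  | add x y _ _ hx hy =>
    convert Submodule.add_mem _ hx hy using 1
    funext j; ext k; simp [coeff_dg, mul_add]
  | smul a x _ hx =>
    convert Submodule.smul_mem _ (C a) hx using 1
    funext j; ext k; simp [coeff_dg]; ring

theorem wronskian {s : ℕ} (f : Fin s → MvPolynomial (Fin n) ℚ) (hf : LinearIndependent ℚ f) :
    ∃ i : Fin s → (Fin n →₀ ℕ), (∀ l, ∑ h, i l h ≤ l) ∧
      (Matrix.of fun l j => Dl (i l) (f j)).det ≠ 0 := by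
  obtain ⟨c, hc⟩ := exists_lam (Finset.univ.biUnion fun j => (f j).support)
  have h1 := det_dg_ne_zero f hf _ hc
  obtain ⟨N, hN, hdet⟩ := det_rows _ (fun l => {v : Fin s → MvPolynomial (Fin n) ℚ |
    ∃ i : Fin n →₀ ℕ, ∑ h, i h ≤ l ∧ v = fun j => Dl i (f j)}) h1
    (fun l => row_mem f l _ (Gd_pow c l))
  choose i hi hiN using hN
  refine ⟨i, hi, ?_⟩
  convert hdet using 2
  funext l
  exact (hiN l).symm
end W
end Sub6

namespace Sub6
open MvPolynomial

lemma one_var (f : Polynomial ℤ) (hf : f ≠ 0) (a : ℤ) (q : ℕ) (hq : 0 < q)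
    (hc : IsCoprime a (q : ℤ)) (k : ℕ)
    (hk : ∀ j < k, (((f.map (Int.castRingHom ℚ)).comp
      (Polynomial.X + Polynomial.C ((a : ℚ) / q))).coeff j) = 0) :
    (q : ℤ) ^ k ≤ |f.leadingCoeff| := by
  have hq0 : (q : ℚ) ≠ 0 := by positivity
  set g := (f.map (Int.castRingHom ℚ)).comp (Polynomial.X + Polynomial.C ((a : ℚ) / q)) with hg
  have h1 : Polynomial.X ^ k ∣ g := Polynomial.X_pow_dvd_iff.2 hk
  obtain ⟨e, he⟩ := h1
  have h2 : f.map (Int.castRingHom ℚ) = g.comp (Polynomial.X - Polynomial.C ((a : ℚ) / q)) := by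
    rw [hg, Polynomial.comp_assoc]; simp
  have h3 : (Polynomial.X - Polynomial.C ((a : ℚ) / q)) ^ k ∣ f.map (Int.castRingHom ℚ) := by
    rw [h2, he, Polynomial.mul_comp, Polynomial.X_pow_comp]
    exact dvd_mul_right _ _
  let L : Polynomial ℤ := Polynomial.C (q : ℤ) * Polynomial.X + Polynomial.C (-a)
  have hL : L.map (Int.castRingHom ℚ)
      = Polynomial.C (q : ℚ) * (Polynomial.X - Polynomial.C ((a : ℚ) / q)) := by
    simp only [L, Polynomial.map_add, Polynomial.map_mul, Polynomial.map_C, Polynomial.map_X]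
    rw [mul_sub, ← Polynomial.C_mul, mul_div_cancel₀ _ hq0]
    simp [sub_eq_add_neg]
  have hprim : L.IsPrimitive := by
    intro r hr
    rw [Polynomial.C_dvd_iff_dvd_coeff] at hr
    have d1 := hr 1
    have d0 := hr 0
    simp only [L, Polynomial.coeff_add, Polynomial.coeff_C_mul, Polynomial.coeff_X_one, mul_one,
      Polynomial.coeff_C_zero, Polynomial.coeff_X_zero, mul_zero, zero_add, dvd_neg,
      Polynomial.coeff_C_succ, add_zero, Polynomial.coeff_C, one_ne_zero, if_false, if_true, dvd_neg] at d1 d0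
    exact hc.isUnit_of_dvd' d0 d1
  have hprimk : (L ^ k).IsPrimitive := by
    clear hk h3 he
    induction k with
    | zero => rw [pow_zero]; exact Polynomial.isPrimitive_one
    | succ k ih => rw [pow_succ]; exact Polynomial.IsPrimitive.mul ih hprim
  have h4 : (L ^ k).map (Int.castRingHom ℚ) ∣ f.map (Int.castRingHom ℚ) := by
    rw [Polynomial.map_pow, hL, mul_pow]
    have hu : IsUnit (Polynomial.C (q : ℚ) ^ k) :=
      (Polynomial.isUnit_C.2 (isUnit_iff_ne_zero.2 hq0)).pow k
    exact (hu.mul_left_dvd).2 h3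
  have h5 : L ^ k ∣ f := by
    exact (Polynomial.IsPrimitive.Int.dvd_iff_map_cast_dvd_map_cast _ _ hprimk).2 h4
  obtain ⟨e2, he2⟩ := h5
  have hlc : L.leadingCoeff = q := by
    have : (q : ℤ) ≠ 0 := by exact_mod_cast hq.ne'
    exact Polynomial.leadingCoeff_linear this
  rw [he2, Polynomial.leadingCoeff_mul, Polynomial.leadingCoeff_pow, hlc, abs_mul, abs_pow,
    Nat.abs_cast]
  have he20 : e2 ≠ 0 := by rintro rfl; exact hf (by rw [he2, mul_zero])
  have : 1 ≤ |e2.leadingCoeff| := Int.one_le_abs (Polynomial.leadingCoeff_ne_zero.2 he20)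
  nlinarith [pow_nonneg (Nat.cast_nonneg (α := ℤ) q) k]

section em
variable {n : ℕ} {R : Type*} [CommRing R]

/-- product of polynomials in the last and the first variables -/
noncomputable def em (P : MvPolynomial (Fin n) R) (Q : MvPolynomial (Fin 1) R) :
    MvPolynomial (Fin (n + 1)) R := rename Fin.succ P * rename (fun _ => 0) Q

lemma mapDomain_succ (m : Fin n →₀ ℕ) : Finsupp.mapDomain Fin.succ m = Finsupp.cons 0 m := by
  ext x
  refine Fin.cases ?_ (fun y => ?_) x
  · rw [Finsupp.mapDomain_notin_range, Finsupp.cons_zero]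
    rintro ⟨y, hy⟩
    exact Fin.succ_ne_zero y hy
  · rw [Finsupp.mapDomain_apply (Fin.succ_injective n), Finsupp.cons_succ]

lemma mapDomain_zero (q : Fin 1 →₀ ℕ) :
    Finsupp.mapDomain (fun _ => (0 : Fin (n + 1))) q = Finsupp.cons (q 0) 0 := by
  have hinj : Function.Injective (fun _ : Fin 1 => (0 : Fin (n + 1))) :=
    fun a b _ => Subsingleton.elim _ _
  ext x
  refine Fin.cases ?_ (fun y => ?_) x
  · rw [Finsupp.cons_zero]
    exact Finsupp.mapDomain_apply hinj q 0
  · rw [Finsupp.mapDomain_notin_range, Finsupp.cons_succ]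
    · rfl
    · rintro ⟨z, hz⟩
      exact Fin.succ_ne_zero y hz.symm

lemma cons_add_cons (a b : ℕ) (m k : Fin n →₀ ℕ) :
    Finsupp.cons a m + Finsupp.cons b k = Finsupp.cons (a + b) (m + k) := by
  ext x
  refine Fin.cases ?_ (fun y => ?_) x
  · simp
  · simp

lemma cons_inj {a b : ℕ} {m k : Fin n →₀ ℕ} :
    Finsupp.cons a m = Finsupp.cons b k ↔ a = b ∧ m = k := by
  constructor
  · intro h
    refine ⟨?_, ?_⟩
    · have := DFunLike.congr_fun h 0; simpa using this
    · ext y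
      have := DFunLike.congr_fun h y.succ; simpa using this
  · rintro ⟨rfl, rfl⟩; rfl

lemma coeff_em (P : MvPolynomial (Fin n) R) (Q : MvPolynomial (Fin 1) R) (j : ℕ)
    (k : Fin n →₀ ℕ) :
    coeff (Finsupp.cons j k) (em P Q) = coeff k P * coeff (Finsupp.single 0 j) Q := by
  classical
  induction P using MvPolynomial.induction_on' with
  | add p q hp hq =>
    have : em (p + q) Q = em p Q + em q Q := by simp [em, add_mul]
    rw [this, coeff_add, hp, hq, coeff_add, add_mul]
  | monomial m a =>
    induction Q using MvPolynomial.induction_on' with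
    | add p q hp hq =>
      have : em (monomial m a) (p + q) = em (monomial m a) p + em (monomial m a) q := by
        simp [em, mul_add]
      rw [this, coeff_add, hp, hq, coeff_add, mul_add]
    | monomial t b =>
      rw [em, rename_monomial, rename_monomial, mapDomain_succ, mapDomain_zero, monomial_mul,
        cons_add_cons, zero_add, add_zero, coeff_monomial, coeff_monomial, coeff_monomial]
      have ht : t = Finsupp.single 0 j ↔ t 0 = j := by
        constructor
        · rintro rfl; simp
        · intro h; refine Finsupp.ext fun x => ?_; rw [Subsingleton.elim x 0, h]; simp
      simp only [cons_inj, ht]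
      by_cases h1 : t 0 = j <;> by_cases h2 : m = k <;> simp [h1, h2]

lemma mch_cons (a b : ℕ) (m k : Fin n →₀ ℕ) :
    mch (Finsupp.cons a m) (Finsupp.cons b k) = a.choose b * mch m k := by
  unfold mch
  rw [Fin.prod_univ_succ]; simp

lemma Dl_em (P : MvPolynomial (Fin n) R) (Q : MvPolynomial (Fin 1) R) (j : ℕ)
    (k : Fin n →₀ ℕ) :
    Dl (Finsupp.cons j k) (em P Q) = em (Dl k P) (Dl (Finsupp.single 0 j) Q) := by
  ext m
  rw [← Finsupp.cons_tail m, coeff_em, coeff_Dl, coeff_Dl, coeff_Dl, cons_add_cons, coeff_em,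
    mch_cons, ← Finsupp.single_add]
  have : mch (Finsupp.single (0 : Fin 1) (m 0 + j)) (Finsupp.single 0 j) = (m 0 + j).choose j := by
    simp [mch]
  rw [this]
  push_cast; ring

lemma Tr_em (ξ : Fin (n + 1) → R) (P : MvPolynomial (Fin n) R) (Q : MvPolynomial (Fin 1) R) :
    Tr ξ (em P Q) = em (Tr (fun h => ξ h.succ) P) (Tr (fun _ => ξ 0) Q) := by
  have h1 : (Tr ξ).comp (rename Fin.succ)
      = (rename Fin.succ).comp (Tr fun h : Fin n => ξ h.succ) := by
    apply algHom_ext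
    intro h
    simp [Tr]
  have h2 : (Tr ξ).comp (rename (fun _ : Fin 1 => (0 : Fin (n + 1))))
      = (rename (fun _ => 0)).comp (Tr fun _ : Fin 1 => ξ 0) := by
    apply algHom_ext
    intro h
    simp [Tr]
  rw [em, em, map_mul]
  congr 1
  · exact DFunLike.congr_fun h1 P
  · exact DFunLike.congr_fun h2 Q

/-- univariate version -/
noncomputable def io : MvPolynomial (Fin 1) R →ₐ[R] Polynomial R := aeval fun _ => Polynomial.X

lemma coeff_io (Q : MvPolynomial (Fin 1) R) (j : ℕ) :
    (io Q).coeff j = coeff (Finsupp.single 0 j) Q := by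
  classical
  induction Q using MvPolynomial.induction_on' with
  | add p q hp hq => rw [map_add, Polynomial.coeff_add, hp, hq, coeff_add]
  | monomial t b =>
    have ht : t = Finsupp.single 0 j ↔ t 0 = j := by
      constructor
      · rintro rfl; simp
      · intro h; refine Finsupp.ext fun x => ?_; rw [Subsingleton.elim x 0, h]; simp
    rw [io, aeval_monomial, coeff_monomial, Finsupp.prod_fintype _ _ (by simp)]
    simp only [ht, Fin.prod_univ_one]
    rw [Polynomial.algebraMap_eq, Polynomial.coeff_C_mul, Polynomial.coeff_X_pow]
    by_cases h : t 0 = j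
    · simp [h]
    · simp [h, Ne.symm h]

lemma io_Tr (x : R) (Q : MvPolynomial (Fin 1) R) :
    io (Tr (fun _ => x) Q) = (io Q).comp (Polynomial.X + Polynomial.C x) := by
  have : (io).comp (Tr fun _ : Fin 1 => x)
      = (Polynomial.compRingHom (Polynomial.X + Polynomial.C x) |> fun _ =>
        (Polynomial.aeval (Polynomial.X + Polynomial.C x) : Polynomial R →ₐ[R] Polynomial R)).comp
        io := by
    apply algHom_ext
    intro h
    simp [Tr, io]
  have h2 := DFunLike.congr_fun this Q
  simp only [AlgHom.comp_apply] at h2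
  rw [h2, Polynomial.aeval_def, Polynomial.algebraMap_eq]; rfl
end em

section decomp
variable {n : ℕ}

/-- coefficient of the first variable -/
noncomputable def cf (F : MvPolynomial (Fin (n + 1)) ℤ) (j : ℕ) : MvPolynomial (Fin n) ℤ :=
  Polynomial.coeff (finSuccEquiv ℤ n F) j

lemma coeff_cf (F : MvPolynomial (Fin (n + 1)) ℤ) (j : ℕ) (k : Fin n →₀ ℕ) :
    coeff k (cf F j) = coeff (Finsupp.cons j k) F := finSuccEquiv_coeff_coeff k F j

lemma l1_cf (F : MvPolynomial (Fin (n + 1)) ℤ) (j : ℕ) : l1 (cf F j) ≤ l1 F := by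
  have h : l1 (cf F j) = ∑ m ∈ (cf F j).support.map
      ⟨fun k => Finsupp.cons j k, fun a b h => (cons_inj.1 h).2⟩, ‖coeff m F‖ := by
    rw [Finset.sum_map, l1]
    refine Finset.sum_congr rfl fun m _ => ?_
    rw [coeff_cf]; rfl
  rw [h]; exact sum_coeff_le_l1 _ _

local notation "mQ" => MvPolynomial.map (Int.castRingHom ℚ)

lemma decomp (F : MvPolynomial (Fin (n + 1)) ℤ) (hF : F ≠ 0) (r0 : ℕ)
    (hdeg : ∀ m, coeff m F ≠ 0 → m 0 ≤ r0) :
    ∃ (s : ℕ) (e : Fin s → ℕ) (ψ : Fin s → MvPolynomial (Fin 1) ℚ), 0 < s ∧ s ≤ r0 + 1 ∧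
      LinearIndependent ℚ (fun t => mQ (cf F (e t))) ∧ LinearIndependent ℚ ψ ∧
      mQ F = ∑ t, em (mQ (cf F (e t))) (ψ t) := by
  classical
  let v : Fin (r0 + 1) → MvPolynomial (Fin n) ℚ := fun j => mQ (cf F j)
  obtain ⟨κ, a, ha, hspan, hli⟩ := exists_linearIndependent' ℚ v
  haveI : Finite κ := Finite.of_injective a ha
  haveI : Fintype κ := Fintype.ofFinite κ
  let E := (Fintype.equivFin κ).symm
  set s := Fintype.card κ
  have hli' : LinearIndependent ℚ (fun t : Fin s => v (a (E t))) := hli.comp E E.injective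
  have hmem : ∀ j, ∃ c : Fin s → ℚ, ∑ t, c t • v (a (E t)) = v j := by
    intro j
    have h1 : v j ∈ Submodule.span ℚ (Set.range fun t : Fin s => v (a (E t))) := by
      have : Set.range (fun t : Fin s => v (a (E t))) = Set.range (v ∘ a) :=
        E.surjective.range_comp (v ∘ a)
      rw [this, hspan]
      exact Submodule.subset_span ⟨j, rfl⟩
    exact (Submodule.mem_span_range_iff_exists_fun ℚ).1 h1
  choose c hc using hmem
  have hcd : ∀ t t', c (a (E t)) t' = if t' = t then 1 else 0 := by
    intro t t'
    have h1 : ∑ u, (c (a (E t)) u - if u = t then 1 else 0) • v (a (E u)) = 0 := by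
      simp only [sub_smul, Finset.sum_sub_distrib, hc, ite_smul, one_smul, zero_smul]
      simp
    exact sub_eq_zero.1 ((Fintype.linearIndependent_iff.1 hli') _ h1 t')
  let ψ : Fin s → MvPolynomial (Fin 1) ℚ :=
    fun t => ∑ j : Fin (r0 + 1), monomial (Finsupp.single 0 (j : ℕ)) (c j t)
  have hψc : ∀ t (j : Fin (r0 + 1)), coeff (Finsupp.single 0 (j : ℕ)) (ψ t) = c j t := by
    intro t j
    simp only [ψ, coeff_sum, coeff_monomial]
    rw [Finset.sum_eq_single j]
    · simp
    · intro b _ hb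
      rw [if_neg]
      intro h
      apply hb
      have := DFunLike.congr_fun h 0
      exact Fin.ext (by simpa using this)
    · simp
  have hψc0 : ∀ t (j : ℕ), r0 < j → coeff (Finsupp.single 0 (j : ℕ)) (ψ t) = 0 := by
    intro t j hj
    simp only [ψ, coeff_sum, coeff_monomial]
    refine Finset.sum_eq_zero fun b _ => ?_
    rw [if_neg]
    intro h
    have := DFunLike.congr_fun h 0
    have hb := b.2
    simp at this
    omega
  have hdec : mQ F = ∑ t, em (mQ (cf F (a (E t)))) (ψ t) := by
    ext m
    rw [← Finsupp.cons_tail m, coeff_sum]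
    simp only [coeff_em]
    by_cases hm : m 0 ≤ r0
    · have h1 : ∀ t, coeff (Finsupp.single 0 (m 0)) (ψ t) = c ⟨m 0, by omega⟩ t :=
        fun t => hψc t ⟨m 0, by omega⟩
      simp only [h1]
      have h2 := congrArg (coeff m.tail) (hc ⟨m 0, by omega⟩)
      rw [coeff_sum] at h2
      simp only [v, coeff_smul, smul_eq_mul] at h2
      rw [coeff_map, coeff_cf] at h2
      rw [coeff_map, ← h2]
      exact Finset.sum_congr rfl fun t _ => mul_comm _ _
    · rw [Finset.sum_eq_zero fun t _ => by rw [hψc0 t _ (by omega), mul_zero], coeff_map]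
      have : coeff (Finsupp.cons (m 0) m.tail) F = 0 := by
        by_contra h
        have := hdeg _ h
        simp at this
        omega
      rw [this]; simp
  refine ⟨s, fun t => a (E t), ψ, ?_, ?_, hli', ?_, hdec⟩
  · rcases Nat.eq_zero_or_pos s with h0 | h0
    · exfalso
      apply hF
      haveI : IsEmpty (Fin s) := by rw [h0]; infer_instance
      rw [Finset.univ_eq_empty, Finset.sum_empty] at hdec
      exact map_injective _ (Int.castRingHom ℚ).injective_int (by rw [hdec, map_zero])
    · exact h0
  · have := Fintype.card_le_of_injective a ha
    simpa using this
  · rw [Fintype.linearIndependent_iff]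
    intro g hg t
    have h1 := congrArg (coeff (Finsupp.single 0 ((a (E t) : Fin (r0 + 1)) : ℕ))) hg
    rw [coeff_sum] at h1
    simpa [hψc, hcd] using h1

/-- the Wronskian construction -/
lemma wron_split (F : MvPolynomial (Fin (n + 1)) ℤ) (hF : F ≠ 0) (r0 : ℕ)
    (hdeg : ∀ m, coeff m F ≠ 0 → m 0 ≤ r0) :
    ∃ (s : ℕ) (e : Fin s → ℕ) (i : Fin s → (Fin n →₀ ℕ)) (j : Fin s → ℕ)
      (V : MvPolynomial (Fin 1) ℚ), 0 < s ∧ s ≤ r0 + 1 ∧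
      (∀ l, ∑ h, i l h ≤ l) ∧ (∀ l, j l ≤ l) ∧
      (Matrix.of fun l t => Dl (i l) (cf F (e t))).det ≠ 0 ∧ V ≠ 0 ∧
      mQ (Matrix.of fun l k => Dl (Finsupp.cons (j k) (i l)) F).det
        = em (mQ (Matrix.of fun l t => Dl (i l) (cf F (e t))).det) V := by
  obtain ⟨s, e, ψ, hs, hs1, hφ, hψ, hdec⟩ := decomp F hF r0 hdeg
  obtain ⟨i, hi, hU⟩ := wronskian _ hφ
  obtain ⟨j, hj, hV⟩ := wronskian _ hψ
  have hU' : mQ (Matrix.of fun l t => Dl (i l) (cf F (e t))).det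
      = (Matrix.of fun l t => Dl (i l) (mQ (cf F (e t)))).det := by
    rw [RingHom.map_det]
    congr 1
    ext l t : 2
    simp only [RingHom.mapMatrix_apply, Matrix.map_apply, Matrix.of_apply, Dl_map]
  have hjs : ∀ k, j k = Finsupp.single 0 (j k 0) := by
    intro k; refine Finsupp.ext fun x => ?_; rw [Subsingleton.elim x 0]; simp
  refine ⟨s, e, i, fun k => j k 0, (Matrix.of fun k t => Dl (j k) (ψ t)).det, hs, hs1, hi,
    fun l => by simpa using hj l, ?_, hV, ?_⟩
  · intro h
    rw [← hU', h, map_zero] at hU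
    exact hU rfl
  · rw [hU', em, AlgHom.map_det, AlgHom.map_det, ← Matrix.det_transpose
      ((rename (fun _ : Fin 1 => (0 : Fin (n + 1)))).mapMatrix _), ← Matrix.det_mul,
      RingHom.map_det]
    congr 1
    refine Matrix.ext fun l k => ?_
    rw [RingHom.mapMatrix_apply, Matrix.map_apply, Matrix.of_apply, ← Dl_map, hdec, map_sum,
      Matrix.mul_apply]
    refine Finset.sum_congr rfl fun t _ => ?_
    rw [Dl_em, ← hjs]
    rfl
end decomp
end Sub6

namespace Sub6
open MvPolynomial

lemma count_sum (s r0 : ℕ) (hr0 : 0 < r0) (hs : s ≤ 2 * r0) (Θ : ℝ) (h0 : 0 < Θ)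
    (h1 : Θ ≤ 1) : (s : ℝ) * Θ ^ 2 / 8 ≤ ∑ k : Fin s, max 0 (Θ - (k : ℕ) / r0) := by
  have hr : (0 : ℝ) < r0 := by exact_mod_cast hr0
  rw [Fin.sum_univ_eq_sum_range (fun k => max 0 (Θ - (k : ℝ) / r0)) s]
  set x := (r0 : ℝ) * Θ / 2 with hx
  have hx0 : 0 < x := by positivity
  set M := min s (⌊x⌋₊ + 1) with hM
  have hsub : Finset.range M ⊆ Finset.range s := Finset.range_mono (min_le_left _ _)
  have h2 : ∑ k ∈ Finset.range M, Θ / 2 ≤ ∑ k ∈ Finset.range s, max 0 (Θ - (k : ℝ) / r0) := by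
    refine le_trans (Finset.sum_le_sum (g := fun k : ℕ => max 0 (Θ - (k : ℝ) / r0)) ?_)
      (Finset.sum_le_sum_of_subset_of_nonneg hsub fun _ _ _ => le_max_left _ _)
    intro k hk
    refine le_trans ?_ (le_max_right _ _)
    have hk2 : k < ⌊x⌋₊ + 1 := lt_of_lt_of_le (Finset.mem_range.1 hk) (min_le_right _ _)
    have hk3 : (k : ℝ) ≤ x := (Nat.le_floor_iff hx0.le).1 (by omega)
    have : (k : ℝ) / r0 ≤ Θ / 2 := by
      rw [div_le_iff₀ hr]; rw [hx] at hk3; linarith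
    linarith
  rw [Finset.sum_const, Finset.card_range, nsmul_eq_mul] at h2
  refine le_trans ?_ h2
  have h3 : (s : ℝ) * Θ / 4 ≤ M := by
    rw [hM]; push_cast
    apply le_min
    · nlinarith [Nat.cast_nonneg (α := ℝ) s]
    · have := Nat.lt_floor_add_one x
      have hs' : (s : ℝ) ≤ 2 * r0 := by exact_mod_cast hs
      nlinarith
  nlinarith

local notation "mQ" => MvPolynomial.map (Int.castRingHom ℚ)

lemma mQ_inj {n : ℕ} {F : MvPolynomial (Fin n) ℤ} (h : F ≠ 0) : mQ F ≠ 0 := by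
  intro h0
  exact h (map_injective _ (Int.castRingHom ℚ).injective_int (by rw [h0, map_zero]))

lemma coeff_mQ {n : ℕ} (F : MvPolynomial (Fin n) ℤ) (m) : coeff m (mQ F) = ((coeff m F : ℤ) : ℚ) := by
  rw [coeff_map]; rfl

lemma slice_bound {n : ℕ} (W : MvPolynomial (Fin (n + 1)) ℤ) (U : MvPolynomial (Fin n) ℤ)
    (V : MvPolynomial (Fin 1) ℚ) (hU : U ≠ 0) (hV : V ≠ 0) (h : mQ W = em (mQ U) V)
    (a : ℤ) (q : ℕ) (hq : 0 < q) (hc : IsCoprime a (q : ℤ)) :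
    ∃ k, coeff (Finsupp.single 0 k) (Tr (fun _ => (a : ℚ) / q) V) ≠ 0 ∧
      k * Real.log q ≤ Real.log (l1 W) := by
  classical
  obtain ⟨μ, hμ⟩ := ne_zero_iff.1 hU
  set TV := Tr (fun _ => (a : ℚ) / q) V with hTV
  have hex : ∃ k, coeff (Finsupp.single 0 k) TV ≠ 0 := by
    obtain ⟨m, hm⟩ := ne_zero_iff.1 (Tr_ne_zero (fun _ => (a : ℚ) / q) hV)
    refine ⟨m 0, ?_⟩
    have : m = Finsupp.single 0 (m 0) := by
      refine Finsupp.ext fun x => ?_; rw [Subsingleton.elim x 0]; simp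
    rw [← this]; exact hm
  refine ⟨Nat.find hex, Nat.find_spec hex, ?_⟩
  let V' : Polynomial ℤ := 
    ∑ j ∈ Finset.range (W.degreeOf 0 + 1), Polynomial.monomial j (coeff (Finsupp.cons j μ) W)
  have hV'c : ∀ j, V'.coeff j = coeff (Finsupp.cons j μ) W := by
    intro j
    simp only [V', Polynomial.finset_sum_coeff, Polynomial.coeff_monomial]
    rw [Finset.sum_ite_eq' (Finset.range _) j]
    split_ifs with hj
    · rfl
    · symm
      by_contra hne
      apply hj
      rw [Finset.mem_range]
      have := monomial_le_degreeOf 0 (mem_support_iff.2 hne)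
      simp at this
      omega
  have hVW : V'.map (Int.castRingHom ℚ) = Polynomial.C ((coeff μ U : ℤ) : ℚ) * io V := by
    ext j
    rw [Polynomial.coeff_map, hV'c, Polynomial.coeff_C_mul, coeff_io]
    have := congrArg (coeff (Finsupp.cons j μ)) h
    rw [coeff_em, coeff_mQ, coeff_mQ] at this
    exact this
  have hμ' : ((coeff μ U : ℤ) : ℚ) ≠ 0 := by exact_mod_cast hμ
  have hV'0 : V' ≠ 0 := by
    intro h0
    rw [h0, Polynomial.map_zero] at hVW
    have h1 : io V = 0 := by
      rcases mul_eq_zero.1 hVW.symm with h2 | h2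
      · exact absurd (Polynomial.C_eq_zero.1 h2) hμ'
      · exact h2
    apply hV
    ext m
    have : m = Finsupp.single 0 (m 0) := by
      refine Finsupp.ext fun x => ?_; rw [Subsingleton.elim x 0]; simp
    rw [this, ← coeff_io, h1]; simp
  have h1 := one_var V' hV'0 a q hq hc (Nat.find hex) (by
    intro j hj
    rw [hVW, Polynomial.mul_comp, Polynomial.C_comp, ← io_Tr, Polynomial.coeff_C_mul, coeff_io]
    have := Nat.find_min hex hj
    push Not at this
    rw [this, mul_zero])
  have h2 : (|V'.leadingCoeff| : ℝ) ≤ l1 W := by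
    have := norm_coeff_le_l1 W (Finsupp.cons V'.natDegree μ)
    rw [← hV'c, Int.norm_eq_abs] at this
    exact this
  have h3 : ((q : ℝ)) ^ Nat.find hex ≤ l1 W := by
    refine le_trans ?_ h2
    exact_mod_cast h1
  have hq' : (0 : ℝ) < q := by exact_mod_cast hq
  rw [← Real.log_pow]
  exact Real.log_le_log (by positivity) h3

/-- weights -/
noncomputable def wt {n : ℕ} (r : Fin n → ℕ) : (Fin n →₀ ℕ) →+ ℝ where
  toFun m := ∑ h, (m h : ℝ) / r h
  map_zero' := by simp
  map_add' a b := by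
    rw [← Finset.sum_add_distrib]
    refine Finset.sum_congr rfl fun h _ => ?_
    simp [add_div]

lemma wt_apply {n : ℕ} (r : Fin n → ℕ) (m : Fin n →₀ ℕ) : wt r m = ∑ h, (m h : ℝ) / r h := rfl

/-- degree weight -/
noncomputable def dw {n : ℕ} (h : Fin n) : (Fin n →₀ ℕ) →+ ℝ where
  toFun m := -(m h : ℝ)
  map_zero' := by simp
  map_add' a b := by simp; ring

lemma det_deg {n s : ℕ} (M : Matrix (Fin s) (Fin s) (MvPolynomial (Fin n) ℤ)) (r : Fin n → ℕ)
    (hM : ∀ i j m, coeff m (M i j) ≠ 0 → ∀ h, m h ≤ r h) :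
    ∀ m, coeff m M.det ≠ 0 → ∀ h, m h ≤ s * r h := by
  intro m hm h
  have := Wge.det (w := dw h) M (fun _ => -(r h : ℝ)) (fun l k m hm => by
    have := hM l k m hm h
    show -(r h : ℝ) ≤ -(m h : ℝ)
    simpa using this) m hm
  have h2 : ∑ _k : Fin s, -(r h : ℝ) ≤ -(m h : ℝ) := this
  simp at h2
  exact_mod_cast h2

lemma log_det_bound (s : ℕ) (hs : 0 < s) (D B E : ℝ) (hD : 1 ≤ D) (hB : 1 ≤ B)
    (h : D ≤ s.factorial * B ^ s) (r0 : ℕ) (hsr : s ≤ r0 + 1) (hE : Real.log B ≤ E) :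
    Real.log D ≤ s * (r0 + E) := by
  have h1 : D ≤ ((s : ℝ) * B) ^ s := by
    refine h.trans ?_
    rw [mul_pow]
    refine mul_le_mul_of_nonneg_right ?_ (by positivity)
    exact_mod_cast Nat.factorial_le_pow s
  have h2 := Real.log_le_log (by linarith) h1
  have hs0 : (0 : ℝ) < s := by exact_mod_cast hs
  rw [Real.log_pow, Real.log_mul hs0.ne' (by linarith)] at h2
  have h3 : Real.log s ≤ r0 := by
    have := Real.log_le_sub_one_of_pos hs0
    have : (s : ℝ) ≤ r0 + 1 := by exact_mod_cast hsr
    linarith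
  refine h2.trans ?_
  apply mul_le_mul_of_nonneg_left _ hs0.le
  linarith

/-- conclusion of the Roth lemma in `n` variables -/
def RothConcl (n : ℕ) (ε ω : ℝ) : Prop :=
  ∀ (r : Fin n → ℕ), (∀ h, 0 < r h) → (∀ i j, i < j → (r i : ℝ) ≤ ω * r j) →
    ∀ (a : Fin n → ℤ) (q : Fin n → ℕ), (∀ h, 0 < q h) → (∀ h, IsCoprime (a h) (q h : ℤ)) →
    ∀ A : ℝ, 0 < A → (∀ h, A ≤ r h * Real.log (q h)) → (∀ h, (r h : ℝ) ≤ ω * A) →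
    ∀ F : MvPolynomial (Fin n) ℤ, F ≠ 0 → (∀ m, coeff m F ≠ 0 → ∀ h, m h ≤ r h) →
    Real.log (l1 F) ≤ ω * A →
    ∃ k, coeff k (Tr (fun h => (a h : ℚ) / q h) (mQ F)) ≠ 0 ∧ ∑ h, (k h : ℝ) / r h < ε

set_option maxHeartbeats 1000000 in
lemma roth_step (n : ℕ) (ε ε' ω' ω : ℝ) (hε : 0 < ε) (hε1 : ε ≤ 1) (hε' : ε' = ε ^ 2 / 100)
    (hω : 0 < ω) (hω1 : (n + 4) * ω ≤ ω') (hω2 : (n + 4) * ω ≤ ε ^ 2 / 100)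
    (ih : RothConcl n ε' ω') : RothConcl (n + 1) ε ω := by
  classical
  intro r hr hrat a q hq hcop A hA hAq hrA F hF hdeg hl
  obtain ⟨s, e, i, j, V, hs, hsr, hi, hj, hU, hV, hW⟩ :=
    wron_split F hF (r 0) (fun m hm => hdeg m hm 0)
  set U := (Matrix.of fun l t => Dl (i l) (cf F (e t))).det with hUdef
  set W := (Matrix.of fun l k => Dl (Finsupp.cons (j k) (i l)) F).det with hWdef
  have hr0 : (0 : ℝ) < r 0 := by exact_mod_cast hr 0
  have hs0 : (0 : ℝ) < s := by exact_mod_cast hs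
  have hWne : W ≠ 0 := by
    intro h0
    obtain ⟨μ, hμ⟩ := ne_zero_iff.1 hU
    obtain ⟨ν, hν⟩ := ne_zero_iff.1 hV
    have hνs : ν = Finsupp.single 0 (ν 0) := by
      refine Finsupp.ext fun x => ?_; rw [Subsingleton.elim x 0]; simp
    rw [h0, map_zero] at hW
    have := congrArg (coeff (Finsupp.cons (ν 0) μ)) hW
    rw [coeff_em, coeff_zero, ← hνs, coeff_mQ] at this
    rcases mul_eq_zero.1 this.symm with h | h
    · exact hμ (by exact_mod_cast h)
    · exact hν h
  set B : ℝ := 2 ^ (∑ h, r h) * l1 F with hB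
  have hlF : 1 ≤ l1 F := one_le_l1 F hF
  have hB1 : 1 ≤ B := by
    have : (1 : ℝ) ≤ 2 ^ (∑ h, r h) := one_le_pow₀ (by norm_num)
    nlinarith
  have hlogB : Real.log B ≤ (n + 2) * (ω * A) := by
    rw [hB, Real.log_mul (by positivity) (by linarith), Real.log_pow]
    have h1 : ((∑ h, r h : ℕ) : ℝ) ≤ (n + 1) * (ω * A) := by
      push_cast
      refine (Finset.sum_le_sum fun h _ => hrA h).trans ?_
      simp
    have h2 : Real.log 2 ≤ 1 := by
      have := Real.log_two_lt_d9; linarith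
    have h3 : 0 ≤ Real.log 2 := Real.log_nonneg (by norm_num)
    have h4 : (0 : ℝ) ≤ ((∑ h, r h : ℕ) : ℝ) := Nat.cast_nonneg _
    nlinarith
  have hUl : l1 U ≤ s.factorial * B ^ s := by
    apply l1_det
    intro l t
    refine (l1_Dl _ _ (fun h => r h.succ) (fun m hm h => ?_)).trans ?_
    · rw [coeff_cf] at hm
      have := hdeg _ hm h.succ
      simpa using this
    · rw [hB]
      apply mul_le_mul _ (l1_cf _ _) (l1_nonneg _) (by positivity)
      apply pow_le_pow_right₀ (by norm_num)
      rw [Fin.sum_univ_succ]; omega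
  have hWl : l1 W ≤ s.factorial * B ^ s := by
    apply l1_det
    intro l t
    exact l1_Dl _ _ r hdeg
  have hE : (r 0 : ℝ) + (n + 2) * (ω * A) ≤ (n + 4) * ω * A := by
    have := hrA 0
    nlinarith [mul_pos hω hA]
  have hUlog : Real.log (l1 U) ≤ s * ((n + 4) * ω * A) :=
    (log_det_bound s hs _ B _ (one_le_l1 U hU) hB1 hUl (r 0) hsr hlogB).trans
      (mul_le_mul_of_nonneg_left hE hs0.le)
  have hWlog : Real.log (l1 W) ≤ s * ((n + 4) * ω * A) :=
    (log_det_bound s hs _ B _ (one_le_l1 W hWne) hB1 hWl (r 0) hsr hlogB).trans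
      (mul_le_mul_of_nonneg_left hE hs0.le)
  have hωω : ω ≤ (n + 4) * ω := by nlinarith [Nat.cast_nonneg (α := ℝ) n]
  -- index of U
  obtain ⟨kU, hkU, hkU2⟩ := ih (fun h => s * r h.succ) (fun h => Nat.mul_pos hs (hr _))
    (fun x y hxy => by
      have := hrat x.succ y.succ (Fin.succ_lt_succ_iff.2 hxy)
      push_cast
      have h2 : (0 : ℝ) ≤ r y.succ := Nat.cast_nonneg _
      nlinarith [mul_le_mul_of_nonneg_right (hωω.trans hω1) h2])
    (fun h => a h.succ) (fun h => q h.succ) (fun h => hq _) (fun h => hcop _)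
    (s * A) (by positivity)
    (fun h => by
      push_cast
      rw [mul_assoc]
      exact mul_le_mul_of_nonneg_left (hAq _) hs0.le)
    (fun h => by
      push_cast
      have := hrA h.succ
      have h2 := mul_le_mul_of_nonneg_right (hωω.trans hω1) hA.le
      nlinarith)
    U hU (det_deg _ _ (fun l t m hm h => by
      rw [Matrix.of_apply, coeff_Dl, coeff_cf] at hm
      have := hdeg _ (left_ne_zero_of_mul hm) h.succ
      simp at this
      show m h ≤ r h.succ
      omega))
    (hUlog.trans (by
      have := mul_le_mul_of_nonneg_right hω1 (by positivity : 0 ≤ (s : ℝ) * A)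
      linarith))
  obtain ⟨k0, hk0, hk02⟩ := slice_bound W U V hU hV hW (a 0) (q 0) (hq 0) (hcop 0)
  set ξ : Fin (n + 1) → ℚ := fun h => (a h : ℚ) / q h with hξ
  have hTW : coeff (Finsupp.cons k0 kU) (Tr ξ (mQ W)) ≠ 0 := by
    rw [hW, Tr_em, coeff_em]
    exact mul_ne_zero hkU hk0
  -- upper bound
  have hup : wt r (Finsupp.cons k0 kU) < s * (ε ^ 2 / 50) := by
    rw [wt_apply, Fin.sum_univ_succ]
    simp only [Finsupp.cons_zero, Finsupp.cons_succ]
    have h1 : ∑ h, (kU h : ℝ) / r h.succ < s * ε' := by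
      have : ∑ h, (kU h : ℝ) / ((s * r h.succ : ℕ) : ℝ) = (∑ h, (kU h : ℝ) / r h.succ) / s := by
        rw [Finset.sum_div]
        refine Finset.sum_congr rfl fun h _ => ?_
        push_cast
        rw [div_div, mul_comm]
      rw [this, div_lt_iff₀ hs0] at hkU2
      linarith
    have h2 : (k0 : ℝ) / r 0 ≤ s * (ε ^ 2 / 100) := by
      rw [div_le_iff₀ hr0]
      have hlq : 0 < Real.log (q 0) := by
        by_contra hneg
        have := hAq 0
        push Not at hneg
        nlinarith
      have h3 : (k0 : ℝ) * Real.log (q 0) ≤ s * (ε ^ 2 / 100) * r 0 * Real.log (q 0) := by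
        refine (hk02.trans hWlog).trans ?_
        have h4 : (n + 4) * ω * A ≤ ε ^ 2 / 100 * (r 0 * Real.log (q 0)) :=
          mul_le_mul hω2 (hAq 0) hA.le (by positivity)
        calc (s : ℝ) * ((n + 4) * ω * A) ≤ s * (ε ^ 2 / 100 * (r 0 * Real.log (q 0))) :=
              mul_le_mul_of_nonneg_left h4 hs0.le
          _ = _ := by ring
      exact le_of_mul_le_mul_right h3 hlq
    rw [hε'] at h1
    linarith
  -- lower bound
  by_contra hcon
  push Not at hcon
  have hWge : Wge (wt r) ε (Tr ξ (mQ F)) := fun m hm => hcon m hm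
  have hω2' : ω ≤ ε ^ 2 / 100 := hωω.trans hω2
  have hsr2 : (s : ℝ) ≤ 2 * r 0 := by
    have : s ≤ 2 * r 0 := by have := hr 0; omega
    exact_mod_cast this
  set Θ := ε - 2 * ω with hΘ
  have hTdet : Tr ξ (mQ W) = (Matrix.of fun l k => Tr ξ (mQ (Dl (Finsupp.cons (j k) (i l)) F))).det := by
    rw [hWdef, RingHom.map_det, AlgHom.map_det]
    rfl
  have hWW : Wge (wt r) (∑ k : Fin s, max 0 (Θ - (k : ℕ) / (r 0 : ℝ))) (Tr ξ (mQ W)) := by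
    rw [hTdet]
    apply Wge.det
    intro l k
    rw [Matrix.of_apply, ← Dl_map, ← Dl_Tr]
    intro m hm
    apply max_le
    · rw [wt_apply]; positivity
    have h1 := hWge.Dl (Finsupp.cons (j k) (i l)) m hm
    refine le_trans ?_ h1
    rw [wt_apply, Fin.sum_univ_succ]
    simp only [Finsupp.cons_zero, Finsupp.cons_succ]
    have h2 : (j k : ℝ) / r 0 ≤ (k : ℕ) / (r 0 : ℝ) := by
      apply div_le_div_of_nonneg_right _ hr0.le
      exact_mod_cast hj k
    have h3 : ∑ h, (i l h : ℝ) / r h.succ ≤ 2 * ω := by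
      have h4 : ∀ h : Fin n, (i l h : ℝ) / r h.succ ≤ i l h * (ω / r 0) := by
        intro h
        rw [div_eq_mul_inv]
        apply mul_le_mul_of_nonneg_left _ (Nat.cast_nonneg _)
        have hrs : (0 : ℝ) < r h.succ := by exact_mod_cast hr _
        rw [inv_eq_one_div, div_le_div_iff₀ hrs hr0, one_mul]
        exact hrat 0 h.succ (Fin.succ_pos h)
      refine (Finset.sum_le_sum fun h _ => h4 h).trans ?_
      rw [← Finset.sum_mul]
      have h5 : ∑ h, (i l h : ℝ) ≤ s := by
        have : ∑ h, i l h ≤ s := (hi l).trans l.2.le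
        exact_mod_cast this
      calc (∑ h, (i l h : ℝ)) * (ω / r 0) ≤ (2 * r 0) * (ω / r 0) :=
            mul_le_mul_of_nonneg_right (h5.trans hsr2) (by positivity)
        _ = 2 * ω := by field_simp
    linarith
  have hlow := hWW _ hTW
  have hΘ1 : ε / 2 ≤ Θ := by rw [hΘ]; nlinarith
  have hcount := count_sum s (r 0) (hr 0) (by have := hr 0; omega) Θ (by linarith)
    (by rw [hΘ]; linarith)
  have : (s : ℝ) * Θ ^ 2 / 8 ≥ s * (ε ^ 2 / 32) := by
    have : (ε / 2) ^ 2 ≤ Θ ^ 2 := pow_le_pow_left₀ (by positivity) hΘ1 2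
    have h8 := mul_le_mul_of_nonneg_left this hs0.le
    have e8 : (s : ℝ) * (ε / 2) ^ 2 = 8 * (s * (ε ^ 2 / 32)) := by ring
    rw [e8] at h8
    linarith
  have h9 : (s : ℝ) * (ε ^ 2 / 50) ≤ s * (ε ^ 2 / 32) := by
    apply mul_le_mul_of_nonneg_left _ hs0.le
    linarith [sq_nonneg ε]
  linarith

theorem roth_lemma (n : ℕ) : ∀ ε : ℝ, 0 < ε → ∃ ω : ℝ, 0 < ω ∧ RothConcl n ε ω := by
  induction n with
  | zero =>
    intro ε hε
    refine ⟨1, one_pos, ?_⟩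
    intro r _ _ a q _ _ A _ _ _ F hF _ _
    obtain ⟨k, hk⟩ := ne_zero_iff.1 (Tr_ne_zero (fun h => (a h : ℚ) / q h) (mQ_inj hF))
    exact ⟨k, hk, by simpa using hε⟩
  | succ n ih =>
    intro ε hε
    set ε1 := min ε 1 with hε1
    have h0 : 0 < ε1 := lt_min hε one_pos
    obtain ⟨ω', hω', hih⟩ := ih (ε1 ^ 2 / 100) (by positivity)
    have hn : (0 : ℝ) < n + 4 := by positivity
    refine ⟨min (ω' / (n + 4)) (ε1 ^ 2 / 100 / (n + 4)), lt_min (by positivity) (by positivity), ?_⟩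
    have h1 := roth_step n ε1 _ ω' (min (ω' / (n + 4)) (ε1 ^ 2 / 100 / (n + 4))) h0
      (min_le_right _ _) rfl
      (lt_min (by positivity) (by positivity))
      (by rw [mul_comm, ← le_div_iff₀ hn]; exact min_le_left _ _)
      (by rw [mul_comm, ← le_div_iff₀ hn]; exact min_le_right _ _) hih
    intro r hr hrat a q hq hcop A hA hAq hrA F hF hdeg hl
    obtain ⟨k, hk, hk2⟩ := h1 r hr hrat a q hq hcop A hA hAq hrA F hF hdeg hl
    exact ⟨k, hk, hk2.trans_le (min_le_left _ _)⟩
end Sub6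

namespace Sub6
open MvPolynomial

section Cheb
lemma cross_zero {m : ℕ} (T : Fin m → Type) [∀ h, Fintype (T h)] (f : ∀ h, T h → ℝ)
    (h0 : ∀ h, ∑ x, f h x = 0) (a b : Fin m) (hab : a ≠ b) :
    ∑ x : (∀ h, T h), f a (x a) * f b (x b) = 0 := by
  classical
  let g : ∀ h, T h → ℝ := fun h t => if h = a then f h t else if h = b then f h t else 1
  have e : ∀ x : (∀ h, T h), f a (x a) * f b (x b) = ∏ h, g h (x h) := by
    intro x
    rw [Finset.prod_eq_mul a b hab]
    · simp [g, hab.symm]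
    · intro c _ hc
      simp [g, hc.1, hc.2]
    · simp
    · simp
  rw [Finset.sum_congr rfl fun x _ => e x]
  have := (Fintype.prod_sum g)
  rw [← this]
  apply Finset.prod_eq_zero (Finset.mem_univ a)
  simp [g, h0]

lemma cheb {m : ℕ} (hm : 0 < m) (T : Fin m → Type) [∀ h, Fintype (T h)] (f : ∀ h, T h → ℝ)
    (h0 : ∀ h, ∑ x, f h x = 0) (h1 : ∀ h x, |f h x| ≤ 1) (ε : ℝ) (hε : 0 < ε) :
    ((Finset.univ.filter fun x : (∀ h, T h) => ε * m < |∑ h, f h (x h)|).card : ℝ) * (ε ^ 2 * m)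
      ≤ Fintype.card (∀ h, T h) := by
  classical
  have hm' : (0:ℝ) < m := by exact_mod_cast hm
  have hsum : ∑ x : (∀ h, T h), (∑ h, f h (x h)) ^ 2 ≤ m * Fintype.card (∀ h, T h) := by
    calc ∑ x : (∀ h, T h), (∑ h, f h (x h)) ^ 2
        = ∑ x : (∀ h, T h), ∑ a, ∑ b, f a (x a) * f b (x b) := by
          refine Finset.sum_congr rfl fun x _ => ?_
          rw [sq, Finset.sum_mul_sum]
      _ = ∑ a, ∑ b, ∑ x : (∀ h, T h), f a (x a) * f b (x b) := by
          rw [Finset.sum_comm]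
          refine Finset.sum_congr rfl fun a _ => ?_
          rw [Finset.sum_comm]
      _ = ∑ a, ∑ x : (∀ h, T h), f a (x a) * f a (x a) := by
          refine Finset.sum_congr rfl fun a _ => ?_
          rw [Finset.sum_eq_single a]
          · intro b _ hb
            exact cross_zero T f h0 a b hb.symm
          · simp
      _ ≤ ∑ a : Fin m, ∑ x : (∀ h, T h), (1:ℝ) := by
          refine Finset.sum_le_sum fun a _ => Finset.sum_le_sum fun x _ => ?_
          have := h1 a (x a)
          rw [← abs_mul_abs_self]
          nlinarith [abs_nonneg (f a (x a))]
      _ = m * Fintype.card (∀ h, T h) := by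
          rw [Finset.sum_const, Finset.sum_const, Finset.card_univ, Finset.card_univ,
            Fintype.card_fin]
          simp
  have h2 : ((Finset.univ.filter fun x : (∀ h, T h) => ε * m < |∑ h, f h (x h)|).card : ℝ)
      * (ε * m) ^ 2 ≤ ∑ x : (∀ h, T h), (∑ h, f h (x h)) ^ 2 := by
    rw [← nsmul_eq_mul, ← Finset.sum_const]
    refine le_trans (Finset.sum_le_sum (g := fun x => (∑ h, f h (x h)) ^ 2) ?_)
      (Finset.sum_le_sum_of_subset_of_nonneg (Finset.filter_subset _ _) fun x _ _ => sq_nonneg _)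
    intro x hx
    have hx' := (Finset.mem_filter.1 hx).2
    show (ε * m) ^ 2 ≤ (∑ h, f h (x h)) ^ 2
    rw [← sq_abs (∑ h, f h (x h))]
    have : 0 < ε * m := by positivity
    exact pow_le_pow_left₀ this.le hx'.le 2
  have h3 := h2.trans hsum
  have : ((Finset.univ.filter fun x : (∀ h, T h) => ε * m < |∑ h, f h (x h)|).card : ℝ)
      * (ε ^ 2 * m) * m ≤ Fintype.card (∀ h, T h) * m := by nlinarith
  exact le_of_mul_le_mul_right this hm'
end Cheb

/-- exponents of degree `r` in three variables -/
abbrev T3 (r : ℕ) : Type := {I : Fin 3 → ℕ // I ∈ (Finset.univ : Finset (Fin 3)).piAntidiag r}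

lemma T3_sum {r : ℕ} (I : T3 r) : ∑ j, I.1 j = r := by
  have := I.2
  simp only [Finset.mem_piAntidiag] at this
  exact this.1

def T3mk {r : ℕ} (I : Fin 3 → ℕ) (h : ∑ j, I j = r) : T3 r :=
  ⟨I, by simp [Finset.mem_piAntidiag, h]⟩

lemma T3_card (r : ℕ) : Fintype.card (T3 r) ≤ 4 ^ r := by
  have h1 : Fintype.card (T3 r) ≤ Fintype.card (Fin (r+1) × Fin (r+1)) := by
    refine Fintype.card_le_of_injective (fun I => (⟨I.1 0, ?_⟩, ⟨I.1 1, ?_⟩)) ?_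
    · have := T3_sum I; rw [Fin.sum_univ_three] at this; omega
    · have := T3_sum I; rw [Fin.sum_univ_three] at this; omega
    · intro I J h
      have hI := T3_sum I
      have hJ := T3_sum J
      rw [Fin.sum_univ_three] at hI hJ
      simp only [Prod.mk.injEq, Fin.mk.injEq] at h
      apply Subtype.ext
      funext j
      fin_cases j
      · exact h.1
      · exact h.2
      · show I.1 2 = J.1 2
        omega
  refine h1.trans ?_
  rw [Fintype.card_prod, Fintype.card_fin]
  have : r + 1 ≤ 2 ^ r := Nat.lt_two_pow_self
  calc (r+1) * (r+1) ≤ 2^r * 2^r := Nat.mul_le_mul this this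
    _ = 4 ^ r := by rw [← mul_pow]; norm_num

lemma T3_pos (r : ℕ) : 0 < Fintype.card (T3 r) := by
  rw [Fintype.card_pos_iff]
  exact ⟨T3mk ![r, 0, 0] (by simp [Fin.sum_univ_three])⟩

lemma T3_mean (r : ℕ) (hr : 0 < r) (j : Fin 3) :
    ∑ I : T3 r, ((I.1 j : ℝ) / r - 1 / 3) = 0 := by
  have hsw : ∀ i, ∑ I : T3 r, (I.1 i : ℝ) = ∑ I : T3 r, (I.1 j : ℝ) := by
    intro i
    have hs : ∀ I : T3 r, ∑ k, I.1 (Equiv.swap i j k) = r := fun I => by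
      rw [Equiv.sum_comp (Equiv.swap i j) I.1]; exact T3_sum I
    refine Fintype.sum_bijective (fun I => T3mk (fun k => I.1 (Equiv.swap i j k)) (hs I)) ?_ _ _ ?_
    · apply Function.Involutive.bijective
      intro I
      apply Subtype.ext
      funext k
      simp [T3mk]
    · intro I
      simp [T3mk]
  have hr' : (r:ℝ) ≠ 0 := by positivity
  have h3 : ∑ i : Fin 3, ∑ I : T3 r, (I.1 i : ℝ) = Fintype.card (T3 r) * r := by
    rw [Finset.sum_comm]
    rw [Finset.sum_congr rfl fun I _ => (by exact_mod_cast T3_sum I : ∑ i, (I.1 i : ℝ) = r)]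
    rw [Finset.sum_const, Finset.card_univ, nsmul_eq_mul]
  rw [Fin.sum_univ_three, hsw 0, hsw 1, hsw 2] at h3
  rw [Finset.sum_sub_distrib, ← Finset.sum_div, Finset.sum_const, Finset.card_univ, nsmul_eq_mul]
  have : ∑ I : T3 r, (I.1 j : ℝ) = Fintype.card (T3 r) * r / 3 := by linarith
  rw [this]
  field_simp
  ring

lemma T3_le {r : ℕ} (hr : 0 < r) (I : T3 r) (j : Fin 3) : |(I.1 j : ℝ) / r - 1 / 3| ≤ 1 := by
  have h1 : I.1 j ≤ r := by
    exact (Finset.single_le_sum (f := I.1) (fun _ _ => Nat.zero_le _) (Finset.mem_univ j)).trans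
      (T3_sum I).le
  have hr' : (0:ℝ) < r := by exact_mod_cast hr
  have h2 : (I.1 j : ℝ) / r ≤ 1 := by
    rw [div_le_one hr']; exact_mod_cast h1
  have h3 : 0 ≤ (I.1 j : ℝ) / r := by positivity
  rw [abs_le]; constructor <;> linarith

/-- bad exponents -/
def Bad {m : ℕ} (r : Fin m → ℕ) (ε : ℝ) (J : ∀ h, T3 (r h)) : Prop :=
  ∃ j, ε * m < |∑ h, (((J h).1 j : ℝ) / r h - 1 / 3)|

open Classical in
lemma bad_count {m : ℕ} (hm : 0 < m) (r : Fin m → ℕ) (hr : ∀ h, 0 < r h) (ε : ℝ) (hε : 0 < ε) :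
    ((Finset.univ.filter fun J : (∀ h, T3 (r h)) => Bad r ε J).card : ℝ) * (ε ^ 2 * m)
      ≤ 3 * Fintype.card (∀ h, T3 (r h)) := by
  have h1 : (Finset.univ.filter fun J : (∀ h, T3 (r h)) => Bad r ε J) ⊆
      (Finset.univ : Finset (Fin 3)).biUnion fun j => Finset.univ.filter
        fun J : (∀ h, T3 (r h)) => ε * m < |∑ h, (((J h).1 j : ℝ) / r h - 1 / 3)| := by
    intro J hJ
    obtain ⟨j, hj⟩ := (Finset.mem_filter.1 hJ).2
    simp only [Finset.mem_biUnion, Finset.mem_filter, Finset.mem_univ, true_and]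
    exact ⟨j, hj⟩
  have h2 := (Finset.card_le_card h1).trans Finset.card_biUnion_le
  have h3 : ∀ j : Fin 3, ((Finset.univ.filter
        fun J : (∀ h, T3 (r h)) => ε * m < |∑ h, (((J h).1 j : ℝ) / r h - 1 / 3)|).card : ℝ)
          * (ε^2 * m) ≤ Fintype.card (∀ h, T3 (r h)) := by
    intro j
    have := cheb hm (fun h => T3 (r h)) (fun h I => (I.1 j : ℝ) / r h - 1 / 3)
      (fun h => T3_mean (r h) (hr h) j) (fun h I => T3_le (hr h) I j) ε hε
    convert this
  rw [Fin.sum_univ_three] at h2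
  have h2' : ((Finset.univ.filter fun J : (∀ h, T3 (r h)) => Bad r ε J).card : ℝ) ≤
    (Finset.univ.filter
        fun J : (∀ h, T3 (r h)) => ε * m < |∑ h, (((J h).1 0 : ℝ) / r h - 1 / 3)|).card +
    (Finset.univ.filter
        fun J : (∀ h, T3 (r h)) => ε * m < |∑ h, (((J h).1 1 : ℝ) / r h - 1 / 3)|).card +
    (Finset.univ.filter
        fun J : (∀ h, T3 (r h)) => ε * m < |∑ h, (((J h).1 2 : ℝ) / r h - 1 / 3)|).card := by
    exact_mod_cast h2
  have h0 := mul_le_mul_of_nonneg_right h2' (show 0 ≤ ε^2 * m by positivity)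
  have := h3 0
  have := h3 1
  have := h3 2
  linarith
end Sub6

namespace Sub6
open MvPolynomial

lemma Wge.C0 {σ R : Type*} [CommRing R] {w : (σ →₀ ℕ) →+ ℝ} (a : R) :
    Wge w 0 (C a : MvPolynomial σ R) := by
  classical
  intro m hm
  rw [coeff_C] at hm
  have : m = 0 := by by_contra h; exact hm (if_neg (Ne.symm h))
  rw [this, map_zero]

lemma Wge.pow {σ R : Type*} [CommRing R] {w : (σ →₀ ℕ) →+ ℝ} {c : ℝ} {p : MvPolynomial σ R}
    (h : Wge w c p) (k : ℕ) : Wge w (k * c) (p ^ k) := by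
  have := Wge.prod (Finset.range k) (fun _ => p) (fun _ => c) (fun _ _ => h)
  simpa using this

lemma Wge.X1 {σ R : Type*} [CommRing R] {w : (σ →₀ ℕ) →+ ℝ} (i : σ) :
    Wge w (w (Finsupp.single i 1)) (X i : MvPolynomial σ R) := by
  classical
  intro m hm
  rw [coeff_X'] at hm
  have : Finsupp.single i 1 = m := by by_contra h; exact hm (if_neg h)
  rw [this]

section
variable {m : ℕ} {R : Type*} [SeminormedCommRing R] [NormOneClass R]

noncomputable def lin3 (G : Matrix (Fin 3) (Fin 3) R) (p : Fin m × Fin 3) :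
    MvPolynomial (Fin m × Fin 3) R := ∑ j, C (G p.2 j) * X (p.1, j)

noncomputable def sub3 (G : Matrix (Fin 3) (Fin 3) R) :
    MvPolynomial (Fin m × Fin 3) ℤ →+* MvPolynomial (Fin m × Fin 3) R :=
  eval₂Hom (C.comp (Int.castRingHom R)) (lin3 G)

def BlockHom (r : Fin m → ℕ) {S : Type*} [CommRing S] (P : MvPolynomial (Fin m × Fin 3) S) : Prop :=
  ∀ I, coeff I P ≠ 0 → ∀ h, ∑ i, I (h, i) = r h

noncomputable def wh (h : Fin m) (s : ℝ) : (Fin m × Fin 3 →₀ ℕ) →+ ℝ where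
  toFun J := s * ∑ j, (J (h, j) : ℝ)
  map_zero' := by simp
  map_add' a b := by
    simp only [Finsupp.coe_add, Pi.add_apply, Nat.cast_add, Finset.sum_add_distrib, mul_add]

lemma wh_apply (h : Fin m) (s : ℝ) (J) : wh h s J = s * ∑ j, (J (h, j) : ℝ) := rfl

lemma wh_single (h : Fin m) (s : ℝ) (p : Fin m × Fin 3) :
    wh h s (Finsupp.single p 1) = s * if p.1 = h then 1 else 0 := by
  classical
  rw [wh_apply]
  congr 1
  obtain ⟨a, b⟩ := p
  by_cases hh : a = h
  · subst hh
    rw [Finset.sum_eq_single b]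
    · simp
    · intro j _ hj
      simp [Finsupp.single_apply, Ne.symm hj]
    · simp
  · simp [hh, Finsupp.single_apply]

lemma lin3_wge (G : Matrix (Fin 3) (Fin 3) R) (h : Fin m) (s : ℝ) (p : Fin m × Fin 3) :
    Wge (wh h s) (s * if p.1 = h then 1 else 0) (lin3 G p) := by
  apply Wge.sum
  intro j _
  have := (Wge.C0 (w := wh h s) (G p.2 j)).mul (Wge.X1 (R := R) (w := wh h s) (p.1, j))
  rw [wh_single, zero_add] at this
  exact this

lemma sub3_blockhom (G : Matrix (Fin 3) (Fin 3) R) (r : Fin m → ℕ)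
    (P : MvPolynomial (Fin m × Fin 3) ℤ) (hP : BlockHom r P) : BlockHom r (sub3 G P) := by
  have key : ∀ (h : Fin m) (s : ℝ), Wge (wh h s) (s * r h) (sub3 G P) := by
    intro h s
    rw [sub3, coe_eval₂Hom, eval₂_eq']
    apply Wge.sum
    intro I hI
    have h1 := (Wge.C0 (w := wh h s) ((Int.castRingHom R) (coeff I P))).mul
      (Wge.prod Finset.univ (fun p => lin3 G p ^ I p) _ (fun p _ => (lin3_wge G h s p).pow (I p)))
    refine h1.mono (le_of_eq ?_)
    rw [zero_add, Fintype.sum_prod_type]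
    have h2 := hP I (mem_support_iff.1 hI) h
    rw [Finset.sum_eq_single h]
    · simp only [if_true]
      rw [← h2]
      push_cast
      rw [← Finset.sum_mul]; ring
    · intro b _ hb
      simp [hb]
    · simp
  intro J hJ h
  have h1 := key h 1 J hJ
  have h2 := key h (-1) J hJ
  rw [wh_apply] at h1 h2
  have : (∑ j, (J (h, j) : ℝ)) = r h := by linarith
  exact_mod_cast this

/-- from blocks to exponents -/
noncomputable def Ex {r : Fin m → ℕ} (J : ∀ h, T3 (r h)) : Fin m × Fin 3 →₀ ℕ :=
  Finsupp.equivFunOnFinite.symm fun p => (J p.1).1 p.2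

lemma Ex_apply {r : Fin m → ℕ} (J : ∀ h, T3 (r h)) (h i) : Ex J (h, i) = (J h).1 i := rfl

lemma Ex_inj {r : Fin m → ℕ} : Function.Injective (Ex (r := r)) := by
  intro I J h
  funext a
  apply Subtype.ext
  funext i
  rw [← Ex_apply, h, Ex_apply]

lemma Ex_surj {r : Fin m → ℕ} (I : Fin m × Fin 3 →₀ ℕ) (h : ∀ h, ∑ i, I (h, i) = r h) :
    ∃ J, Ex (r := r) J = I := by
  refine ⟨fun a => T3mk (fun i => I (a, i)) (h a), ?_⟩
  refine Finsupp.ext fun ⟨a, i⟩ => ?_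
  rfl

noncomputable def GK (G : Matrix (Fin 3) (Fin 3) R) : ℝ := 1 + ∑ i, ∑ j, ‖G i j‖

lemma GK_one (G : Matrix (Fin 3) (Fin 3) R) : 1 ≤ GK G := by
  unfold GK
  have : 0 ≤ ∑ i, ∑ j, ‖G i j‖ := Finset.sum_nonneg fun _ _ => Finset.sum_nonneg fun _ _ => norm_nonneg _
  linarith

lemma l1_lin3 (G : Matrix (Fin 3) (Fin 3) R) (p : Fin m × Fin 3) : l1 (lin3 G p) ≤ GK G := by
  refine (l1_sum _ _).trans ?_
  have h1 : ∀ j ∈ (Finset.univ : Finset (Fin 3)), l1 (C (G p.2 j) * X (p.1, j) : MvPolynomial (Fin m × Fin 3) R) ≤ ‖G p.2 j‖ := by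
    intro j _
    refine (l1_mul _ _).trans ?_
    rw [l1_C, l1_X, mul_one]
  refine (Finset.sum_le_sum h1).trans ?_
  have := Finset.single_le_sum (f := fun i => ∑ j, ‖G i j‖)
    (fun i _ => Finset.sum_nonneg fun _ _ => norm_nonneg _) (Finset.mem_univ p.2)
  unfold GK
  linarith

lemma l1_sub3_mon (G : Matrix (Fin 3) (Fin 3) R) {r : Fin m → ℕ} (I : ∀ h, T3 (r h)) :
    l1 (sub3 G (monomial (Ex I) 1)) ≤ GK G ^ (∑ h, r h) := by
  rw [sub3, coe_eval₂Hom]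
  refine (l1_eval₂ _ _ _).trans ?_
  rw [support_monomial, if_neg one_ne_zero, Finset.sum_singleton, coeff_monomial, if_pos rfl,
    map_one, norm_one, one_mul]
  refine (Finset.prod_le_prod (fun p _ => pow_nonneg (l1_nonneg _) _)
    (fun p _ => pow_le_pow_left₀ (l1_nonneg _) (l1_lin3 G p) _)).trans ?_
  rw [Finset.prod_pow_eq_pow_sum, Fintype.sum_prod_type]
  refine le_of_eq ?_
  congr 1
  exact Finset.sum_congr rfl fun h _ => T3_sum (I h)

attribute [local instance] Matrix.seminormedAddCommGroup

open Classical in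
theorem aux_poly (d : ℕ) (hd : 0 < d) (coord : Fin d → R →+ ℤ)
    (hc0 : ∀ x, (∀ i, coord i x = 0) → x = 0) (hc : ∀ i x, |(coord i x : ℝ)| ≤ ‖x‖)
    (G : Matrix (Fin 3) (Fin 3) R) (ε : ℝ) (hε : 0 < ε) :
    ∃ m : ℕ, 0 < m ∧ ∃ K : ℝ, 1 ≤ K ∧ ∀ r : Fin m → ℕ, (∀ h, 0 < r h) →
      ∃ P : MvPolynomial (Fin m × Fin 3) ℤ, P ≠ 0 ∧ BlockHom r P ∧ l1 P ≤ K ^ (∑ h, r h) ∧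
        ∀ J, coeff J (sub3 G P) ≠ 0 → ∀ j, |∑ h, ((J (h, j) : ℝ) / r h) - m / 3| ≤ ε * m := by
  obtain ⟨m, hm⟩ := exists_nat_gt (6 * d / ε ^ 2)
  have hd' : (0:ℝ) < d := by exact_mod_cast hd
  have hm0 : 0 < m := by
    have : (0:ℝ) < m := lt_of_le_of_lt (by positivity) hm
    exact_mod_cast this
  refine ⟨m, hm0, 16 * GK G, by linarith [GK_one G], ?_⟩
  intro r hr
  have hK1 := GK_one G
  set K := GK G
  set s := ∑ h, r h
  set β := ∀ h, T3 (r h)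
  have hβpos : 0 < Fintype.card β := by
    rw [Fintype.card_pi]
    exact Finset.prod_pos fun h _ => T3_pos (r h)
  have hβle : (Fintype.card β : ℝ) ≤ 4 ^ s := by
    have : Fintype.card β ≤ 4 ^ s := by
      rw [Fintype.card_pi, ← Finset.prod_pow_eq_pow_sum]
      exact Finset.prod_le_prod' fun h _ => T3_card (r h)
    exact_mod_cast this
  let poly : (β → ℤ) → MvPolynomial (Fin m × Fin 3) ℤ := fun t => ∑ I, C (t I) * monomial (Ex I) 1
  have hcoeff : ∀ t I, coeff (Ex I) (poly t) = t I := by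
    intro t I
    simp only [poly, coeff_sum, coeff_C_mul, coeff_monomial]
    rw [Finset.sum_eq_single I]
    · simp
    · intro J _ hJ
      rw [if_neg (fun h => hJ (Ex_inj h)), mul_zero]
    · simp
  have hhom : ∀ t, BlockHom r (poly t) := by
    intro t I hI h
    simp only [poly, coeff_sum, coeff_C_mul, coeff_monomial] at hI
    obtain ⟨J, _, hJ⟩ := Finset.exists_ne_zero_of_sum_ne_zero hI
    have : Ex J = I := by
      by_contra h'
      exact hJ (by rw [if_neg h', mul_zero])
    rw [← this]
    exact T3_sum (J h)
  have hl1 : ∀ t, l1 (poly t) ≤ ∑ I, |(t I : ℝ)| := by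
    intro t
    refine (l1_sum _ _).trans (Finset.sum_le_sum fun I _ => (l1_mul _ _).trans ?_)
    rw [l1_C, l1_monomial, norm_one, mul_one, Int.norm_eq_abs]
  have hsubc : ∀ t J, coeff J (sub3 G (poly t)) =
      ∑ I, (t I : R) * coeff J (sub3 G (monomial (Ex I) 1)) := by
    intro t J
    simp only [poly, map_sum, map_mul, coeff_sum]
    refine Finset.sum_congr rfl fun I _ => ?_
    have : sub3 (m := m) G (C (t I)) = C ((t I : R)) := by
      rw [sub3, coe_eval₂Hom, eval₂_C]; rfl
    rw [this, coeff_C_mul]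
  -- it suffices to kill the bad exponents
  suffices hs : ∃ t : β → ℤ, t ≠ 0 ∧ (∀ I, |(t I : ℝ)| ≤ 4 ^ s * K ^ s) ∧
      ∀ J : β, Bad r ε J → coeff (Ex J) (sub3 G (poly t)) = 0 by
    obtain ⟨t, ht0, htb, htJ⟩ := hs
    refine ⟨poly t, ?_, hhom t, ?_, ?_⟩
    · intro h0
      apply ht0
      funext I
      rw [← hcoeff t I, h0]; simp
    · refine (hl1 t).trans ((Finset.sum_le_sum fun I _ => htb I).trans ?_)
      rw [Finset.sum_const, Finset.card_univ, nsmul_eq_mul]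
      have : (16 * K) ^ s = 4 ^ s * (4 ^ s * K ^ s) := by
        rw [← mul_assoc, ← mul_pow, ← mul_pow]; norm_num
      rw [this]
      exact mul_le_mul_of_nonneg_right hβle (by positivity)
    · intro J hJ j
      obtain ⟨J', rfl⟩ := Ex_surj J (sub3_blockhom G r _ (hhom t) J hJ)
      have hnb : ¬ Bad r ε J' := fun hb => hJ (htJ J' hb)
      unfold Bad at hnb
      push Not at hnb
      have h1 := hnb j
      rw [Finset.sum_sub_distrib] at h1
      simp only [Finset.sum_const, Finset.card_univ, Fintype.card_fin, nsmul_eq_mul] at h1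
      rw [show (m:ℝ) / 3 = m * (1/3) by ring]
      exact h1
  have hbc := bad_count hm0 r hr ε hε
  set nb := (Finset.univ.filter fun J : β => Bad r ε J).card with hnb
  have h2 : 2 * ((nb : ℝ) * d) ≤ Fintype.card β := by
    have h3 : 6 * d < m * ε ^ 2 := by rwa [div_lt_iff₀ (by positivity)] at hm
    have h4 : (nb:ℝ) * (6 * d) ≤ nb * (ε^2 * m) :=
      mul_le_mul_of_nonneg_left (by linarith) (by positivity)
    linarith
  by_cases hnb0 : nb = 0
  · refine ⟨fun _ => 1, ?_, ?_, ?_⟩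
    · intro h0
      obtain ⟨I⟩ := Fintype.card_pos_iff.1 hβpos
      have := congrFun h0 I
      simp at this
    · intro I
      simp only [Int.cast_one, abs_one]
      exact one_le_mul_of_one_le_of_one_le (one_le_pow₀ (by norm_num)) (one_le_pow₀ hK1)
    · intro J hJ
      rw [hnb, Finset.card_eq_zero] at hnb0
      have : J ∈ (Finset.univ.filter fun J : β => Bad r ε J) := by simp [hJ]
      rw [hnb0] at this
      simp at this
  let A : Matrix ({J : β // Bad r ε J} × Fin d) β ℤ :=
    fun a I => coord a.2 (coeff (Ex a.1.1) (sub3 G (monomial (Ex I) 1)))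
  have hcα : Fintype.card ({J : β // Bad r ε J} × Fin d) = nb * d := by
    rw [Fintype.card_prod, Fintype.card_fin, Fintype.card_subtype]
  have hnbd : 0 < nb * d := Nat.mul_pos (Nat.pos_of_ne_zero hnb0) hd
  have hlt : Fintype.card ({J : β // Bad r ε J} × Fin d) < Fintype.card β := by
    rw [hcα]
    have : 2 * (nb * d) ≤ Fintype.card β := by exact_mod_cast h2
    omega
  obtain ⟨t, ht0, htA, htn⟩ := Int.Matrix.exists_ne_zero_int_vec_norm_le A hlt (by rw [hcα]; exact hnbd)
  have hKs : 1 ≤ K ^ s := one_le_pow₀ hK1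
  refine ⟨t, ht0, ?_, ?_⟩
  · have hA : ‖A‖ ≤ K ^ s := by
      rw [Matrix.norm_le_iff (by positivity)]
      intro a I
      rw [Int.norm_eq_abs]
      exact (hc _ _).trans ((norm_coeff_le_l1 _ _).trans (l1_sub3_mon G I))
    have hbase : (Fintype.card β : ℝ) * max 1 ‖A‖ ≤ 4 ^ s * K ^ s :=
      mul_le_mul hβle (max_le hKs hA) (by positivity) (by positivity)
    have hbase1 : 1 ≤ (Fintype.card β : ℝ) * max 1 ‖A‖ := by
      have : (1:ℝ) ≤ Fintype.card β := by exact_mod_cast hβpos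
      exact one_le_mul_of_one_le_of_one_le this (le_max_left _ _)
    have hex : ((Fintype.card ({J : β // Bad r ε J} × Fin d) : ℝ) /
        (Fintype.card β - Fintype.card ({J : β // Bad r ε J} × Fin d))) ≤ 1 := by
      have hlt' : (Fintype.card ({J : β // Bad r ε J} × Fin d) : ℝ) < Fintype.card β := by
        exact_mod_cast hlt
      rw [div_le_one (by linarith), hcα]
      push_cast
      linarith
    have hfin : ‖t‖ ≤ 4 ^ s * K ^ s := by
      refine htn.trans (le_trans ?_ hbase)
      calc _ ≤ ((Fintype.card β : ℝ) * max 1 ‖A‖) ^ (1:ℝ) :=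
            Real.rpow_le_rpow_of_exponent_le hbase1 hex
        _ = _ := Real.rpow_one _
    intro I
    rw [← Int.norm_eq_abs]
    exact (norm_le_pi_norm t I).trans hfin
  · intro J hJ
    apply hc0
    intro i
    have h5 := congrFun htA (⟨J, hJ⟩, i)
    rw [hsubc, map_sum]
    simp only [Matrix.mulVec, dotProduct, Pi.zero_apply, A] at h5
    rw [← h5]
    refine Finset.sum_congr rfl fun I _ => ?_
    rw [← zsmul_eq_mul, map_zsmul, smul_eq_mul, mul_comm]
end
end Sub6

namespace Sub6
open MvPolynomial

def AuxGood (G : Matrix (Fin 3) (Fin 3) ℝ) : Prop := ∀ ε : ℝ, 0 < ε →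
    ∃ m : ℕ, 0 < m ∧ ∃ K : ℝ, 1 ≤ K ∧ ∀ r : Fin m → ℕ, (∀ h, 0 < r h) →
      ∃ P : MvPolynomial (Fin m × Fin 3) ℤ, P ≠ 0 ∧ BlockHom r P ∧ l1 P ≤ K ^ (∑ h, r h) ∧
        l1 (sub3 G P) ≤ K ^ (∑ h, r h) ∧ BlockHom r (sub3 G P) ∧
        ∀ J, coeff J (sub3 G P) ≠ 0 → ∀ j, |∑ h, ((J (h, j) : ℝ) / r h) - m / 3| ≤ ε * m

lemma sub3_map {m : ℕ} {R : Type*} [SeminormedCommRing R] [NormOneClass R] (ι : R →+* ℝ)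
    (G : Matrix (Fin 3) (Fin 3) R) (P : MvPolynomial (Fin m × Fin 3) ℤ) :
    sub3 (G.map ι) P = map ι (sub3 G P) := by
  have : sub3 (m := m) (G.map ι) = (MvPolynomial.map ι).comp (sub3 (m := m) G) := by
    apply MvPolynomial.ringHom_ext
    · intro a
      simp [sub3]
    · intro p
      simp [sub3, lin3]
  rw [this]; rfl

lemma l1_sub3 {m : ℕ} (G : Matrix (Fin 3) (Fin 3) ℝ) (r : Fin m → ℕ)
    (P : MvPolynomial (Fin m × Fin 3) ℤ) (hP : BlockHom r P) :
    l1 (sub3 G P) ≤ l1 P * GK G ^ (∑ h, r h) := by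
  rw [sub3, coe_eval₂Hom]
  refine (l1_eval₂ _ _ _).trans ?_
  rw [l1, Finset.sum_mul]
  refine Finset.sum_le_sum fun I hI => ?_
  have h1 : ‖(Int.castRingHom ℝ) (coeff I P)‖ = ‖coeff I P‖ := by
    simp [Int.norm_eq_abs]
  rw [h1]
  refine mul_le_mul_of_nonneg_left ?_ (norm_nonneg _)
  refine (Finset.prod_le_prod (fun p _ => pow_nonneg (l1_nonneg _) _)
    (fun p _ => pow_le_pow_left₀ (l1_nonneg _) (l1_lin3 G p) _)).trans ?_
  rw [Finset.prod_pow_eq_pow_sum, Fintype.sum_prod_type]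
  refine le_of_eq ?_
  congr 1
  exact Finset.sum_congr rfl fun h _ => hP I (mem_support_iff.1 hI) h

lemma auxGood_abs {R : Type*} [SeminormedCommRing R] [NormOneClass R] (d : ℕ) (hd : 0 < d)
    (coord : Fin d → R →+ ℤ)
    (hc0 : ∀ x, (∀ i, coord i x = 0) → x = 0) (hc : ∀ i x, |(coord i x : ℝ)| ≤ ‖x‖)
    (G : Matrix (Fin 3) (Fin 3) R) (ι : R →+* ℝ) : AuxGood (G.map ι) := by
  intro ε hε
  obtain ⟨m, hm, K, hK, h⟩ := aux_poly d hd coord hc0 hc G ε hε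
  have hG1 := GK_one (G.map ι)
  refine ⟨m, hm, K * GK (G.map ι), one_le_mul_of_one_le_of_one_le hK hG1, ?_⟩
  intro r hr
  obtain ⟨P, hP0, hPh, hPl, hPs⟩ := h r hr
  refine ⟨P, hP0, hPh, ?_, ?_, sub3_blockhom _ r P hPh, ?_⟩
  · refine hPl.trans (pow_le_pow_left₀ (by linarith) ?_ _)
    nlinarith
  · refine (l1_sub3 _ r P hPh).trans ?_
    rw [mul_pow]
    exact mul_le_mul_of_nonneg_right hPl (by positivity)
  · intro J hJ
    apply hPs
    intro h0
    apply hJ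
    rw [sub3_map, coeff_map, h0, map_zero]

theorem auxGood (f : Polynomial ℤ) (hf : f.Monic) (β : ℝ) (hβ : Polynomial.aeval β f = 0)
    (g : Fin 3 → Fin 3 → Polynomial ℤ) :
    AuxGood (Matrix.of fun i j => Polynomial.aeval β (g i j)) := by
  classical
  have hd : 0 < (AdjoinRoot.powerBasis' hf).dim := by
    rw [AdjoinRoot.powerBasis'_dim]
    rw [Nat.pos_iff_ne_zero]
    intro h0
    have := hf.natDegree_eq_zero.1 h0
    rw [this] at hβ
    simp at hβ
  set pb := AdjoinRoot.powerBasis' hf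
  haveI : Nonempty (Fin pb.dim) := ⟨⟨0, hd⟩⟩
  letI := Matrix.linftyOpNormedRing (n := Fin pb.dim) (α := ℤ)
  haveI := Matrix.linfty_opNormOneClass (n := Fin pb.dim) (α := ℤ)
  letI i1 : SeminormedCommRing (AdjoinRoot f) :=
    SeminormedCommRing.induced (AdjoinRoot f) (Matrix (Fin pb.dim) (Fin pb.dim) ℤ)
      (Algebra.leftMulMatrix pb.basis)
  haveI : NormOneClass (AdjoinRoot f) :=
    NormOneClass.induced (AdjoinRoot f) (Matrix (Fin pb.dim) (Fin pb.dim) ℤ)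
      (Algebra.leftMulMatrix pb.basis)
  have hnorm : ∀ x : AdjoinRoot f, ‖x‖ = ‖Algebra.leftMulMatrix pb.basis x‖ := fun x => rfl
  let ι : AdjoinRoot f →+* ℝ := AdjoinRoot.lift (Int.castRingHom ℝ) β
    (by rw [← hβ, Polynomial.aeval_def]; rfl)
  have h := auxGood_abs pb.dim hd
    (fun i => { toFun := fun x => Algebra.leftMulMatrix pb.basis x i ⟨0, hd⟩
                map_zero' := by simp
                map_add' := fun a b => by simp } : Fin pb.dim → AdjoinRoot f →+ ℤ) ?_ ?_
    (Matrix.of fun i j => AdjoinRoot.mk f (g i j)) ι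
  · convert h using 1
    ext i j
    simp only [Matrix.of_apply, Matrix.map_apply, ι]
    rw [AdjoinRoot.lift_mk]
    rfl
  · intro x hx
    have h1 : pb.basis.repr x = 0 := by
      refine Finsupp.ext fun i => ?_
      have := hx i
      simp only [AddMonoidHom.coe_mk, ZeroHom.coe_mk] at this
      rw [Algebra.leftMulMatrix_eq_repr_mul, PowerBasis.basis_eq_pow] at this
      simpa using this
    simpa using h1
  · intro i x
    simp only [AddMonoidHom.coe_mk, ZeroHom.coe_mk]
    rw [hnorm, Matrix.linfty_opNorm_def]
    rw [← Int.norm_eq_abs, ← coe_nnnorm, NNReal.coe_le_coe]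
    refine le_trans ?_ (Finset.le_sup (f := fun i => ∑ j, ‖Algebra.leftMulMatrix pb.basis x i j‖₊) (Finset.mem_univ i))
    exact Finset.single_le_sum (f := fun j => ‖Algebra.leftMulMatrix pb.basis x i j‖₊)
      (fun _ _ => zero_le) (Finset.mem_univ _)
end Sub6

namespace Sub6
open MvPolynomial

/-- blockwise linear substitution -/
noncomputable def subM {m : ℕ} {S : Type*} [CommRing S]
    (N : Fin m → Matrix (Fin 3) (Fin 3) S) :
    MvPolynomial (Fin m × Fin 3) S →+* MvPolynomial (Fin m × Fin 3) S :=
  eval₂Hom C (fun p => ∑ k, C (N p.1 p.2 k) * X (p.1, k))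

noncomputable def scaleH {σ : Type*} (l : σ → ℝ) : MvPolynomial σ ℝ →+* MvPolynomial σ ℝ :=
  eval₂Hom C (fun i => C (l i) * X i)

lemma coeff_scaleH {σ : Type*} [Fintype σ] (l : σ → ℝ) (p : MvPolynomial σ ℝ) (M : σ →₀ ℕ) :
    coeff M (scaleH l p) = coeff M p * ∏ i, l i ^ M i := by
  classical
  induction p using MvPolynomial.induction_on' with
  | add p q hp hq => rw [map_add, coeff_add, hp, hq, coeff_add, add_mul]
  | monomial n a =>
    rw [scaleH, coe_eval₂Hom, eval₂_monomial, Finsupp.prod_fintype _ _ (by simp)]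
    have : ∏ i, (C (l i) * X i : MvPolynomial σ ℝ) ^ n i = C (∏ i, l i ^ n i) * monomial n 1 := by
      rw [monomial_eq, C_1, one_mul, Finsupp.prod_fintype _ _ (by simp), map_prod,
        ← Finset.prod_mul_distrib]
      exact Finset.prod_congr rfl fun i _ => by rw [mul_pow, map_pow]
    rw [this, coeff_C_mul, coeff_C_mul, coeff_monomial, coeff_monomial]
    split_ifs with h
    · rw [h]; ring
    · simp

lemma subM_sub3 {m : ℕ} (G F : Matrix (Fin 3) (Fin 3) ℝ) (hGF : G * F = 1)
    (N : Fin m → Matrix (Fin 3) (Fin 3) ℤ) (l : Fin m × Fin 3 → ℝ)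
    (P : MvPolynomial (Fin m × Fin 3) ℤ) :
    scaleH l (MvPolynomial.map (Int.castRingHom ℝ) (subM N P)) =
      eval₂ (C.comp (RingHom.id ℝ)) (fun p => ∑ k, C ((F * (N p.1).map (Int.cast : ℤ → ℝ)) p.2 k * l (p.1, k)) * X (p.1, k))
        (sub3 G P) := by
  have : (scaleH l).comp ((MvPolynomial.map (Int.castRingHom ℝ)).comp (subM N)) =
      (eval₂Hom (C.comp (RingHom.id ℝ)) (fun p => ∑ k, C ((F * (N p.1).map (Int.cast : ℤ → ℝ)) p.2 k * l (p.1, k)) * X (p.1, k))).comp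
        (sub3 (m := m) G) := by
    apply MvPolynomial.ringHom_ext
    · intro a
      simp [sub3, subM, scaleH]
    · rintro ⟨h, i⟩
      simp only [RingHom.comp_apply, sub3, subM, coe_eval₂Hom, eval₂_X, lin3, map_sum, map_mul,
        map_C, map_X, scaleH, eval₂_C, RingHom.id_apply]
      simp only [eval₂_sum, eval₂_mul, eval₂_C, eval₂_X, RingHom.comp_apply, RingHom.id_apply,
        Finset.mul_sum]
      rw [Finset.sum_comm]
      refine Finset.sum_congr rfl fun k _ => ?_
      have h1 : (N h).map (Int.cast : ℤ → ℝ) = G * (F * (N h).map (Int.cast : ℤ → ℝ)) := by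
        rw [← Matrix.mul_assoc, hGF, Matrix.one_mul]
      have h2 := congrFun (congrFun h1 i) k
      rw [Matrix.map_apply, Matrix.mul_apply] at h2
      simp only [eq_intCast]
      rw [h2, map_sum, Finset.sum_mul]
      refine Finset.sum_congr rfl fun j _ => ?_
      simp only [map_mul]
      ring
  exact DFunLike.congr_fun this P

lemma exponent_bound {m : ℕ} (r : Fin m → ℕ) (hr : ∀ h, 0 < r h) (l : Fin m → ℝ)
    (hl : ∀ h, 0 < l h) (L : ℝ) (hL : 0 ≤ L) (h1 : ∀ h, L ≤ r h * l h) (h2 : ∀ h, r h * l h ≤ L + l h)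
    (γ : Fin 3 → ℝ) (g η ε : ℝ) (hγ : ∀ j, |γ j| ≤ g) (hη : ∑ j, γ j ≤ -η)
    (J : Fin m × Fin 3 →₀ ℕ) (hJ : ∀ h, ∑ i, J (h, i) = r h)
    (hJe : ∀ j, |∑ h, ((J (h, j) : ℝ) / r h) - m / 3| ≤ ε * m) :
    ∑ p : Fin m × Fin 3, γ p.2 * l p.1 * J p ≤
      - L * m * (η / 3 - 3 * g * ε) + g * ∑ h, l h := by
  have hg : 0 ≤ g := (abs_nonneg _).trans (hγ 0)
  have e1 : ∑ p : Fin m × Fin 3, γ p.2 * l p.1 * J p =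
      L * ∑ j, γ j * ∑ h, ((J (h, j) : ℝ) / r h) +
      ∑ h, (r h * l h - L) * ∑ j, γ j * ((J (h, j) : ℝ) / r h) := by
    have : L * ∑ j, γ j * ∑ h, ((J (h, j) : ℝ) / r h) =
        ∑ h, L * ∑ j, γ j * ((J (h, j) : ℝ) / r h) := by
      rw [← Finset.mul_sum, Finset.sum_comm]
      simp only [Finset.mul_sum]
    rw [this, ← Finset.sum_add_distrib, Fintype.sum_prod_type]
    refine Finset.sum_congr rfl fun h _ => ?_
    have : (r h : ℝ) ≠ 0 := by have := hr h; positivity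
    simp only [Finset.mul_sum]
    rw [← Finset.sum_add_distrib]
    refine Finset.sum_congr rfl fun j _ => ?_
    field_simp
    ring
  rw [e1]
  have b1 : ∑ j, γ j * ∑ h, ((J (h, j) : ℝ) / r h) ≤ - m * (η / 3 - 3 * g * ε) := by
    have : ∀ j ∈ (Finset.univ : Finset (Fin 3)), γ j * ∑ h, ((J (h, j) : ℝ) / r h) ≤
        γ j * (m / 3) + g * (ε * m) := by
      intro j _
      have h3 : γ j * (∑ h, ((J (h, j) : ℝ) / r h) - m / 3) ≤ g * (ε * m) := by
        refine (le_abs_self _).trans ?_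
        rw [abs_mul]
        exact mul_le_mul (hγ j) (hJe j) (abs_nonneg _) hg
      linarith
    refine (Finset.sum_le_sum this).trans ?_
    rw [Finset.sum_add_distrib, ← Finset.sum_mul, Finset.sum_const]
    simp only [Finset.card_univ, Fintype.card_fin, nsmul_eq_mul]
    have : (∑ j, γ j) * ((m:ℝ)/3) ≤ -η * (m/3) := mul_le_mul_of_nonneg_right hη (by positivity)
    push_cast
    linarith
  have b2 : ∀ h ∈ (Finset.univ : Finset (Fin m)),
      (r h * l h - L) * ∑ j, γ j * ((J (h, j) : ℝ) / r h) ≤ g * l h := by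
    intro h _
    have hr' : (0:ℝ) < r h := by exact_mod_cast hr h
    have : ∑ j, γ j * ((J (h, j) : ℝ) / r h) ≤ g := by
      have : ∀ j ∈ (Finset.univ : Finset (Fin 3)), γ j * ((J (h, j) : ℝ) / r h) ≤
        g * ((J (h, j) : ℝ) / r h) := fun j _ =>
          mul_le_mul_of_nonneg_right ((le_abs_self _).trans (hγ j)) (by positivity)
      refine (Finset.sum_le_sum this).trans ?_
      rw [← Finset.mul_sum, ← Finset.sum_div]
      have h3 : (∑ j, (J (h, j) : ℝ)) = r h := by exact_mod_cast hJ h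
      rw [h3, div_self hr'.ne', mul_one]
    have h3 : 0 ≤ r h * l h - L := by linarith [h1 h]
    calc _ ≤ (r h * l h - L) * g := mul_le_mul_of_nonneg_left this h3
      _ ≤ l h * g := mul_le_mul_of_nonneg_right (by linarith [h2 h]) hg
      _ = _ := mul_comm _ _
  have b3 := Finset.sum_le_sum b2
  rw [← Finset.mul_sum] at b3
  have b4 := mul_le_mul_of_nonneg_left b1 hL
  linarith

lemma small_coeff {m : ℕ} (r : Fin m → ℕ) (hr : ∀ h, 0 < r h) (l : Fin m → ℝ)
    (hl : ∀ h, 0 < l h) (L : ℝ) (hL : 0 ≤ L) (h1 : ∀ h, L ≤ r h * l h) (h2 : ∀ h, r h * l h ≤ L + l h)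
    (γ : Fin 3 → ℝ) (g η ε : ℝ) (hγ : ∀ j, |γ j| ≤ g) (hη : ∑ j, γ j ≤ -η)
    (G F : Matrix (Fin 3) (Fin 3) ℝ) (hGF : G * F = 1)
    (N : Fin m → Matrix (Fin 3) (Fin 3) ℤ) (B : ℝ) (hB : 1 ≤ B)
    (hN0 : ∀ h j, |(F * (N h).map (Int.cast : ℤ → ℝ)) j 0| ≤ Real.exp (γ j * l h))
    (hN1 : ∀ h j, |(F * (N h).map (Int.cast : ℤ → ℝ)) j 1| ≤ Real.exp (γ j * l h))
    (hN2 : ∀ h j, 2 + |(F * (N h).map (Int.cast : ℤ → ℝ)) j 2| ≤ B)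
    (P : MvPolynomial (Fin m × Fin 3) ℤ) (K : ℝ) (hK : 1 ≤ K)
    (hPl : l1 (sub3 G P) ≤ K ^ (∑ h, r h)) (hPh : BlockHom r (sub3 G P))
    (hPe : ∀ J, coeff J (sub3 G P) ≠ 0 → ∀ j, |∑ h, ((J (h, j) : ℝ) / r h) - m / 3| ≤ ε * m)
    (θ : ℝ) (M : Fin m × Fin 3 →₀ ℕ) (hM : coeff M (subM N P) ≠ 0)
    (hMθ : ∑ h, ((M (h, 2) : ℝ) / r h) < θ * m) :
    0 ≤ (∑ h, (r h : ℝ)) * (Real.log K + Real.log B) - L * m * (η / 3 - 3 * g * ε)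
      + g * ∑ h, l h + g * (θ * m) * (L + ∑ h, l h) := by
  classical
  have hg : 0 ≤ g := (abs_nonneg _).trans (hγ 0)
  let lam : Fin m × Fin 3 → ℝ := fun p => if p.2 = 2 then Real.exp (- g * l p.1) else 1
  have key := subM_sub3 G F hGF N lam P
  set lin : Fin m × Fin 3 → MvPolynomial (Fin m × Fin 3) ℝ := fun p => ∑ k, C ((F * (N p.1).map (Int.cast : ℤ → ℝ)) p.2 k * lam (p.1, k)) * X (p.1, k)
  have hlin : ∀ p, l1 (lin p) ≤ B * Real.exp (γ p.2 * l p.1) := by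
    rintro ⟨h, j⟩
    refine (l1_sum _ _).trans ?_
    have : ∀ k ∈ (Finset.univ : Finset (Fin 3)), l1 (C ((F * (N h).map (Int.cast : ℤ → ℝ)) j k * lam (h, k)) * X (h, k) : MvPolynomial (Fin m × Fin 3) ℝ)
        ≤ |(F * (N h).map (Int.cast : ℤ → ℝ)) j k| * lam (h, k) := by
      intro k _
      refine (l1_mul _ _).trans ?_
      rw [l1_C, l1_X, mul_one, Real.norm_eq_abs, abs_mul]
      have : 0 ≤ lam (h, k) := by
        simp only [lam]; split_ifs <;> positivity
      rw [abs_of_nonneg this]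
    refine (Finset.sum_le_sum this).trans ?_
    rw [Fin.sum_univ_three]
    have l0 : lam (h, 0) = 1 := by simp [lam]
    have l1' : lam (h, 1) = 1 := by simp [lam]
    have l2 : lam (h, 2) = Real.exp (- g * l h) := by simp [lam]
    rw [l0, l1', l2]
    have h3 : Real.exp (- g * l h) ≤ Real.exp (γ j * l h) := by
      apply Real.exp_le_exp.2
      apply mul_le_mul_of_nonneg_right _ (hl h).le
      have := (abs_le.1 (hγ j)).1
      linarith
    have h4 := mul_le_mul_of_nonneg_left h3 (abs_nonneg ((F * (N h).map (Int.cast : ℤ → ℝ)) j 2))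
    have h5 := mul_le_mul_of_nonneg_right (hN2 h j) (Real.exp_pos (γ j * l h)).le
    have := hN0 h j
    have := hN1 h j
    show _ ≤ B * Real.exp (γ j * l h)
    linarith
  -- bound of l1
  have hbound : l1 (scaleH lam (MvPolynomial.map (Int.castRingHom ℝ) (subM N P))) ≤
      K ^ (∑ h, r h) * (B ^ (∑ h, r h) * Real.exp (- L * m * (η / 3 - 3 * g * ε) + g * ∑ h, l h)) := by
    rw [key]
    refine (l1_eval₂ _ _ _).trans ?_
    refine le_trans ?_ (mul_le_mul_of_nonneg_right hPl (by positivity))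
    rw [l1, Finset.sum_mul]
    refine Finset.sum_le_sum fun J hJ => ?_
    rw [RingHom.id_apply]
    refine mul_le_mul_of_nonneg_left ?_ (norm_nonneg _)
    have hJ' := mem_support_iff.1 hJ
    refine (Finset.prod_le_prod (fun p _ => pow_nonneg (l1_nonneg _) _)
      (fun p _ => pow_le_pow_left₀ (l1_nonneg _) (hlin p) _)).trans ?_
    simp only [mul_pow]
    rw [Finset.prod_mul_distrib, Finset.prod_pow_eq_pow_sum]
    have e1 : ∑ p, J p = ∑ h, r h := by
      rw [Fintype.sum_prod_type]
      exact Finset.sum_congr rfl fun h _ => hPh J hJ' h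
    rw [e1]
    refine mul_le_mul_of_nonneg_left ?_ (by positivity)
    have e2 : ∏ p : Fin m × Fin 3, Real.exp (γ p.2 * l p.1) ^ J p = Real.exp (∑ p : Fin m × Fin 3, γ p.2 * l p.1 * J p) := by
      rw [Real.exp_sum]
      refine Finset.prod_congr rfl fun p _ => ?_
      rw [← Real.exp_nat_mul, mul_comm]
    rw [e2]
    exact Real.exp_le_exp.2 (exponent_bound r hr l hl L hL h1 h2 γ g η ε hγ hη J (hPh J hJ') (hPe J hJ'))
  -- lower bound
  have hlow : Real.exp (- (g * (θ * m) * (L + ∑ h, l h))) ≤ l1 (scaleH lam (MvPolynomial.map (Int.castRingHom ℝ) (subM N P))) := by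
    refine le_trans ?_ (norm_coeff_le_l1 _ M)
    rw [coeff_scaleH, coeff_map, norm_mul]
    have c1 : 1 ≤ ‖(Int.castRingHom ℝ) (coeff M (subM N P))‖ := by
      simp only [eq_intCast, Real.norm_eq_abs]
      exact_mod_cast Int.one_le_abs hM
    have c2 : ∏ p, lam p ^ M p = Real.exp (- (g * ∑ h, l h * M (h, 2))) := by
      rw [Fintype.prod_prod_type, Finset.mul_sum, ← Finset.sum_neg_distrib, Real.exp_sum]
      refine Finset.prod_congr rfl fun h _ => ?_
      rw [Fin.prod_univ_three]
      simp only [lam]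
      rw [if_neg (by decide), if_neg (by decide), if_pos trivial, one_pow, one_pow, one_mul, one_mul,
        ← Real.exp_nat_mul]
      congr 1
      ring
    rw [c2, Real.norm_eq_abs (Real.exp _), Real.abs_exp]
    refine le_trans ?_ (le_mul_of_one_le_left (Real.exp_pos _).le c1)
    apply Real.exp_le_exp.2
    have c3 : ∑ h, l h * M (h, 2) ≤ (θ * m) * (L + ∑ h, l h) := by
      have hS : 0 ≤ ∑ h, l h := Finset.sum_nonneg fun h _ => (hl h).le
      have : ∀ h ∈ (Finset.univ : Finset (Fin m)), l h * M (h, 2) ≤ ((M (h, 2) : ℝ) / r h) * (L + ∑ h, l h) := by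
        intro h _
        have hr' : (0:ℝ) < r h := by exact_mod_cast hr h
        have : l h ≤ ∑ h, l h := Finset.single_le_sum (f := l) (fun h _ => (hl h).le) (Finset.mem_univ h)
        have h3 : r h * l h ≤ L + ∑ h, l h := (h2 h).trans (by linarith)
        calc l h * M (h, 2) = ((M (h, 2) : ℝ) / r h) * (r h * l h) := by field_simp
          _ ≤ _ := mul_le_mul_of_nonneg_left h3 (by positivity)
      refine (Finset.sum_le_sum this).trans ?_
      rw [← Finset.sum_mul]
      exact mul_le_mul_of_nonneg_right hMθ.le (by linarith)
    have := mul_le_mul_of_nonneg_left c3 hg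
    linarith
  have hfin := hlow.trans hbound
  have e3 : K ^ (∑ h, r h) * (B ^ (∑ h, r h) * Real.exp (- L * m * (η / 3 - 3 * g * ε) + g * ∑ h, l h))
      = Real.exp ((∑ h, (r h : ℝ)) * (Real.log K + Real.log B) + (- L * m * (η / 3 - 3 * g * ε) + g * ∑ h, l h)) := by
    have : ∀ y : ℝ, 1 ≤ y → Real.exp ((∑ h, (r h : ℝ)) * Real.log y) = y ^ (∑ h, r h) := by
      intro y hy
      rw [← Nat.cast_sum, Real.exp_nat_mul, Real.exp_log (by linarith)]
    rw [mul_add, add_assoc, Real.exp_add (_ * Real.log K), Real.exp_add (_ * Real.log B), this K hK, this B hB]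
  rw [e3] at hfin
  have := Real.exp_le_exp.1 hfin
  linarith
end Sub6

namespace Sub6
open MvPolynomial

noncomputable def slc {m : ℕ} (c : Fin 3) (I : Fin m × Fin 3 →₀ ℕ) : Fin m →₀ ℕ :=
  Finsupp.equivFunOnFinite.symm fun h => I (h, c)

lemma slc_apply {m : ℕ} (c : Fin 3) (I : Fin m × Fin 3 →₀ ℕ) (h : Fin m) : slc c I h = I (h, c) := rfl

noncomputable def wr {m : ℕ} (r : Fin m → ℕ) : (Fin m →₀ ℕ) →+ ℝ where
  toFun k := ∑ h, (k h : ℝ) / r h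
  map_zero' := by simp
  map_add' a b := by simp [add_div, Finset.sum_add_distrib]

lemma wr_apply {m : ℕ} (r : Fin m → ℕ) (k) : wr r k = ∑ h, (k h : ℝ) / r h := rfl

lemma wr_single {m : ℕ} (r : Fin m → ℕ) (h : Fin m) : wr r (Finsupp.single h 1) = 1 / r h := by
  classical
  rw [wr_apply, Finset.sum_eq_single h]
  · simp
  · intro b _ hb; simp [Finsupp.single_apply, Ne.symm hb]
  · simp

/-- block matrices `(u,v,e_a)` -/
def NN {m : ℕ} (a : Fin 3) (u v : Fin m → Fin 3 → ℤ) (h : Fin m) : Matrix (Fin 3) (Fin 3) ℤ :=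
  Matrix.of fun i k => ![u h i, v h i, if i = a then 1 else 0] k

lemma eval₂_intc {σ S : Type*} [CommRing S] (g : σ → S) (k : ℤ) :
    eval₂ (Int.castRingHom S) g ((k : ℤ) : MvPolynomial σ ℤ) = (k : S) := by
  rw [← coe_eval₂Hom, map_intCast]

abbrev YY (m : ℕ) : Type := MvPolynomial (Fin m) (MvPolynomial (Fin m) ℚ)

set_option maxHeartbeats 1000000 in
lemma pen_subst {m : ℕ} (e : Equiv.Perm (Fin 3)) (u v : Fin m → Fin 3 → ℤ) (d n : Fin m → ℤ)
    (hd : ∀ h, d h = u h (e 1) * v h (e 2) - u h (e 2) * v h (e 1)) (hd0 : ∀ h, d h ≠ 0)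
    (hn : ∀ h, n h = u h (e 2) * v h (e 0) - u h (e 0) * v h (e 2))
    (r : Fin m → ℕ) (P : MvPolynomial (Fin m × Fin 3) ℤ) (hP : P ≠ 0) (hPh : BlockHom r P) (c : ℝ)
    (hM : ∀ M, coeff M (subM (NN (e 0) u v) P) ≠ 0 → c ≤ ∑ h, (M (h, 2) : ℝ) / r h) :
    ∃ f : MvPolynomial (Fin m) ℤ, f ≠ 0 ∧ l1 f ≤ l1 P ∧ (∀ k, coeff k f ≠ 0 → ∀ h, k h ≤ r h) ∧
      ∀ k, coeff k (Tr (fun h => -(n h : ℚ) / d h) (MvPolynomial.map (Int.castRingHom ℚ) f)) ≠ 0 →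
        c ≤ ∑ h, (k h : ℝ) / r h := by
  classical
  have he01 : e 0 ≠ e 1 := fun h => by have := e.injective h; revert this; decide
  have he02 : e 0 ≠ e 2 := fun h => by have := e.injective h; revert this; decide
  have he12 : e 1 ≠ e 2 := fun h => by have := e.injective h; revert this; decide
  have hcase : ∀ i, i = e 0 ∨ i = e 1 ∨ i = e 2 := by
    intro i
    obtain ⟨j, rfl⟩ := e.surjective i
    fin_cases j <;> simp
  let fm : Fin m → ℤ := fun h => u h (e 0) * v h (e 1) - u h (e 1) * v h (e 0)
  let D : Fin m → YY m := fun h => C (C (1 / (d h : ℚ)))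
  have hD : ∀ h, ((d h : ℤ) : YY m) * D h = 1 := by
    intro h
    have h1 : ((d h : ℤ) : YY m) = C (C (d h : ℚ)) := by simp
    rw [h1]
    simp only [D]
    rw [← map_mul, ← map_mul, mul_one_div_cancel (by exact_mod_cast hd0 h), map_one, map_one]
  let tA : Fin m → YY m := fun h => C (X h) - D h * ((n h : ℤ) : YY m) - D h * ((fm h : ℤ) : YY m) * X h
  let tg : Fin m × Fin 3 → YY m := fun p => if p.2 = e 0 then tA p.1 else if p.2 = e 1 then 1 else X p.1
  let ps : Fin m × Fin 3 → YY m := fun p =>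
    ![D p.1 * (((v p.1 (e 2) : ℤ) : YY m) - ((v p.1 (e 1) : ℤ) : YY m) * X p.1),
      D p.1 * (- ((u p.1 (e 2) : ℤ) : YY m) + ((u p.1 (e 1) : ℤ) : YY m) * X p.1), C (X p.1)] p.2
  have hcomp : eval₂Hom (Int.castRingHom (YY m)) tg =
      (eval₂Hom (Int.castRingHom (YY m)) ps).comp (subM (NN (e 0) u v)) := by
    apply MvPolynomial.ringHom_ext
    · intro a; simp [subM]
    · rintro ⟨h, i⟩
      simp only [RingHom.comp_apply, subM, coe_eval₂Hom, eval₂_X, eval₂_sum, eval₂_mul, eval₂_C,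
        Fin.sum_univ_three, NN, Matrix.of_apply]
      have hDh := hD h
      rw [hd h] at hDh
      push_cast at hDh
      rcases hcase i with rfl | rfl | rfl
      · simp [tg, ps, tA, hn h, fm, eval₂_intc]
        linear_combination (0:YY m) * hDh
      · simp [tg, ps, he01.symm, eval₂_intc]
        linear_combination - hDh
      · simp [tg, ps, he02.symm, he12.symm, eval₂_intc]
        linear_combination - X h * hDh
  -- weight part
  have hW : ∀ l, Wge (wr r) c (coeff l (eval₂Hom (Int.castRingHom (YY m)) tg P)) := by
    intro l
    rw [hcomp, RingHom.comp_apply, coe_eval₂Hom, eval₂_eq', coeff_sum]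
    apply Wge.sum
    intro M hMs
    have e1 : ∏ p, ps p ^ M p = (∏ h, (ps (h, 0) ^ M (h, 0) * ps (h, 1) ^ M (h, 1))) *
        C (∏ h, X h ^ M (h, 2)) := by
      rw [Fintype.prod_prod_type, map_prod, ← Finset.prod_mul_distrib]
      refine Finset.prod_congr rfl fun h _ => ?_
      rw [Fin.prod_univ_three, map_pow]
      rfl
    rw [e1, ← mul_assoc, mul_comm _ (C _), coeff_C_mul, mul_comm]
    have w1 : ∀ q : MvPolynomial (Fin m) ℚ, Wge (wr r) 0 q := fun q k _ => by
      rw [wr_apply]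
      exact Finset.sum_nonneg fun h _ => by positivity
    have w2 := Wge.prod (w := wr r) Finset.univ (fun h => (X h : MvPolynomial (Fin m) ℚ) ^ M (h, 2)) _
      (fun h _ => (Wge.X1 (R := ℚ) (w := wr r) h).pow (M (h, 2)))
    refine ((w1 _).mul w2).mono ?_
    rw [zero_add]
    refine (hM M (mem_support_iff.1 hMs)).trans (le_of_eq ?_)
    refine Finset.sum_congr rfl fun h _ => ?_
    rw [wr_single]; ring
  -- minimal slice
  have hne : (P.support.image (slc (e 2))).Nonempty := by
    rw [Finset.image_nonempty]
    exact support_nonempty.2 hP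
  obtain ⟨ls, hls⟩ := Finset.exists_minimal hne
  obtain ⟨I0, hI0, hI0l⟩ := Finset.mem_image.1 hls.1
  have hmin : ∀ I ∈ P.support, slc (e 2) I ≤ ls → slc (e 2) I = ls := by
    intro I hI hle
    exact le_antisymm hle (hls.2 (Finset.mem_image_of_mem _ hI) hle)
  set f : MvPolynomial (Fin m) ℤ :=
    ∑ I ∈ P.support.filter (fun I => slc (e 2) I = ls), monomial (slc (e 0) I) (coeff I P) with hf
  have hsum3 : ∀ I ∈ P.support, ∀ h, I (h, e 0) + I (h, e 1) + I (h, e 2) = r h := by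
    intro I hI h
    rw [← hPh I (mem_support_iff.1 hI) h, ← Equiv.sum_comp e, Fin.sum_univ_three]
  refine ⟨f, ?_, ?_, ?_, ?_⟩
  · apply ne_zero_iff.2
    refine ⟨slc (e 0) I0, ?_⟩
    rw [hf, coeff_sum, Finset.sum_eq_single I0]
    · rw [coeff_monomial, if_pos rfl]; exact mem_support_iff.1 hI0
    · intro I hI hne
      obtain ⟨hI1, hI2⟩ := Finset.mem_filter.1 hI
      rw [coeff_monomial, if_neg]
      intro heq
      apply hne
      refine Finsupp.ext fun ⟨h, i⟩ => ?_
      have a1 := hsum3 I hI1 h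
      have a2 := hsum3 I0 hI0 h
      have a3 : I (h, e 0) = I0 (h, e 0) := DFunLike.congr_fun heq h
      have a4 : I (h, e 2) = I0 (h, e 2) := DFunLike.congr_fun (hI2.trans hI0l.symm) h
      rcases hcase i with rfl | rfl | rfl
      · exact a3
      · omega
      · exact a4
    · intro h
      exact absurd (Finset.mem_filter.2 ⟨hI0, hI0l⟩) h
  · refine (l1_sum _ _).trans ?_
    simp only [l1_monomial]
    exact Finset.sum_le_sum_of_subset_of_nonneg (Finset.filter_subset _ _) fun _ _ _ => norm_nonneg _
  · intro k hk h
    rw [hf, coeff_sum] at hk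
    obtain ⟨I, hI, hIk⟩ := Finset.exists_ne_zero_of_sum_ne_zero hk
    rw [coeff_monomial] at hIk
    have : slc (e 0) I = k := by by_contra h'; exact hIk (if_neg h')
    rw [← this, slc_apply]
    have := hsum3 I (Finset.mem_filter.1 hI).1 h
    omega
  · intro k hk
    have heq : coeff ls (eval₂Hom (Int.castRingHom (YY m)) tg P) =
        Tr (fun h => -(n h : ℚ) / d h) (MvPolynomial.map (Int.castRingHom ℚ) f) := by
      rw [coe_eval₂Hom, eval₂_eq', coeff_sum, hf, map_sum, map_sum, Finset.sum_filter]
      refine Finset.sum_congr rfl fun I hI => ?_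
      have e1 : ∏ p, tg p ^ I p = (∏ h, tA h ^ I (h, e 0)) * monomial (slc (e 2) I) 1 := by
        rw [monomial_eq, C_1, one_mul, Finsupp.prod_fintype _ _ (by simp), Fintype.prod_prod_type,
          ← Finset.prod_mul_distrib]
        refine Finset.prod_congr rfl fun h _ => ?_
        rw [← Equiv.prod_comp e, Fin.prod_univ_three]
        simp [tg, he01.symm, he02.symm, he12.symm, slc_apply]
      rw [e1, ← mul_assoc, coeff_mul_monomial']
      by_cases hc : slc (e 2) I = ls
      · rw [if_pos hc, if_pos hc.le, hc, tsub_self, mul_one, map_monomial, Tr, aeval_monomial,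
          Finsupp.prod_fintype _ _ (by simp)]
        rw [← constantCoeff_eq, map_mul, map_prod]
        congr 1
        · simp
        · refine Finset.prod_congr rfl fun h _ => ?_
          rw [map_pow, slc_apply]
          congr 1
          simp only [tA, map_sub, map_mul, constantCoeff_C, constantCoeff_X, mul_zero, sub_zero, D]
          have : constantCoeff ((n h : ℤ) : YY m) = C ((n h : ℤ) : ℚ) := by simp
          rw [this, ← map_mul, sub_eq_add_neg, ← map_neg]
          congr 2
          ring
      · rw [if_neg hc, if_neg (fun hle => hc (hmin I hI hle))]
    rw [← heq] at hk
    exact hW ls k hk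
end Sub6

namespace Sub6
open MvPolynomial

def PenData (F : Matrix (Fin 3) (Fin 3) ℝ) (e : Equiv.Perm (Fin 3)) (γ : Fin 3 → ℝ) (κ : ℝ)
    (l : ℝ) (u v : Fin 3 → ℤ) : Prop :=
  (∀ j, |∑ i, F j i * u i| ≤ Real.exp (γ j * l)) ∧ (∀ j, |∑ i, F j i * v i| ≤ Real.exp (γ j * l)) ∧
  u (e 1) * v (e 2) - u (e 2) * v (e 1) ≠ 0 ∧
  Real.exp (κ * l) ≤ ((((u (e 2) * v (e 0) - u (e 0) * v (e 2) : ℤ) : ℚ) /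
    ((u (e 1) * v (e 2) - u (e 2) * v (e 1) : ℤ) : ℚ)).den : ℝ)

set_option maxHeartbeats 1000000 in
theorem penult (G F : Matrix (Fin 3) (Fin 3) ℝ) (hGF : G * F = 1) (hG : AuxGood G)
    (e : Equiv.Perm (Fin 3)) (γ : Fin 3 → ℝ) (η : ℝ) (hη : 0 < η) (hγη : ∑ j, γ j ≤ -η)
    (κ : ℝ) (hκ : 0 < κ) :
    ∃ l0 : ℝ, 0 < l0 ∧ ∀ l, l0 ≤ l → ∀ u v, ¬ PenData F e γ κ l u v := by
  by_contra hcon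
  push Not at hcon
  choose! lf hlf uf vf hdat using hcon
  set g : ℝ := 1 + ∑ j, |γ j| with hg
  have hγg : ∀ j, |γ j| ≤ g := by
    intro j
    have := Finset.single_le_sum (f := fun j => |γ j|) (fun _ _ => abs_nonneg _) (Finset.mem_univ j)
    linarith
  have hg1 : 1 ≤ g := by
    have : 0 ≤ ∑ j, |γ j| := Finset.sum_nonneg fun _ _ => abs_nonneg _
    linarith
  set θ : ℝ := η / (100 * g) with hθ
  have hθ0 : 0 < θ := by positivity
  have hgθ : g * θ = η / 100 := by rw [hθ]; field_simp
  obtain ⟨m, hm, K, hK, hP⟩ := hG θ hθ0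
  have hm' : (0:ℝ) < m := by exact_mod_cast hm
  obtain ⟨ω, hω, hRoth⟩ := roth_lemma m (θ * m) (by positivity)
  set B : ℝ := 2 + ∑ j, |F j (e 0)| with hB
  have hBj : ∀ j, 2 + |F j (e 0)| ≤ B := by
    intro j
    have := Finset.single_le_sum (f := fun j => |F j (e 0)|) (fun _ _ => abs_nonneg _) (Finset.mem_univ j)
    linarith
  have hB1 : 1 ≤ B := by linarith [hBj 0, abs_nonneg (F 0 (e 0))]
  set lb := Real.log K + Real.log B with hlb
  have hlK : 0 ≤ Real.log K := Real.log_nonneg hK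
  have hlB : 0 ≤ Real.log B := Real.log_nonneg hB1
  have hlb0 : 0 ≤ lb := by linarith
  set lmin : ℝ := 1 + 100 * lb / η + 4 / (ω * κ) + 4 * m * lb / (ω * κ) with hlmin
  have t1 : 0 ≤ 100 * lb / η := by positivity
  have t2 : 0 ≤ 4 / (ω * κ) := by positivity
  have t3 : 0 ≤ 4 * m * lb / (ω * κ) := by positivity
  have hl1 : 1 ≤ lmin := by linarith
  have hla : 100 * lb ≤ lmin * η := by
    rw [← div_le_iff₀ hη]; linarith
  have hlbb : 4 ≤ lmin * (ω * κ) := by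
    rw [← div_le_iff₀ (by positivity)]; linarith
  have hlc : 4 * m * lb ≤ lmin * (ω * κ) := by
    rw [← div_le_iff₀ (by positivity)]; linarith
  -- the sequence
  let S : ℕ → ℝ := fun n => Nat.rec lmin (fun _ x => (2 / ω + 1) * lf x) n
  have hS0 : S 0 = lmin := rfl
  have hSs : ∀ n, S (n+1) = (2 / ω + 1) * lf (S n) := fun n => rfl
  have hc1 : 1 ≤ 2 / ω + 1 := by have : 0 ≤ 2 / ω := by positivity
                                 linarith
  have hSp : ∀ n, lmin ≤ S n := by
    intro n
    induction n with
    | zero => exact le_of_eq hS0.symm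
    | succ n ih =>
      rw [hSs]
      have := hlf (S n) (by linarith)
      nlinarith
  have hlfS : ∀ n, S n ≤ lf (S n) := fun n => hlf (S n) (by linarith [hSp n])
  have hgrow : ∀ n k, (2 / ω + 1) * lf (S n) ≤ lf (S (n + k + 1)) := by
    intro n k
    induction k with
    | zero => rw [← hSs]; exact hlfS (n + 1)
    | succ k ih =>
      have h1 := hlfS (n + (k + 1) + 1)
      rw [hSs] at h1
      have h2 : 0 ≤ lf (S (n + k + 1)) := by linarith [hlfS (n+k+1), hSp (n+k+1)]
      have h3 : lf (S (n + k + 1)) ≤ (2 / ω + 1) * lf (S (n + k + 1)) := by nlinarith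
      exact ih.trans (h3.trans h1)
  let l : Fin m → ℝ := fun h => lf (S (m - 1 - h))
  let u : Fin m → Fin 3 → ℤ := fun h => uf (S (m - 1 - h))
  let v : Fin m → Fin 3 → ℤ := fun h => vf (S (m - 1 - h))
  have hD : ∀ h, PenData F e γ κ (l h) (u h) (v h) := fun h =>
    hdat _ (by linarith [hSp (m - 1 - h)])
  have hlm : ∀ h, lmin ≤ l h := fun h => (hSp _).trans (hlfS _)
  have hl0 : ∀ h, 0 < l h := fun h => by linarith [hlm h]
  have hlij : ∀ i j : Fin m, i < j → (2 / ω) * l j ≤ l i := by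
    intro i j hij
    have := hgrow (m - 1 - j) (j - i - 1)
    have e1 : m - 1 - (j:ℕ) + (j - i - 1) + 1 = m - 1 - i := by
      have := j.2; have : (i:ℕ) < j := hij; omega
    rw [e1] at this
    have h2 := hl0 j
    show (2 / ω) * lf (S (m - 1 - j)) ≤ lf (S (m - 1 - i))
    have h3 : (2 / ω + 1) * lf (S (m - 1 - j)) = (2 / ω) * lf (S (m - 1 - j)) + l j := by
      show _ = _ + lf (S (m - 1 - j)); ring
    linarith
  clear_value l u v
  set E := ∑ h, l h with hE
  have hE0 : 0 ≤ E := Finset.sum_nonneg fun h _ => (hl0 h).le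
  have hlE : ∀ h, l h ≤ E := fun h => Finset.single_le_sum (f := l) (fun h _ => (hl0 h).le) (Finset.mem_univ h)
  set cc := m * lb + g * E + m * η * E / 100 with hcc
  have hcc0 : 0 ≤ cc := by positivity
  set L : ℝ := 1 + 2 / ω * E + 4 / (ω * κ) + 4 * m * lb / (ω * κ) + 4 / (m * η) * cc with hL
  have q1 : 0 ≤ 2 / ω * E := by positivity
  have q2 : 0 ≤ 4 / (m * η) * cc := by positivity
  have hL1 : 1 ≤ L := by linarith
  have hLE : 2 / ω * E ≤ L := by linarith
  have hLb : 4 ≤ L * (ω * κ) := by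
    rw [← div_le_iff₀ (by positivity)]; linarith
  have hLc : 4 * m * lb ≤ L * (ω * κ) := by
    rw [← div_le_iff₀ (by positivity)]; linarith
  have hLd : 4 * cc < L * (m * η) := by
    rw [← div_lt_iff₀ (by positivity)]
    have : 4 / (m * η) * cc = 4 * cc / (m * η) := by ring
    linarith
  clear_value L
  let r : Fin m → ℕ := fun h => ⌈L / l h⌉₊
  have hr1 : ∀ h, L ≤ r h * l h := fun h => by
    rw [← div_le_iff₀ (hl0 h)]; exact Nat.le_ceil _
  have hr2' : ∀ h, (r h : ℝ) ≤ L / l h + 1 := fun h =>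
    (Nat.ceil_lt_add_one (div_nonneg (by linarith) (hl0 h).le)).le
  have hr2 : ∀ h, r h * l h ≤ L + l h := fun h => by
    have := mul_le_mul_of_nonneg_right (hr2' h) (hl0 h).le
    rwa [add_mul, one_mul, div_mul_cancel₀ _ (hl0 h).ne'] at this
  have hr0 : ∀ h, 0 < r h := fun h => Nat.ceil_pos.2 (div_pos (by linarith) (hl0 h))
  have hLl : ∀ h, L / l h ≤ L / lmin := fun h =>
    div_le_div_of_nonneg_left (by linarith) (by linarith) (hlm h)
  clear_value r
  have hsumr : ∑ h, (r h : ℝ) ≤ m * (L / lmin + 1) := by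
    have : ∀ h ∈ (Finset.univ : Finset (Fin m)), (r h : ℝ) ≤ L / lmin + 1 := fun h _ =>
      (hr2' h).trans (by linarith [hLl h])
    refine (Finset.sum_le_sum this).trans ?_
    rw [Finset.sum_const, Finset.card_univ, Fintype.card_fin, nsmul_eq_mul]
  have hLlm : ∀ x y : ℝ, 0 ≤ x → x ≤ lmin * y → L / lmin * x ≤ L * y := by
    intro x y hx hxy
    have h1 : L / lmin * x ≤ L / lmin * (lmin * y) := mul_le_mul_of_nonneg_left hxy (by positivity)
    have h2 : L / lmin * (lmin * y) = L * y := by field_simp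
    linarith
  obtain ⟨P, hP0, hPh, hPl, hPGl, hPGh, hPe⟩ := hP r hr0
  -- weights
  have hM : ∀ M, coeff M (subM (NN (e 0) u v) P) ≠ 0 → θ * m ≤ ∑ h, (M (h, 2) : ℝ) / r h := by
    intro M hMc
    by_contra hlt
    push Not at hlt
    have key := small_coeff r hr0 l hl0 L (by linarith) hr1 hr2 γ g η θ hγg hγη G F hGF
      (NN (e 0) u v) B hB1 ?_ ?_ ?_ P K hK hPGl hPGh hPe θ M hMc hlt
    · have k1 : (∑ h, (r h : ℝ)) * lb ≤ m * (L * (η / 100)) + m * lb := by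
        have := mul_le_mul_of_nonneg_right hsumr hlb0
        have h3 := hLlm lb (η / 100) hlb0 (by linarith)
        have h4 := mul_le_mul_of_nonneg_left h3 hm'.le
        linarith
      have k2 : L * m * (η / 3 - 3 * g * θ) = L * m * (η / 3 - 3 * (η / 100)) := by
        rw [← hgθ]; ring
      have k3 : g * (θ * m) * (L + E) = η / 100 * m * (L + E) := by rw [← hgθ]; ring
      rw [← hlb, k2, k3] at key
      have : 0 < L * (m * η) := by positivity
      linarith
    · intro h j
      have := (hD h).1 j
      simpa [Matrix.mul_apply, NN] using this
    · intro h j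
      have := (hD h).2.1 j
      simpa [Matrix.mul_apply, NN] using this
    · intro h j
      have := hBj j
      simpa [Matrix.mul_apply, NN] using this
  obtain ⟨f, hf0, hfl, hfr, hfk⟩ := pen_subst e u v _ _ (fun h => rfl) (fun h => (hD h).2.2.1)
    (fun h => rfl) r P hP0 hPh (θ * m) hM
  let ξ : Fin m → ℚ := fun h => -(((u h (e 2) * v h (e 0) - u h (e 0) * v h (e 2) : ℤ) : ℚ)) /
    ((u h (e 1) * v h (e 2) - u h (e 2) * v h (e 1) : ℤ) : ℚ)
  have hR : ∃ k, coeff k (Tr (fun h => (((ξ h).num : ℤ) : ℚ) / ((ξ h).den : ℚ)) (MvPolynomial.map (Int.castRingHom ℚ) f)) ≠ 0 ∧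
      ∑ h, (k h : ℝ) / r h < θ * m := by
    refine hRoth r hr0 ?_ (fun h => (ξ h).num) (fun h => (ξ h).den)
      (fun h => (ξ h).den_pos) ?_ (κ * L) (by positivity) ?_ ?_ f hf0 hfr ?_
    · intro i j hij
      have h1 := hr2' i
      have h2 := hr1 j
      have h3 := hlij i j hij
      have h4 : L / l i ≤ ω / 2 * (L / l j) := by
        have : L / l i ≤ L / (2 / ω * l j) :=
          div_le_div_of_nonneg_left (by linarith) (by have := hl0 j; positivity) h3
        refine this.trans (le_of_eq ?_)
        have := (hl0 j).ne'
        field_simp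
      have h5 : L / l j ≤ r j := by rwa [div_le_iff₀ (hl0 j)]
      have h6 : 2 / ω ≤ r j := by
        refine le_trans ?_ h5
        rw [le_div_iff₀ (hl0 j)]
        exact (mul_le_mul_of_nonneg_left (hlE j) (by positivity)).trans hLE
      have h7 : 1 ≤ ω / 2 * r j := by
        have := mul_le_mul_of_nonneg_left h6 (show 0 ≤ ω / 2 by positivity)
        have e3 : ω / 2 * (2 / ω) = 1 := by field_simp
        linarith
      have h8 := mul_le_mul_of_nonneg_left h5 (show 0 ≤ ω / 2 by positivity)
      linarith
    · intro h
      exact Int.isCoprime_iff_nat_coprime.2 (by simpa using (ξ h).reduced)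
    · intro h
      have h1 := (hD h).2.2.2
      have h2 : κ * l h ≤ Real.log ((ξ h).den : ℝ) := by
        have e3 : (ξ h).den = (((u h (e 2) * v h (e 0) - u h (e 0) * v h (e 2) : ℤ) : ℚ) /
          ((u h (e 1) * v h (e 2) - u h (e 2) * v h (e 1) : ℤ) : ℚ)).den := by
          simp only [ξ]
          rw [neg_div, Rat.den_neg_eq_den]
        rw [e3, Real.le_log_iff_exp_le]
        · exact h1
        · exact_mod_cast Rat.den_pos _
      calc κ * L ≤ κ * (r h * l h) := mul_le_mul_of_nonneg_left (hr1 h) hκ.le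
        _ = r h * (κ * l h) := by ring
        _ ≤ _ := mul_le_mul_of_nonneg_left h2 (by positivity)
    · intro h
      have h1 := hr2' h
      have h2 := hLl h
      have h3 := hLlm 4 (ω * κ) (by norm_num) hlbb
      have e3 : ω * (κ * L) = L * (ω * κ) := by ring
      linarith
    · have h1 : Real.log (l1 f) ≤ (∑ h, (r h : ℝ)) * Real.log K := by
        have h2 : Real.log (l1 f) ≤ Real.log (K ^ (∑ h, r h)) :=
          Real.log_le_log (by linarith [one_le_l1 f hf0]) (hfl.trans hPl)
        rw [Real.log_pow] at h2
        push_cast at h2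
        exact h2
      have h3 : (∑ h, (r h : ℝ)) * Real.log K ≤ m * (L / lmin + 1) * lb :=
        mul_le_mul hsumr (by linarith) hlK (by positivity)
      have h4 := hLlm (4 * m * lb) (ω * κ) (by positivity) hlc
      have e3 : ω * (κ * L) = L * (ω * κ) := by ring
      have e4 : m * (L / lmin + 1) * lb = (L / lmin * (4 * m * lb)) / 4 + (4 * m * lb) / 4 := by ring
      have : 0 < L * (ω * κ) := by positivity
      linarith
  obtain ⟨k, hk1, hk2⟩ := hR
  have e2 : (fun h => ((ξ h).num : ℚ) / (ξ h).den) = ξ := by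
    funext h; exact Rat.num_div_den _
  rw [e2] at hk1
  have := hfk k hk1
  linarith
end Sub6

namespace Sub6
open MvPolynomial

def cr (u v : Fin 3 → ℤ) : Fin 3 → ℤ :=
  ![u 1 * v 2 - u 2 * v 1, u 2 * v 0 - u 0 * v 2, u 0 * v 1 - u 1 * v 0]

lemma perm3 : ∀ e : Equiv.Perm (Fin 3), (e 0 = 0 ∧ e 1 = 1 ∧ e 2 = 2) ∨ (e 0 = 0 ∧ e 1 = 2 ∧ e 2 = 1)
    ∨ (e 0 = 1 ∧ e 1 = 0 ∧ e 2 = 2) ∨ (e 0 = 1 ∧ e 1 = 2 ∧ e 2 = 0) ∨ (e 0 = 2 ∧ e 1 = 0 ∧ e 2 = 1)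
    ∨ (e 0 = 2 ∧ e 1 = 1 ∧ e 2 = 0) := by decide

lemma perm3' : ∀ a : Fin 3, ∃ e f : Equiv.Perm (Fin 3), e 0 = a ∧ f 0 = a ∧ e 1 = f 2 ∧ f 1 = e 2 := by
  decide

lemma cr_perm (u v : Fin 3 → ℤ) (e : Equiv.Perm (Fin 3)) : ∃ s : ℤ, (s = 1 ∨ s = -1) ∧
    u (e 1) * v (e 2) - u (e 2) * v (e 1) = s * cr u v (e 0) ∧
    u (e 2) * v (e 0) - u (e 0) * v (e 2) = s * cr u v (e 1) := by
  rcases perm3 e with h | h | h | h | h | h <;> obtain ⟨h0, h1, h2⟩ := h <;> rw [h0, h1, h2]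
  · exact ⟨1, by simp, by simp [cr], by simp [cr]⟩
  · exact ⟨-1, by simp, by simp [cr], by simp [cr]⟩
  · exact ⟨-1, by simp, by simp [cr], by simp [cr]⟩
  · exact ⟨1, by simp, by simp [cr], by simp [cr]⟩
  · exact ⟨1, by simp, by simp [cr], by simp [cr]⟩
  · exact ⟨-1, by simp, by simp [cr], by simp [cr]⟩

lemma den_lower (n d : ℤ) (hd : d ≠ 0) :
    d.natAbs ≤ Int.gcd n d * ((n : ℚ) / (d : ℚ)).den := by
  set q : ℚ := (n : ℚ) / (d : ℚ) with hq
  have hdq : (d : ℚ) ≠ 0 := by exact_mod_cast hd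
  have h1 : (n : ℚ) * q.den = q.num * d := by
    have h2 : (q.num : ℚ) = q * q.den := (Rat.mul_den_eq_num q).symm
    rw [h2, hq]; field_simp
  have h3 : n * q.den = q.num * d := by exact_mod_cast h1
  have h4 : d ∣ n * q.den := ⟨q.num, by rw [h3]; ring⟩
  have h5 : d.natAbs ∣ Int.gcd n d * q.den := by
    have : Int.gcd (n * q.den) (d * q.den) = Int.gcd n d * q.den := by
      rw [Int.gcd_mul_right]; simp
    rw [← this]
    exact Nat.dvd_gcd (Int.natAbs_dvd_natAbs.2 h4) (Int.natAbs_dvd_natAbs.2 (dvd_mul_right _ _))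
  refine Nat.le_of_dvd (Nat.mul_pos ?_ q.den_pos) h5
  exact Int.gcd_pos_of_ne_zero_right _ hd

lemma prim_den (u v p : Fin 3 → ℤ) (hp : ∑ i, p i * cr u v i = 1) (a : Fin 3)
    (ha : cr u v a ≠ 0) : ∃ e : Equiv.Perm (Fin 3),
    u (e 1) * v (e 2) - u (e 2) * v (e 1) ≠ 0 ∧
    (cr u v a).natAbs ≤ ((((u (e 2)*v (e 0) - u (e 0)*v (e 2):ℤ):ℚ)/
      ((u (e 1)*v (e 2) - u (e 2)*v (e 1):ℤ):ℚ)).den) ^ 2 := by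
  have key : ∀ e : Equiv.Perm (Fin 3), e 0 = a → 
    u (e 1) * v (e 2) - u (e 2) * v (e 1) ≠ 0 ∧ ((Int.gcd (cr u v a) (cr u v (e 1))) ^ 2 ≤ (cr u v a).natAbs →
      (cr u v a).natAbs ≤ ((((u (e 2)*v (e 0) - u (e 0)*v (e 2):ℤ):ℚ)/
      ((u (e 1)*v (e 2) - u (e 2)*v (e 1):ℤ):ℚ)).den) ^ 2) := by
    intro e he
    obtain ⟨s, hs, h1, h2⟩ := cr_perm u v e
    rw [h1, h2, he]
    have hs0 : s ≠ 0 := by rcases hs with rfl | rfl <;> norm_num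
    refine ⟨mul_ne_zero hs0 ha, fun hg => ?_⟩
    have := den_lower (s * cr u v (e 1)) (s * cr u v a) (mul_ne_zero hs0 ha)
    have hsa : s.natAbs = 1 := by rcases hs with rfl | rfl <;> rfl
    rw [Int.gcd_mul_left, Int.natAbs_mul, hsa, one_mul, one_mul, Int.gcd_comm] at this
    set D := (((s * cr u v (e 1) : ℤ) : ℚ) / ((s * cr u v a : ℤ) : ℚ)).den
    set A := (cr u v a).natAbs with hA
    have hA0 : 0 < A := Int.natAbs_pos.2 ha
    have h4 : A * A ≤ A * D ^ 2 := by
      calc A * A ≤ (Int.gcd (cr u v a) (cr u v (e 1)) * D) * (Int.gcd (cr u v a) (cr u v (e 1)) * D) :=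
            Nat.mul_le_mul this this
        _ = (Int.gcd (cr u v a) (cr u v (e 1))) ^ 2 * D ^ 2 := by ring
        _ ≤ A * D ^ 2 := Nat.mul_le_mul_right _ hg
    exact Nat.le_of_mul_le_mul_left h4 hA0
  obtain ⟨e, f, he, hf, hef, hfe⟩ := perm3' a
  set w := cr u v with hw
  have hsum : p (e 0) * w (e 0) + p (e 1) * w (e 1) + p (e 2) * w (e 2) = 1 := by
    rw [← hp, ← Equiv.sum_comp e, Fin.sum_univ_three]
  have hcop : Nat.Coprime (Int.gcd (w a) (w (e 1))) (Int.gcd (w a) (w (f 1))) := by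
    rw [Nat.coprime_iff_gcd_eq_one, ← Nat.dvd_one]
    set g := Nat.gcd (Int.gcd (w a) (w (e 1))) (Int.gcd (w a) (w (f 1))) with hg
    have d1 : (g : ℤ) ∣ Int.gcd (w a) (w (e 1)) := by exact_mod_cast Nat.gcd_dvd_left _ _
    have d2 : (g : ℤ) ∣ Int.gcd (w a) (w (f 1)) := by exact_mod_cast Nat.gcd_dvd_right _ _
    have da := d1.trans (Int.gcd_dvd_left _ _)
    have db := d1.trans (Int.gcd_dvd_right _ _)
    have dc := d2.trans (Int.gcd_dvd_right _ _)
    rw [hfe] at dc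
    have : (g : ℤ) ∣ 1 := by
      rw [← hsum, he]
      exact dvd_add (dvd_add (da.mul_left _) (db.mul_left _)) (dc.mul_left _)
    exact_mod_cast this
  have hmul : Int.gcd (w a) (w (e 1)) * Int.gcd (w a) (w (f 1)) ≤ (w a).natAbs := by
    refine Nat.le_of_dvd (Int.natAbs_pos.2 ha) (hcop.mul_dvd_of_dvd_of_dvd ?_ ?_)
    · exact Int.natAbs_dvd_natAbs.2 (Int.gcd_dvd_left (w a) (w (e 1)))
    · exact Int.natAbs_dvd_natAbs.2 (Int.gcd_dvd_left (w a) (w (f 1)))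
  rcases le_total (Int.gcd (w a) (w (e 1))) (Int.gcd (w a) (w (f 1))) with h | h
  · refine ⟨e, (key e he).1, (key e he).2 ?_⟩
    rw [pow_two]; exact (Nat.mul_le_mul_left _ h).trans hmul
  · refine ⟨f, (key f hf).1, (key f hf).2 ?_⟩
    rw [pow_two]; exact (Nat.mul_le_mul_right _ h).trans hmul

theorem penultCor (G F : Matrix (Fin 3) (Fin 3) ℝ) (hGF : G * F = 1) (hG : AuxGood G)
    (g η κ : ℝ) (hg : 0 < g) (hη : 0 < η) (hκ : 0 < κ) :
    ∃ H0 : ℝ, 1 < H0 ∧ ∀ H, H0 ≤ H → ∀ B : Fin 3 → ℝ, (∀ j, H ^ (-g) ≤ B j) → (∀ j, B j ≤ H ^ g) →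
      ∏ j, B j ≤ H ^ (-η) → ∀ u v p : Fin 3 → ℤ, (∀ j, |∑ i, F j i * u i| ≤ B j) →
      (∀ j, |∑ i, F j i * v i| ≤ B j) → ∑ i, p i * cr u v i = 1 → 
      (∃ i, H ^ κ ≤ ((cr u v i).natAbs : ℝ)) → False := by
  set N : ℤ := ⌈g * (6 / η)⌉ + 1 with hN
  have hpt : ∀ q : (Fin 3 → Set.Icc (-N) N) × Equiv.Perm (Fin 3), ∃ l0 : ℝ,
      (∑ j, ((q.1 j : ℤ) : ℝ) * (η / 6) ≤ -(η / 2)) → ∀ l, l0 ≤ l → ∀ u v,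
        ¬ PenData F q.2 (fun j => ((q.1 j : ℤ) : ℝ) * (η / 6)) (κ / 2) l u v := by
    intro q
    by_cases h : (∑ j, ((q.1 j : ℤ) : ℝ) * (η / 6) ≤ -(η / 2))
    · obtain ⟨l0, _, h2⟩ := penult G F hGF hG q.2 (fun j => ((q.1 j : ℤ) : ℝ) * (η / 6)) (η / 2)
        (by positivity) h (κ / 2) (by positivity)
      exact ⟨l0, fun _ => h2⟩
    · exact ⟨0, fun h' => absurd h' h⟩
  choose lf hlf using hpt
  obtain ⟨Mx, hMx⟩ := (Set.finite_range lf).bddAbove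
  have hMx' : ∀ q, lf q ≤ Mx := fun q => hMx ⟨q, rfl⟩
  refine ⟨Real.exp (1 + |Mx|), by rw [Real.one_lt_exp_iff]; positivity, ?_⟩
  intro H hH B hB1 hB2 hprod u v p hu hv hp ⟨a, ha⟩
  have hH0 : 0 < H := lt_of_lt_of_le (Real.exp_pos _) hH
  set l := Real.log H with hl
  have hl1 : 1 + |Mx| ≤ l := by rwa [hl, Real.le_log_iff_exp_le hH0]
  have hl0 : 0 < l := by have := abs_nonneg Mx; linarith
  have hpow : ∀ t : ℝ, H ^ t = Real.exp (t * l) := fun t => by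
    rw [Real.rpow_def_of_pos hH0, mul_comm]
  have hB0 : ∀ j, 0 < B j := fun j => lt_of_lt_of_le (Real.rpow_pos_of_pos hH0 _) (hB1 j)
  have hlb : ∀ j, -g * l ≤ Real.log (B j) := fun j => by
    rw [Real.le_log_iff_exp_le (hB0 j), ← hpow]; exact hB1 j
  have hub : ∀ j, Real.log (B j) ≤ g * l := fun j => by
    rw [Real.log_le_iff_le_exp (hB0 j), ← hpow]; exact hB2 j
  have hlp : ∑ j, Real.log (B j) ≤ -η * l := by
    rw [← Real.log_prod (fun j _ => (hB0 j).ne'), Real.log_le_iff_le_exp (Finset.prod_pos fun j _ => hB0 j), ← hpow]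
    exact hprod
  let k : Fin 3 → ℤ := fun j => ⌈Real.log (B j) / l * (6 / η)⌉
  have hk1 : ∀ j, Real.log (B j) / l * (6 / η) ≤ k j := fun j => Int.le_ceil _
  have hk2 : ∀ j, (k j : ℝ) < Real.log (B j) / l * (6 / η) + 1 := fun j => Int.ceil_lt_add_one _
  have hkN : ∀ j, k j ∈ Set.Icc (-N) N := by
    intro j
    have a1 : Real.log (B j) / l ≤ g := by rw [div_le_iff₀ hl0]; exact hub j
    have a2 : -g ≤ Real.log (B j) / l := by rw [le_div_iff₀ hl0]; exact hlb j
    have hc : g * (6 / η) ≤ ⌈g * (6 / η)⌉ := Int.le_ceil _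
    have a3 := mul_le_mul_of_nonneg_right a1 (show 0 ≤ 6 / η by positivity)
    have a4 := mul_le_mul_of_nonneg_right a2 (show 0 ≤ 6 / η by positivity)
    have hNr : (N : ℝ) = ⌈g * (6 / η)⌉ + 1 := by rw [hN]; push_cast; rfl
    constructor
    · have : ((-N : ℤ) : ℝ) ≤ k j := by push_cast; have := hk1 j; linarith
      exact_mod_cast this
    · have : (k j : ℝ) ≤ N := by have := hk2 j; linarith
      exact_mod_cast this
  have hγ1 : ∀ j, Real.log (B j) ≤ k j * (η / 6) * l := fun j => by
    have h1 := mul_le_mul_of_nonneg_right (hk1 j) (show 0 ≤ η / 6 * l by positivity)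
    have h2 : Real.log (B j) / l * (6 / η) * (η / 6 * l) = Real.log (B j) := by field_simp
    linarith
  have hγ2 : ∀ j, k j * (η / 6) ≤ Real.log (B j) / l + η / 6 := fun j => by
    have h1 := mul_le_mul_of_nonneg_right (hk2 j).le (show 0 ≤ η / 6 by positivity)
    have h2 : (Real.log (B j) / l * (6 / η) + 1) * (η / 6) = Real.log (B j) / l + η / 6 := by field_simp
    linarith
  have hwa : cr u v a ≠ 0 := by
    intro h
    rw [h] at ha
    have := Real.rpow_pos_of_pos hH0 κ
    simp at ha
    linarith
  obtain ⟨e, he1, he2⟩ := prim_den u v p hp a hwa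
  refine hlf (fun j => ⟨k j, hkN j⟩, e) ?_ l ?_ u v ⟨?_, ?_, he1, ?_⟩
  · rw [Fin.sum_univ_three] at hlp ⊢
    have h0 := hγ2 0
    have h1 := hγ2 1
    have h2 := hγ2 2
    have h3 : Real.log (B 0) / l + Real.log (B 1) / l + Real.log (B 2) / l ≤ -η := by
      rw [← add_div, ← add_div, div_le_iff₀ hl0]; exact hlp
    show (k 0 : ℝ) * (η / 6) + k 1 * (η / 6) + k 2 * (η / 6) ≤ -(η / 2)
    linarith
  · exact (hMx' _).trans ((le_abs_self _).trans (by linarith))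
  · intro j
    refine (hu j).trans ?_
    rw [← Real.log_le_iff_le_exp (hB0 j)]
    exact hγ1 j
  · intro j
    refine (hv j).trans ?_
    rw [← Real.log_le_iff_le_exp (hB0 j)]
    exact hγ1 j
  · rw [hpow] at ha
    have h1 : Real.exp (κ * l) ≤ (((((u (e 2)*v (e 0) - u (e 0)*v (e 2):ℤ):ℚ)/
      ((u (e 1)*v (e 2) - u (e 2)*v (e 1):ℤ):ℚ)).den : ℝ)) ^ 2 := by
      refine ha.trans ?_
      exact_mod_cast he2
    have h2 : Real.exp (κ * l) = Real.exp (κ / 2 * l) ^ 2 := by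
      rw [← Real.exp_nat_mul]; congr 1; push_cast; ring
    rw [h2] at h1
    exact (pow_le_pow_iff_left₀ (Real.exp_pos _).le (by positivity) (by norm_num)).1 h1
end Sub6

namespace Sub6

def Fd (a b : ℝ) : Matrix (Fin 3) (Fin 3) ℝ := !![1, a, b; 0, 1, 0; 0, 0, 1]
def Gdu (a b : ℝ) : Matrix (Fin 3) (Fin 3) ℝ := !![1, -a, -b; 0, 1, 0; 0, 0, 1]
def Fp (a b : ℝ) : Matrix (Fin 3) (Fin 3) ℝ := !![1, 0, 0; -a, 1, 0; -b, 0, 1]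
def Gp (a b : ℝ) : Matrix (Fin 3) (Fin 3) ℝ := !![1, 0, 0; a, 1, 0; b, 0, 1]

lemma GFd (a b : ℝ) : Gdu a b * Fd a b = 1 := by
  ext i j; fin_cases i <;> fin_cases j <;> simp [Gdu, Fd, Matrix.mul_apply, Fin.sum_univ_three]
lemma GFp (a b : ℝ) : Gp a b * Fp a b = 1 := by
  ext i j; fin_cases i <;> fin_cases j <;> simp [Gp, Fp, Matrix.mul_apply, Fin.sum_univ_three]

lemma Fd_forms (a b : ℝ) (u : Fin 3 → ℤ) (B : Fin 3 → ℝ) (h0 : |u 0 + u 1 * a + u 2 * b| ≤ B 0)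
    (h1 : |(u 1 : ℝ)| ≤ B 1) (h2 : |(u 2 : ℝ)| ≤ B 2) : ∀ j, |∑ i, Fd a b j i * u i| ≤ B j := by
  intro j
  fin_cases j
  · have e : ∑ i, Fd a b 0 i * u i = u 0 + u 1 * a + u 2 * b := by
      simp [Fd, Fin.sum_univ_three]; ring
    show |∑ i, Fd a b 0 i * u i| ≤ B 0
    rwa [e]
  · have e : ∑ i, Fd a b 1 i * u i = u 1 := by
      simp [Fd, Fin.sum_univ_three]
    show |∑ i, Fd a b 1 i * u i| ≤ B 1
    rwa [e]
  · have e : ∑ i, Fd a b 2 i * u i = u 2 := by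
      simp [Fd, Fin.sum_univ_three]
    show |∑ i, Fd a b 2 i * u i| ≤ B 2
    rwa [e]

lemma Fp_forms (a b : ℝ) (u : Fin 3 → ℤ) (B : Fin 3 → ℝ) (h0 : |(u 0 : ℝ)| ≤ B 0)
    (h1 : |u 1 - a * u 0| ≤ B 1) (h2 : |u 2 - b * u 0| ≤ B 2) : ∀ j, |∑ i, Fp a b j i * u i| ≤ B j := by
  intro j
  fin_cases j
  · have e : ∑ i, Fp a b 0 i * u i = u 0 := by
      simp [Fp, Fin.sum_univ_three]
    show |∑ i, Fp a b 0 i * u i| ≤ B 0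
    rwa [e]
  · have e : ∑ i, Fp a b 1 i * u i = u 1 - a * u 0 := by
      simp [Fp, Fin.sum_univ_three]; ring
    show |∑ i, Fp a b 1 i * u i| ≤ B 1
    rwa [e]
  · have e : ∑ i, Fp a b 2 i * u i = u 2 - b * u 0 := by
      simp [Fp, Fin.sum_univ_three]; ring
    show |∑ i, Fp a b 2 i * u i| ≤ B 2
    rwa [e]

/-- a partner `z` of `y` with `cr y z = b`, reduced in coordinate `2`. -/
lemma partner2 (y b u : Fin 3 → ℤ) (hyb : y 0 * b 0 + y 1 * b 1 + y 2 * b 2 = 0)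
    (hu : y 0 * u 0 + y 1 * u 1 + y 2 * u 2 = 1) (hy2 : y 2 ≠ 0) :
    ∃ z : Fin 3 → ℤ, |z 2| ≤ |y 2| ∧ y 1 * z 2 - y 2 * z 1 = b 0 ∧ y 2 * z 0 - y 0 * z 2 = b 1 ∧
      y 0 * z 1 - y 1 * z 0 = b 2 := by
  obtain ⟨k, hk⟩ : ∃ k : ℤ, k = (b 0 * u 1 - b 1 * u 0) / y 2 := ⟨_, rfl⟩
  refine ⟨![b 1 * u 2 - b 2 * u 1 - k * y 0, b 2 * u 0 - b 0 * u 2 - k * y 1, b 0 * u 1 - b 1 * u 0 - k * y 2],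
    ?_, ?_, ?_, ?_⟩
  · show |b 0 * u 1 - b 1 * u 0 - k * y 2| ≤ |y 2|
    have e : b 0 * u 1 - b 1 * u 0 - k * y 2 = (b 0 * u 1 - b 1 * u 0) % y 2 := by
      rw [hk, Int.emod_def]; ring
    rw [e, abs_of_nonneg (Int.emod_nonneg _ hy2)]
    exact (Int.emod_lt_abs _ hy2).le
  · show y 1 * (b 0 * u 1 - b 1 * u 0 - k * y 2) - y 2 * (b 2 * u 0 - b 0 * u 2 - k * y 1) = b 0
    linear_combination b 0 * hu - u 0 * hyb
  · show y 2 * (b 1 * u 2 - b 2 * u 1 - k * y 0) - y 0 * (b 0 * u 1 - b 1 * u 0 - k * y 2) = b 1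
    linear_combination b 1 * hu - u 1 * hyb
  · show y 0 * (b 2 * u 0 - b 0 * u 2 - k * y 1) - y 1 * (b 1 * u 2 - b 2 * u 1 - k * y 0) = b 2
    linear_combination b 2 * hu - u 2 * hyb

/-- a partner `c` of `b` with `cr b c = y`, reduced in coordinate `0`. -/
lemma partner0 (y b t : Fin 3 → ℤ) (hyb : y 0 * b 0 + y 1 * b 1 + y 2 * b 2 = 0)
    (ht : b 0 * t 0 + b 1 * t 1 + b 2 * t 2 = 1) (hb0 : b 0 ≠ 0) :
    ∃ z : Fin 3 → ℤ, |z 0| ≤ |b 0| ∧ b 1 * z 2 - b 2 * z 1 = y 0 ∧ b 2 * z 0 - b 0 * z 2 = y 1 ∧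
      b 0 * z 1 - b 1 * z 0 = y 2 := by
  obtain ⟨k, hk⟩ : ∃ k : ℤ, k = (y 1 * t 2 - y 2 * t 1) / b 0 := ⟨_, rfl⟩
  refine ⟨![y 1 * t 2 - y 2 * t 1 - k * b 0, y 2 * t 0 - y 0 * t 2 - k * b 1, y 0 * t 1 - y 1 * t 0 - k * b 2],
    ?_, ?_, ?_, ?_⟩
  · show |y 1 * t 2 - y 2 * t 1 - k * b 0| ≤ |b 0|
    have e : y 1 * t 2 - y 2 * t 1 - k * b 0 = (y 1 * t 2 - y 2 * t 1) % b 0 := by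
      rw [hk, Int.emod_def]; ring
    rw [e, abs_of_nonneg (Int.emod_nonneg _ hb0)]
    exact (Int.emod_lt_abs _ hb0).le
  · show b 1 * (y 0 * t 1 - y 1 * t 0 - k * b 2) - b 2 * (y 2 * t 0 - y 0 * t 2 - k * b 1) = y 0
    linear_combination y 0 * ht - t 0 * hyb
  · show b 2 * (y 1 * t 2 - y 2 * t 1 - k * b 0) - b 0 * (y 0 * t 1 - y 1 * t 0 - k * b 2) = y 1
    linear_combination y 1 * ht - t 1 * hyb
  · show b 0 * (y 2 * t 0 - y 0 * t 2 - k * b 1) - b 1 * (y 1 * t 2 - y 2 * t 1 - k * b 0) = y 2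
    linear_combination y 2 * ht - t 2 * hyb

set_option maxHeartbeats 1000000 in
theorem dual_lem (θ1 θ2 : ℝ) (hG : AuxGood (Gdu θ1 θ2)) (η κ : ℝ) (hη : 0 < η) (hκ : 0 < κ) :
    ∃ H0 : ℝ, 1 < H0 ∧ ∀ H, H0 ≤ H → ∀ (ε : ℝ) (y b u t : Fin 3 → ℤ),
      y 0 * b 0 + y 1 * b 1 + y 2 * b 2 = 0 → y 0 * u 0 + y 1 * u 1 + y 2 * u 2 = 1 →
      b 0 * t 0 + b 1 * t 1 + b 2 * t 2 = 1 → b 0 ≠ 0 → y 2 ≠ 0 → |y 1| ≤ |y 2| →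
      |b 1 - θ1 * b 0| ≤ ε → |b 2 - θ2 * b 0| ≤ ε → 1 ≤ H ^ 2 * ε → ε ≤ 1 →
      |(y 2 : ℝ)| ^ 2 ≤ |(b 0 : ℝ)| → |(b 0 : ℝ)| ≤ H ^ 3 → H ^ κ ≤ |(b 0 : ℝ)| → 
      8 * ε * |(b 0 : ℝ)| ≤ |(y 2 : ℝ)| * H ^ (-η) → False := by
  obtain ⟨H0, h1, hH⟩ := penultCor _ _ (GFd θ1 θ2) hG 6 η κ (by norm_num) hη hκ
  refine ⟨max H0 8, lt_max_of_lt_left h1, ?_⟩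
  intro H hHH ε y b u t hyb hu ht hb0 hy2 hy12 hb1 hb2 hε1 hε2 hYX hX3 hXκ hpr
  have hHH0 := (le_max_left _ _).trans hHH
  have hH8 := (le_max_right _ _).trans hHH
  obtain ⟨z, hz2, e0, e1, e2⟩ := partner2 y b u hyb hu hy2
  set Y : ℝ := |(y 2 : ℝ)| with hY
  set X : ℝ := |(b 0 : ℝ)| with hX
  have hY1 : 1 ≤ Y := by
    have : (1 : ℤ) ≤ |y 2| := Int.one_le_abs hy2
    rw [hY]; exact_mod_cast this
  have hX1 : 1 ≤ X := by nlinarith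
  have hYXl : Y ≤ X := by nlinarith
  have hε0 : 0 < ε := by
    by_contra h
    push Not at h
    have := mul_nonpos_of_nonneg_of_nonpos (sq_nonneg H) h
    linarith
  have hy1 : |(y 1 : ℝ)| ≤ Y := by rw [hY]; exact_mod_cast hy12
  have hz2' : |(z 2 : ℝ)| ≤ Y := by rw [hY]; exact_mod_cast hz2
  have hYX2 : Y ≤ 2 * X / Y := by rw [le_div_iff₀ (by linarith)]; nlinarith
  have hyb' : (y 0 : ℝ) * b 0 + y 1 * b 1 + y 2 * b 2 = 0 := by exact_mod_cast hyb
  have e0' : (y 1 : ℝ) * z 2 - y 2 * z 1 = b 0 := by exact_mod_cast e0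
  have e1' : (y 2 : ℝ) * z 0 - y 0 * z 2 = b 1 := by exact_mod_cast e1
  have hLy : |y 0 + y 1 * θ1 + y 2 * θ2| ≤ 2 * ε / Y := by
    have id : (b 0 : ℝ) * (y 0 + y 1 * θ1 + y 2 * θ2) =
        -(y 1 * (b 1 - θ1 * b 0)) - y 2 * (b 2 - θ2 * b 0) := by linear_combination hyb'
    have h3 : X * |y 0 + y 1 * θ1 + y 2 * θ2| ≤ 2 * (Y * ε) := by
      rw [hX, ← abs_mul, id]
      refine (abs_sub _ _).trans ?_
      rw [abs_neg, abs_mul, abs_mul]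
      have := mul_le_mul hy1 hb1 (abs_nonneg _) (by linarith)
      have := mul_le_mul_of_nonneg_left hb2 (show 0 ≤ Y by linarith)
      linarith
    rw [le_div_iff₀ (by linarith)]
    have h4 : Y * (Y * |y 0 + y 1 * θ1 + y 2 * θ2|) ≤ Y * (2 * ε) := by
      have := mul_le_mul_of_nonneg_right hYX (abs_nonneg (y 0 + y 1 * θ1 + y 2 * θ2))
      linarith
    have := le_of_mul_le_mul_left h4 (by linarith)
    linarith
  have hLz : |z 0 + z 1 * θ1 + z 2 * θ2| ≤ 4 * ε / Y := by
    have id : (y 2 : ℝ) * (z 0 + z 1 * θ1 + z 2 * θ2) =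
        (b 1 - θ1 * b 0) + z 2 * (y 0 + y 1 * θ1 + y 2 * θ2) := by
      linear_combination e1' - θ1 * e0'
    rw [le_div_iff₀ (by linarith), mul_comm, hY, ← abs_mul, id]
    refine (abs_add_le _ _).trans ?_
    rw [abs_mul]
    have := mul_le_mul hz2' hLy (abs_nonneg _) (by linarith)
    have e : Y * (2 * ε / Y) = 2 * ε := by field_simp
    linarith
  have hz1 : |(z 1 : ℝ)| ≤ 2 * X / Y := by
    rw [le_div_iff₀ (by linarith), mul_comm, hY, ← abs_mul]
    have : (y 2 : ℝ) * z 1 = y 1 * z 2 - b 0 := by linear_combination -e0'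
    rw [this]
    refine (abs_sub _ _).trans ?_
    rw [abs_mul]
    have := mul_le_mul hy1 hz2' (abs_nonneg _) (by linarith)
    nlinarith
  have hHpos : 0 < H := by linarith
  have hm6 : H ^ (-6 : ℝ) = 1 / H ^ 6 := by
    rw [Real.rpow_neg hHpos.le, one_div]; norm_cast
  have hp6 : H ^ (6 : ℝ) = H ^ 6 := by norm_cast
  have h36 : H ^ 3 * 8 ≤ H ^ 6 := by
    have h5 : (8:ℝ) ≤ H ^ 3 := by nlinarith [sq_nonneg H]
    calc H ^ 3 * 8 ≤ H ^ 3 * H ^ 3 := mul_le_mul_of_nonneg_left h5 (by positivity)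
      _ = H ^ 6 := by ring
  have h61 : (1:ℝ) / H ^ 6 ≤ 1 := by
    rw [div_le_one (by positivity)]; exact one_le_pow₀ (by linarith)
  have hH61 : (8:ℝ) ≤ H ^ 6 := by
    have : (1:ℝ) ≤ H ^ 3 := one_le_pow₀ (by linarith)
    linarith
  refine hH H hHH0 ![4 * ε / Y, 2 * X / Y, Y] ?_ ?_ ?_ y z t ?_ ?_ ?_ ?_
  · rw [hm6]
    intro j
    fin_cases j
    · show 1 / H ^ 6 ≤ 4 * ε / Y
      rw [div_le_div_iff₀ (by positivity) (by linarith)]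
      have h1 : (1:ℝ) ≤ H := by linarith
      have : H ^ 3 * 1 ≤ H ^ 3 * (H * (H ^ 2 * ε)) := by
        refine mul_le_mul_of_nonneg_left ?_ (by positivity)
        have := mul_le_mul h1 hε1 zero_le_one (by linarith)
        linarith
      have e : H ^ 3 * (H * (H ^ 2 * ε)) = ε * H ^ 6 := by ring
      have : 0 < ε * H ^ 6 := by positivity
      linarith
    · show 1 / H ^ 6 ≤ 2 * X / Y
      linarith
    · show 1 / H ^ 6 ≤ Y
      linarith
  · rw [hp6]
    intro j
    fin_cases j
    · show 4 * ε / Y ≤ H ^ 6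
      rw [div_le_iff₀ (by linarith)]
      have : H ^ 6 * 1 ≤ H ^ 6 * Y := mul_le_mul_of_nonneg_left hY1 (by positivity)
      linarith
    · show 2 * X / Y ≤ H ^ 6
      rw [div_le_iff₀ (by linarith)]
      have : H ^ 6 * 1 ≤ H ^ 6 * Y := mul_le_mul_of_nonneg_left hY1 (by positivity)
      linarith
    · show Y ≤ H ^ 6
      have : 0 ≤ H ^ 3 := by positivity
      linarith
  · rw [Fin.prod_univ_three]
    show 4 * ε / Y * (2 * X / Y) * Y ≤ _
    have : 4 * ε / Y * (2 * X / Y) * Y = 8 * ε * X / Y := by field_simp; ring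
    rw [this, div_le_iff₀ (by linarith)]
    linarith
  · refine Fd_forms _ _ _ _ ?_ (hy1.trans hYX2) le_rfl
    refine hLy.trans ?_
    show 2 * ε / Y ≤ 4 * ε / Y
    gcongr; norm_num
  · exact Fd_forms _ _ _ _ hLz hz1 hz2'
  · rw [Fin.sum_univ_three]
    show t 0 * (y 1 * z 2 - y 2 * z 1) + t 1 * (y 2 * z 0 - y 0 * z 2) + t 2 * (y 0 * z 1 - y 1 * z 0) = 1
    rw [e0, e1, e2]; linarith
  · refine ⟨0, ?_⟩
    show _ ≤ (((y 1 * z 2 - y 2 * z 1).natAbs : ℕ) : ℝ)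
    rw [e0, Nat.cast_natAbs]
    push_cast
    exact hXκ

set_option maxHeartbeats 1000000 in
theorem primal_lem (θ1 θ2 : ℝ) (hG : AuxGood (Gp θ1 θ2)) (η : ℝ) (hη : 0 < η) :
    ∃ H0 : ℝ, 1 < H0 ∧ ∀ (ε : ℝ) (y b u t : Fin 3 → ℤ), H0 ≤ |(y 2 : ℝ)| → 
      y 0 * b 0 + y 1 * b 1 + y 2 * b 2 = 0 → y 0 * u 0 + y 1 * u 1 + y 2 * u 2 = 1 →
      b 0 * t 0 + b 1 * t 1 + b 2 * t 2 = 1 → b 0 ≠ 0 → |y 1| ≤ |y 2| →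
      |b 1 - θ1 * b 0| ≤ ε → |b 2 - θ2 * b 0| ≤ ε → ε * |(b 0 : ℝ)| ≤ 4 * |(y 2 : ℝ)| → 
      |(b 0 : ℝ)| ≤ |(y 2 : ℝ)| ^ 3 → 
      25 * |(y 2 : ℝ)| ^ 2 ≤ |(b 0 : ℝ)| * |(y 2 : ℝ)| ^ (-η) → False := by
  obtain ⟨H0, h1, hH⟩ := penultCor _ _ (GFp θ1 θ2) hG 6 η 1 (by norm_num) hη one_pos
  refine ⟨max H0 8, lt_max_of_lt_left h1, ?_⟩
  intro ε y b u t hHH hyb hu ht hb0 hy12 hb1 hb2 hε1 hX3 hpr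
  have hHH0 := (le_max_left _ _).trans hHH
  have hH8 := (le_max_right _ _).trans hHH
  obtain ⟨z, hz0, e0, e1, e2⟩ := partner0 y b t hyb ht hb0
  set H : ℝ := |(y 2 : ℝ)| with hHd
  set X : ℝ := |(b 0 : ℝ)| with hX
  have hX1 : 1 ≤ X := by
    have : (1 : ℤ) ≤ |b 0| := Int.one_le_abs hb0
    rw [hX]; exact_mod_cast this
  have hy1 : |(y 1 : ℝ)| ≤ H := by rw [hHd]; exact_mod_cast hy12
  have hz0' : |(z 0 : ℝ)| ≤ X := by rw [hX]; exact_mod_cast hz0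
  have e1' : (b 2 : ℝ) * z 0 - b 0 * z 2 = y 1 := by exact_mod_cast e1
  have e2' : (b 0 : ℝ) * z 1 - b 1 * z 0 = y 2 := by exact_mod_cast e2
  have hb1' : |b 1 - θ1 * b 0| ≤ 5 * H / X := by
    rw [le_div_iff₀ (by linarith)]
    have := mul_le_mul_of_nonneg_right hb1 (show 0 ≤ X by linarith)
    linarith
  have hb2' : |b 2 - θ2 * b 0| ≤ 5 * H / X := by
    rw [le_div_iff₀ (by linarith)]
    have := mul_le_mul_of_nonneg_right hb2 (show 0 ≤ X by linarith)
    linarith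
  have hz1 : |z 1 - θ1 * z 0| ≤ 5 * H / X := by
    rw [le_div_iff₀ (by linarith), mul_comm, hX, ← abs_mul]
    have : (b 0 : ℝ) * (z 1 - θ1 * z 0) = y 2 + z 0 * (b 1 - θ1 * b 0) := by linear_combination e2'
    rw [this]
    refine (abs_add_le _ _).trans ?_
    rw [abs_mul]
    have := mul_le_mul hz0' hb1 (abs_nonneg _) (by linarith)
    linarith
  have hz2 : |z 2 - θ2 * z 0| ≤ 5 * H / X := by
    rw [le_div_iff₀ (by linarith), mul_comm, hX, ← abs_mul]
    have : (b 0 : ℝ) * (z 2 - θ2 * z 0) = z 0 * (b 2 - θ2 * b 0) - y 1 := by linear_combination -e1'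
    rw [this]
    refine (abs_sub _ _).trans ?_
    rw [abs_mul]
    have := mul_le_mul hz0' hb2 (abs_nonneg _) (by linarith)
    linarith
  have hHpos : 0 < H := by linarith
  have hm6 : H ^ (-6 : ℝ) = 1 / H ^ 6 := by
    rw [Real.rpow_neg hHpos.le, one_div]; norm_cast
  have hp6 : H ^ (6 : ℝ) = H ^ 6 := by norm_cast
  have h36 : H ^ 3 * 8 ≤ H ^ 6 := by
    have h5 : (8:ℝ) ≤ H ^ 3 := by nlinarith [sq_nonneg H]
    calc H ^ 3 * 8 ≤ H ^ 3 * H ^ 3 := mul_le_mul_of_nonneg_left h5 (by positivity)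
      _ = H ^ 6 := by ring
  have h61 : (1:ℝ) / H ^ 6 ≤ 1 := by
    rw [div_le_one (by positivity)]; exact one_le_pow₀ (by linarith)
  have hH3 : H ≤ H ^ 3 := by nlinarith [sq_nonneg H]
  have hlo : 1 / H ^ 6 ≤ 5 * H / X := by
    rw [div_le_div_iff₀ (by positivity) (by linarith)]
    have : 1 * H ^ 6 ≤ 5 * H * H ^ 6 := mul_le_mul_of_nonneg_right (by linarith) (by positivity)
    have : 0 ≤ H ^ 3 := by positivity
    linarith
  have hhi : 5 * H / X ≤ H ^ 6 := by
    rw [div_le_iff₀ (by linarith)]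
    have : H ^ 6 * 1 ≤ H ^ 6 * X := mul_le_mul_of_nonneg_left hX1 (by positivity)
    linarith
  refine hH H hHH0 ![X, 5 * H / X, 5 * H / X] ?_ ?_ ?_ b z u ?_ ?_ ?_ ?_
  · rw [hm6]
    intro j
    fin_cases j
    · show 1 / H ^ 6 ≤ X
      linarith
    · exact hlo
    · exact hlo
  · rw [hp6]
    intro j
    fin_cases j
    · show X ≤ H ^ 6
      linarith
    · exact hhi
    · exact hhi
  · rw [Fin.prod_univ_three]
    show X * (5 * H / X) * (5 * H / X) ≤ _
    have : X * (5 * H / X) * (5 * H / X) = 25 * H ^ 2 / X := by field_simp; ring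
    rw [this, div_le_iff₀ (by linarith)]
    linarith
  · exact Fp_forms _ _ _ _ le_rfl hb1' hb2'
  · exact Fp_forms _ _ _ _ hz0' hz1 hz2
  · rw [Fin.sum_univ_three]
    show u 0 * (b 1 * z 2 - b 2 * z 1) + u 1 * (b 2 * z 0 - b 0 * z 2) + u 2 * (b 0 * z 1 - b 1 * z 0) = 1
    rw [e0, e1, e2]; linarith
  · refine ⟨2, ?_⟩
    show _ ≤ (((b 0 * z 1 - b 1 * z 0).natAbs : ℕ) : ℝ)
    rw [e2, Nat.cast_natAbs, Real.rpow_one]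
    push_cast
    exact le_rfl
end Sub6

namespace Sub6

lemma pig1 (θ : ℝ) (y : Fin 3 → ℤ) (hy : y 2 ≠ 0) (K : ℕ) (hK : 0 < K) :
    ∃ b : Fin 3 → ℤ, b 0 ≠ 0 ∧ |b 0| ≤ |y 2| * K ∧ |b 1 - θ * b 0| * K ≤ 1 ∧
      y 0 * b 0 + y 1 * b 1 + y 2 * b 2 = 0 := by
  set H := (y 2).natAbs with hH
  have hH0 : 0 < H := Int.natAbs_pos.2 hy
  have hHy : |y 2| = (H : ℤ) := by rw [hH]; simp
  have hKr : (0:ℝ) < K := by exact_mod_cast hK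
  let f : ℕ → ℤ × ℤ := fun n => ((y 0 * n + y 1 * ⌈θ * n⌉) % (y 2), ⌊(K : ℝ) * (⌈θ * n⌉ - θ * n)⌋)
  have hmap : ∀ n ∈ Finset.range (H * K + 1), f n ∈ Finset.Ico (0:ℤ) H ×ˢ Finset.Ico (0:ℤ) K := by
    intro n _
    rw [Finset.mem_product, Finset.mem_Ico, Finset.mem_Ico]
    have h1 := Int.le_ceil (θ * n)
    have h2 := Int.ceil_lt_add_one (θ * n)
    refine ⟨⟨Int.emod_nonneg _ hy, ?_⟩, ?_, ?_⟩
    · rw [← hHy]; exact Int.emod_lt_abs _ hy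
    · exact Int.floor_nonneg.2 (mul_nonneg hKr.le (by linarith))
    · rw [Int.floor_lt]
      have : (K:ℝ) * (⌈θ * n⌉ - θ * n) < K * 1 := mul_lt_mul_of_pos_left (by linarith) hKr
      push_cast; linarith
  obtain ⟨n, hn, m, hm, hnm, hf⟩ := Finset.exists_ne_map_eq_of_card_lt_of_maps_to (by simp) hmap
  have hf1 := congrArg Prod.fst hf
  have hf2 := congrArg Prod.snd hf
  simp only [f] at hf1 hf2
  obtain ⟨k, hk⟩ := (Int.ModEq.dvd hf1)
  rw [Finset.mem_range] at hn hm
  refine ⟨![(m:ℤ) - n, ⌈θ * m⌉ - ⌈θ * n⌉, -k], ?_, ?_, ?_, ?_⟩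
  · show (m:ℤ) - n ≠ 0
    omega
  · show |(m:ℤ) - n| ≤ |y 2| * K
    rw [hHy, abs_le]
    have h3 : ((H * K : ℕ) : ℤ) = (H:ℤ) * K := by push_cast; ring
    constructor <;> omega
  · show |((⌈θ * m⌉ - ⌈θ * n⌉ : ℤ) : ℝ) - θ * (((m:ℤ) - n : ℤ) : ℝ)| * K ≤ 1
    have := (Int.abs_sub_lt_one_of_floor_eq_floor hf2.symm).le
    have e : (K:ℝ) * (⌈θ * m⌉ - θ * m) - K * (⌈θ * n⌉ - θ * n) =
      (((⌈θ * m⌉ - ⌈θ * n⌉ : ℤ) : ℝ) - θ * (((m:ℤ) - n : ℤ) : ℝ)) * K := by push_cast; ring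
    rw [e, abs_mul, abs_of_pos hKr] at this
    exact this
  · show y 0 * ((m:ℤ) - n) + y 1 * (⌈θ * m⌉ - ⌈θ * n⌉) + y 2 * (-k) = 0
    linear_combination hk

lemma pig2 (b : Fin 3 → ℤ) (hb : b 0 ≠ 0) :
    ∃ y : Fin 3 → ℤ, (y 1 ≠ 0 ∨ y 2 ≠ 0) ∧ y 1 ^ 2 ≤ |b 0| ∧ y 2 ^ 2 ≤ |b 0| ∧
      y 0 * b 0 + y 1 * b 1 + y 2 * b 2 = 0 := by
  set X := (b 0).natAbs with hX
  have hXb : |b 0| = (X : ℤ) := by rw [hX]; simp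
  set s := Nat.sqrt X with hs
  let f : ℕ × ℕ → ℤ := fun n => (b 1 * n.1 + b 2 * n.2) % (b 0)
  have hmap : ∀ n ∈ Finset.range (s + 1) ×ˢ Finset.range (s + 1), f n ∈ Finset.Ico (0:ℤ) X := by
    intro n _
    rw [Finset.mem_Ico, ← hXb]
    exact ⟨Int.emod_nonneg _ hb, Int.emod_lt_abs _ hb⟩
  have hc : (Finset.Ico (0:ℤ) X).card < (Finset.range (s + 1) ×ˢ Finset.range (s + 1)).card := by
    simp only [Int.card_Ico, Finset.card_product, Finset.card_range, sub_zero, Int.toNat_natCast]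
    exact Nat.lt_succ_sqrt X
  obtain ⟨n, hn, m, hm, hnm, hf⟩ := Finset.exists_ne_map_eq_of_card_lt_of_maps_to hc hmap
  simp only [f] at hf
  obtain ⟨k, hk⟩ := (Int.ModEq.dvd hf)
  rw [Finset.mem_product, Finset.mem_range, Finset.mem_range] at hn hm
  have hsq : ((s:ℤ)) ^ 2 ≤ X := by
    have : s ^ 2 ≤ X := by rw [pow_two]; exact Nat.sqrt_le X
    exact_mod_cast this
  refine ⟨![-k, (m.1:ℤ) - n.1, (m.2:ℤ) - n.2], ?_, ?_, ?_, ?_⟩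
  · show (m.1:ℤ) - n.1 ≠ 0 ∨ (m.2:ℤ) - n.2 ≠ 0
    by_contra h
    push Not at h
    exact hnm (Prod.ext (by omega) (by omega))
  · show ((m.1:ℤ) - n.1) ^ 2 ≤ |b 0|
    rw [hXb]
    exact (sq_le_sq' (by omega) (by omega)).trans hsq
  · show ((m.2:ℤ) - n.2) ^ 2 ≤ |b 0|
    rw [hXb]
    exact (sq_le_sq' (by omega) (by omega)).trans hsq
  · show (-k) * b 0 + ((m.1:ℤ) - n.1) * b 1 + ((m.2:ℤ) - n.2) * b 2 = 0
    linear_combination hk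

lemma prim3 (b : Fin 3 → ℤ) (j : Fin 3) (hb : b j ≠ 0) : ∃ (d : ℤ) (c t : Fin 3 → ℤ), 1 ≤ d ∧
    (∀ i, b i = d * c i) ∧ c 0 * t 0 + c 1 * t 1 + c 2 * t 2 = 1 := by
  set g1 : ℤ := ((Int.gcd (b 0) (b 1) : ℕ) : ℤ) with hg1
  set d : ℤ := ((Int.gcd g1 (b 2) : ℕ) : ℤ) with hd
  have h1 : g1 = b 0 * Int.gcdA (b 0) (b 1) + b 1 * Int.gcdB (b 0) (b 1) := Int.gcd_eq_gcd_ab _ _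
  have h2 : d = g1 * Int.gcdA g1 (b 2) + b 2 * Int.gcdB g1 (b 2) := Int.gcd_eq_gcd_ab _ _
  have d0 : d ∣ b 0 := (Int.gcd_dvd_left _ _).trans (Int.gcd_dvd_left _ _)
  have d1 : d ∣ b 1 := (Int.gcd_dvd_left _ _).trans (Int.gcd_dvd_right _ _)
  have d2 : d ∣ b 2 := (Int.gcd_dvd_right _ _)
  have hd0 : d ≠ 0 := by
    intro h
    rw [h] at d0 d1 d2
    apply hb
    fin_cases j
    · exact zero_dvd_iff.1 d0
    · exact zero_dvd_iff.1 d1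
    · exact zero_dvd_iff.1 d2
  have hdp : 1 ≤ d := by
    have : 0 ≤ d := by rw [hd]; positivity
    omega
  obtain ⟨c0, e0⟩ := d0
  obtain ⟨c1, e1⟩ := d1
  obtain ⟨c2, e2⟩ := d2
  refine ⟨d, ![c0, c1, c2], ![Int.gcdA (b 0) (b 1) * Int.gcdA g1 (b 2),
    Int.gcdB (b 0) (b 1) * Int.gcdA g1 (b 2), Int.gcdB g1 (b 2)], hdp, ?_, ?_⟩
  · intro i; fin_cases i
    · exact e0
    · exact e1
    · exact e2
  · show c0 * (Int.gcdA (b 0) (b 1) * Int.gcdA g1 (b 2)) + c1 * (Int.gcdB (b 0) (b 1) * Int.gcdA g1 (b 2))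
      + c2 * Int.gcdB g1 (b 2) = 1
    apply mul_left_cancel₀ hd0
    generalize Int.gcdA g1 (b 2) = p at *
    generalize Int.gcdB g1 (b 2) = q at *
    generalize Int.gcdA (b 0) (b 1) = r at *
    generalize Int.gcdB (b 0) (b 1) = s at *
    linear_combination (-r * p) * e0 - (s * p) * e1 - q * e2 - h2 - p * h1

/-- if two vectors are orthogonal to primitive `b`, `y` primitive -/
lemma par_or (y y' b u t : Fin 3 → ℤ) (hyb : y 0 * b 0 + y 1 * b 1 + y 2 * b 2 = 0)
    (hyb' : y' 0 * b 0 + y' 1 * b 1 + y' 2 * b 2 = 0)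
    (hu : y 0 * u 0 + y 1 * u 1 + y 2 * u 2 = 1)
    (ht : b 0 * t 0 + b 1 * t 1 + b 2 * t 2 = 1) (hb : b 0 ≠ 0) :
    |b 0| ≤ |y 1 * y' 2 - y 2 * y' 1| ∨ ∃ m : ℤ, ∀ i, y' i = m * y i := by
  set w0 := y 1 * y' 2 - y 2 * y' 1 with hw0
  set w1 := y 2 * y' 0 - y 0 * y' 2 with hw1
  set w2 := y 0 * y' 1 - y 1 * y' 0 with hw2
  have c2 : w0 * b 1 = w1 * b 0 := by
    rw [hw0, hw1]; linear_combination (y' 2) * hyb - (y 2) * hyb'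
  have c1 : w0 * b 2 = w2 * b 0 := by
    rw [hw0, hw2]; linear_combination (-y' 1) * hyb + (y 1) * hyb'
  have hk : w0 = (w0 * t 0 + w1 * t 1 + w2 * t 2) * b 0 := by
    linear_combination (-w0) * ht + t 1 * c2 + t 2 * c1
  by_cases h0 : w0 = 0
  · right
    have h1 : w1 = 0 := by
      rw [h0, zero_mul] at c2
      exact (mul_eq_zero.1 c2.symm).resolve_right hb
    have h2 : w2 = 0 := by
      rw [h0, zero_mul] at c1
      exact (mul_eq_zero.1 c1.symm).resolve_right hb
    rw [hw0] at h0
    rw [hw1] at h1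
    rw [hw2] at h2
    refine ⟨y' 0 * u 0 + y' 1 * u 1 + y' 2 * u 2, ?_⟩
    intro i
    fin_cases i
    · show y' 0 = (y' 0 * u 0 + y' 1 * u 1 + y' 2 * u 2) * y 0
      linear_combination (-y' 0) * hu - u 1 * h2 + u 2 * h1
    · show y' 1 = (y' 0 * u 0 + y' 1 * u 1 + y' 2 * u 2) * y 1
      linear_combination (-y' 1) * hu + u 0 * h2 - u 2 * h0
    · show y' 2 = (y' 0 * u 0 + y' 1 * u 1 + y' 2 * u 2) * y 2
      linear_combination (-y' 2) * hu - u 0 * h1 + u 1 * h0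
  · left
    have hk0 : (w0 * t 0 + w1 * t 1 + w2 * t 2) ≠ 0 := by
      intro h; rw [h, zero_mul] at hk; exact h0 hk
    rw [hk, abs_mul]
    exact le_mul_of_one_le_left (abs_nonneg _) (Int.one_le_abs hk0)
end Sub6

namespace Sub6

set_option maxHeartbeats 1000000 in
theorem schmidt_ord (θ1 θ2 : ℝ) (hGd : AuxGood (Gdu θ1 θ2)) (hGd' : AuxGood (Gdu θ2 θ1))
    (hGp : AuxGood (Gp θ1 θ2))
    (hLi : ∃ D : ℕ, 0 < D ∧ ∃ c : ℝ, 0 < c ∧ ∀ p q : ℤ, q ≠ 0 → c ≤ |(q:ℝ)| ^ D * |p - θ1 * q|)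
    (δ : ℝ) (hδ : 0 < δ) (hδ1 : δ ≤ 1) :
    ∃ H0 : ℝ, 1 < H0 ∧ ∀ y u : Fin 3 → ℤ, y 0 * u 0 + y 1 * u 1 + y 2 * u 2 = 1 → |y 1| ≤ |y 2| →
      H0 ≤ |(y 2 : ℝ)| → |(y 2 : ℝ)| ^ (-2 - δ) ≤ |y 0 + y 1 * θ1 + y 2 * θ2| := by
  obtain ⟨D, hD, c, hc, hLio⟩ := hLi
  have hD' : (0:ℝ) < D := by exact_mod_cast hD
  set η := δ / 12 with hη
  have hη0 : 0 < η := by positivity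
  obtain ⟨H1, h11, hH1⟩ := dual_lem θ1 θ2 hGd η (1 / D) hη0 (by positivity)
  obtain ⟨H2, h21, hH2⟩ := dual_lem θ2 θ1 hGd' η (1 / D) hη0 (by positivity)
  obtain ⟨H3, h31, hH3⟩ := primal_lem θ1 θ2 hGp η hη0
  set T0 : ℝ := 32 + 2 / c with hT0
  have hT00 : 32 ≤ T0 := by have : 0 < 2 / c := by positivity
                            linarith
  refine ⟨max (max H1 H2) (max H3 (T0 ^ (1 / η))), lt_max_of_lt_left (lt_max_of_lt_left h11), ?_⟩
  intro y u hu hy12 hH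
  set H : ℝ := |(y 2 : ℝ)| with hHd
  have hHH1 : H1 ≤ H := (le_max_left _ _).trans ((le_max_left _ _).trans hH)
  have hHH2 : H2 ≤ H := (le_max_right _ _).trans ((le_max_left _ _).trans hH)
  have hHH3 : H3 ≤ H := (le_max_left _ _).trans ((le_max_right _ _).trans hH)
  have hHH4 : T0 ^ (1 / η) ≤ H := (le_max_right _ _).trans ((le_max_right _ _).trans hH)
  have hH1' : 1 < H := by linarith
  have hHp : 0 < H := by linarith
  set T : ℝ := H ^ η with hT
  have hTT0 : T0 ≤ T := by
    have := Real.rpow_le_rpow (by positivity) hHH4 hη0.le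
    rwa [← Real.rpow_mul (by linarith), one_div_mul_cancel hη0.ne', Real.rpow_one] at this
  have hT32 : 32 ≤ T := by linarith
  have hTp : 0 < T := by linarith
  have hTη : H ^ (-η) = 1 / T := by rw [Real.rpow_neg hHp.le, one_div]
  have hT12 : T ^ 12 = H ^ δ := by
    rw [hT, ← Real.rpow_natCast, ← Real.rpow_mul hHp.le]; congr 1; rw [hη]; push_cast; ring
  have hT12H : T ^ 12 ≤ H := by
    rw [hT12]
    calc H ^ δ ≤ H ^ (1:ℝ) := Real.rpow_le_rpow_of_exponent_le hH1'.le hδ1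
      _ = H := Real.rpow_one H
  have hpw : H ^ (-2 - δ) = 1 / (H ^ 2 * T ^ 12) := by
    rw [hT12, show -2 - δ = -(2 + δ) by ring, Real.rpow_neg hHp.le, Real.rpow_add hHp, one_div]
    norm_cast
  by_contra hcon
  push Not at hcon
  rw [hpw] at hcon
  have hy2 : y 2 ≠ 0 := by
    intro h
    rw [h] at hHd; simp at hHd; linarith
  -- powers of T
  have hT4 : 32 ≤ T ^ 4 := by
    have : (32:ℝ)^4 ≤ T ^ 4 := pow_le_pow_left₀ (by norm_num) hT32 4
    linarith
  have hT8 : 32 ≤ T ^ 8 := by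
    have : (32:ℝ)^8 ≤ T ^ 8 := pow_le_pow_left₀ (by norm_num) hT32 8
    linarith
  have hT4H : 32 * T ^ 4 ≤ H := by
    have : 32 * T ^ 4 ≤ T ^ 8 * T ^ 4 := mul_le_mul_of_nonneg_right hT8 (by positivity)
    have e : T ^ 8 * T ^ 4 = T ^ 12 := by ring
    linarith
  set ε : ℝ := 2 / (H * T ^ 4) with hε
  have hε0 : 0 < ε := by positivity
  have hεe : ε * (H * T ^ 4) = 2 := by rw [hε]; field_simp
  set K : ℕ := ⌈H * T ^ 4⌉₊ with hK
  have hHT1 : 1 ≤ H * T ^ 4 := by nlinarith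
  have hK1 : H * T ^ 4 ≤ K := Nat.le_ceil _
  have hK2 : (K:ℝ) ≤ 2 * (H * T ^ 4) := by
    have := (Nat.ceil_lt_add_one (show 0 ≤ H * T ^ 4 by positivity)).le
    linarith
  have hKp : (0:ℝ) < K := by linarith
  obtain ⟨b', hb0', hbK', hb1', hyb'⟩ := pig1 θ1 y hy2 K (by exact_mod_cast hKp)
  obtain ⟨d, b, t, hd, hdb, ht⟩ := prim3 b' 0 hb0'
  have hdr : (1:ℝ) ≤ d := by exact_mod_cast hd
  have hb0 : b 0 ≠ 0 := by
    intro h; rw [hdb 0, h, mul_zero] at hb0'; exact hb0' rfl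
  have hyb : y 0 * b 0 + y 1 * b 1 + y 2 * b 2 = 0 := by
    have : d * (y 0 * b 0 + y 1 * b 1 + y 2 * b 2) = 0 := by
      rw [hdb 0, hdb 1, hdb 2] at hyb'; linear_combination hyb'
    exact (mul_eq_zero.1 this).resolve_left (by omega)
  set X : ℝ := |(b 0 : ℝ)| with hX
  have hX1 : 1 ≤ X := by
    have : (1 : ℤ) ≤ |b 0| := Int.one_le_abs hb0
    rw [hX]; exact_mod_cast this
  have hXK : X ≤ H * K := by
    have h1 : |(b' 0 : ℝ)| ≤ H * K := by rw [hHd]; exact_mod_cast hbK'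
    rw [hdb 0] at h1
    push_cast at h1
    rw [abs_mul, abs_of_nonneg (by linarith : (0:ℝ) ≤ d)] at h1
    have : 1 * X ≤ d * X := mul_le_mul_of_nonneg_right hdr (abs_nonneg _)
    linarith
  have hX2 : X ≤ 2 * (H ^ 2 * T ^ 4) := by
    have := mul_le_mul_of_nonneg_left hK2 hHp.le
    linarith
  have hb1K : |b 1 - θ1 * b 0| * K ≤ 1 := by
    rw [hdb 0, hdb 1] at hb1'
    have e : (((d * b 1 : ℤ) : ℝ) - θ1 * ((d * b 0 : ℤ) : ℝ)) = d * (b 1 - θ1 * b 0) := by push_cast; ring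
    rw [e, abs_mul, abs_of_nonneg (by linarith : (0:ℝ) ≤ d), mul_assoc] at hb1'
    have : 1 * (|b 1 - θ1 * b 0| * K) ≤ d * (|b 1 - θ1 * b 0| * K) :=
      mul_le_mul_of_nonneg_right hdr (by positivity)
    linarith
  have hb1h : |b 1 - θ1 * b 0| ≤ ε / 2 := by
    have h1 : |b 1 - θ1 * b 0| * (H * T ^ 4) ≤ 1 :=
      (mul_le_mul_of_nonneg_left hK1 (abs_nonneg _)).trans hb1K
    have h2 : ε / 2 * (H * T ^ 4) = 1 := by linarith
    rw [← h2] at h1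
    exact le_of_mul_le_mul_right h1 (by positivity)
  have hb1 : |b 1 - θ1 * b 0| ≤ ε := by linarith
  have hybr : (y 0 : ℝ) * b 0 + y 1 * b 1 + y 2 * b 2 = 0 := by exact_mod_cast hyb
  have hy1r : |(y 1 : ℝ)| ≤ H := by rw [hHd]; exact_mod_cast hy12
  have hb2 : |b 2 - θ2 * b 0| ≤ ε := by
    have id : (y 2 : ℝ) * (b 2 - θ2 * b 0) = -(b 0 * (y 0 + y 1 * θ1 + y 2 * θ2)) - y 1 * (b 1 - θ1 * b 0) := by
      linear_combination hybr
    have h1 : H * |b 2 - θ2 * b 0| ≤ X * |y 0 + y 1 * θ1 + y 2 * θ2| + H * (ε / 2) := by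
      rw [hHd, ← abs_mul, id]
      refine (abs_sub _ _).trans ?_
      rw [abs_neg, abs_mul, abs_mul]
      have := mul_le_mul hy1r hb1h (abs_nonneg _) (by linarith)
      linarith
    have h2 : X * |y 0 + y 1 * θ1 + y 2 * θ2| ≤ H * (ε / 2) := by
      have h3 : X * |y 0 + y 1 * θ1 + y 2 * θ2| ≤ 2 * (H ^ 2 * T ^ 4) * (1 / (H ^ 2 * T ^ 12)) :=
        mul_le_mul hX2 hcon.le (abs_nonneg _) (by positivity)
      have e1 : 2 * (H ^ 2 * T ^ 4) * (1 / (H ^ 2 * T ^ 12)) = 2 / T ^ 8 := by field_simp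
      have e2 : H * (ε / 2) = 1 / T ^ 4 := by rw [hε]; field_simp
      have e3 : 2 / T ^ 8 ≤ 1 / T ^ 4 := by
        rw [div_le_div_iff₀ (by positivity) (by positivity)]
        have : 2 * T ^ 4 ≤ T ^ 4 * T ^ 4 := mul_le_mul_of_nonneg_right (by linarith) (by positivity)
        have e : T ^ 4 * T ^ 4 = T ^ 8 := by ring
        linarith
      rw [e2]; rw [e1] at h3; linarith
    have h4 : H * |b 2 - θ2 * b 0| ≤ H * ε := by linarith
    exact le_of_mul_le_mul_left h4 hHp
  have hXκ : H ^ (1 / (D:ℝ)) ≤ X := by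
    have h1 := hLio (b 1) (b 0) hb0
    have h2 : c ≤ X ^ D * (ε / 2) := h1.trans (mul_le_mul_of_nonneg_left hb1h (by positivity))
    have h3 : H ≤ X ^ D := by
      have h4 : c * (H * T ^ 4) ≤ X ^ D := by
        have := mul_le_mul_of_nonneg_right h2 (show 0 ≤ H * T ^ 4 by positivity)
        have e : X ^ D * (ε / 2) * (H * T ^ 4) = X ^ D * ((ε * (H * T ^ 4)) / 2) := by ring
        rw [e, hεe] at this
        linarith
      have h5 : 1 ≤ c * T ^ 4 := by
        have h6 : 2 ≤ c * T := by
          have : c * (2 / c) ≤ c * T := mul_le_mul_of_nonneg_left (by linarith) hc.le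
          have e : c * (2 / c) = 2 := by field_simp
          linarith
        have h7 : T ≤ T ^ 4 := by
          calc T = T ^ 1 := (pow_one T).symm
            _ ≤ T ^ 4 := pow_le_pow_right₀ (by linarith) (by norm_num)
        have := mul_le_mul_of_nonneg_left h7 hc.le
        linarith
      have := mul_le_mul_of_nonneg_left h5 hHp.le
      linarith
    have := Real.rpow_le_rpow hHp.le h3 (show 0 ≤ 1 / (D:ℝ) by positivity)
    rwa [← Real.rpow_natCast, ← Real.rpow_mul (by linarith), mul_one_div_cancel hD'.ne', Real.rpow_one] at this
  have hX3 : X ≤ H ^ 3 := by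
    have : H ^ 2 * (32 * T ^ 4) ≤ H ^ 2 * H := mul_le_mul_of_nonneg_left hT4H (by positivity)
    have e : H ^ 2 * H = H ^ 3 := by ring
    have : 0 < H ^ 2 * T ^ 4 := by positivity
    linarith
  have hHε : 1 ≤ H ^ 2 * ε := by
    have e : H ^ 2 * ε = 2 * H / T ^ 4 := by rw [hε]; field_simp
    rw [e, le_div_iff₀ (by positivity)]
    have : 0 < T ^ 4 := by positivity
    linarith
  have hε1 : ε ≤ 1 := by
    rw [hε, div_le_one (by positivity)]
    have : 1 * 32 ≤ H * T ^ 4 := mul_le_mul hH1'.le hT4 (by norm_num) hHp.le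
    linarith
  have hεX : ∀ Z, ε * X ≤ Z ↔ 2 * X ≤ Z * (H * T ^ 4) := by
    intro Z
    rw [hε, div_mul_eq_mul_div, div_le_iff₀ (by positivity)]
  rcases lt_or_ge (H ^ 2 * T ^ 2) X with hbig | hsm
  · refine hH3 ε y b u t hHH3 hyb hu ht hb0 hy12 hb1 hb2 ?_ hX3 ?_
    · rw [hεX]; linarith
    · rw [hTη, mul_one_div, le_div_iff₀ hTp]
      have : H ^ 2 * T * 25 ≤ H ^ 2 * T * T := mul_le_mul_of_nonneg_left (by linarith) (by positivity)
      have e : H ^ 2 * T * T = H ^ 2 * T ^ 2 := by ring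
      linarith
  rcases le_or_gt (H ^ 2) X with hmid | hlo
  · refine hH1 H hHH1 ε y b u t hyb hu ht hb0 hy2 hy12 hb1 hb2 hHε hε1 hmid hX3 hXκ ?_
    have h1 : ε * X ≤ H * (1 / T) / 8 := by
      rw [hεX]
      have e : H * (1 / T) / 8 * (H * T ^ 4) = H ^ 2 * T ^ 2 * T / 8 := by field_simp
      rw [e]
      have : H ^ 2 * T ^ 2 * 32 ≤ H ^ 2 * T ^ 2 * T := mul_le_mul_of_nonneg_left (by linarith) (by positivity)
      linarith
    rw [hTη]
    linarith
  · obtain ⟨z', hz'0, hz'1, hz'2, hz'b⟩ := pig2 b hb0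
    obtain ⟨j, hj⟩ : ∃ j, z' j ≠ 0 := by
      rcases hz'0 with h | h
      · exact ⟨1, h⟩
      · exact ⟨2, h⟩
    obtain ⟨d', z, v, hd', hdz, hv⟩ := prim3 z' j hj
    have hzb : z 0 * b 0 + z 1 * b 1 + z 2 * b 2 = 0 := by
      have : d' * (z 0 * b 0 + z 1 * b 1 + z 2 * b 2) = 0 := by
        rw [hdz 0, hdz 1, hdz 2] at hz'b; linear_combination hz'b
      exact (mul_eq_zero.1 this).resolve_left (by omega)
    have hsqle : ∀ i, z i ^ 2 ≤ z' i ^ 2 := by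
      intro i
      rw [hdz i, mul_pow]
      have : (1:ℤ) ≤ d' ^ 2 := one_le_pow₀ hd'
      exact le_mul_of_one_le_left (sq_nonneg _) this
    have hz1 : z 1 ^ 2 ≤ |b 0| := (hsqle 1).trans hz'1
    have hz2 : z 2 ^ 2 ≤ |b 0| := (hsqle 2).trans hz'2
    have hz0 : z 1 ≠ 0 ∨ z 2 ≠ 0 := by
      rcases hz'0 with h | h
      · left; intro h'; rw [hdz 1, h', mul_zero] at h; exact h rfl
      · right; intro h'; rw [hdz 2, h', mul_zero] at h; exact h rfl
    have hz1r : |(z 1 : ℝ)| ^ 2 ≤ X := by rw [hX, sq_abs]; exact_mod_cast hz1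
    have hz2r : |(z 2 : ℝ)| ^ 2 ≤ X := by rw [hX, sq_abs]; exact_mod_cast hz2
    have hcr : X ≤ H * |(z 2 : ℝ)| + H * |(z 1 : ℝ)| := by
      rcases par_or y z b u t hyb hzb hu ht hb0 with h | ⟨m, hm⟩
      · have h1 : X ≤ |(y 1 : ℝ) * z 2 - y 2 * z 1| := by rw [hX]; exact_mod_cast h
        refine h1.trans ((abs_sub _ _).trans ?_)
        rw [abs_mul, abs_mul]
        have := mul_le_mul_of_nonneg_right hy1r (abs_nonneg (z 2 : ℝ))
        linarith
      · exfalso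
        have hm0 : m ≠ 0 := by
          intro h
          rcases hz0 with h' | h'
          · apply h'; rw [hm 1, h, zero_mul]
          · apply h'; rw [hm 2, h, zero_mul]
        have h1 : H ≤ |(z 2 : ℝ)| := by
          have : |y 2| ≤ |z 2| := by
            rw [hm 2, abs_mul]
            exact le_mul_of_one_le_left (abs_nonneg _) (Int.one_le_abs hm0)
          rw [hHd]; exact_mod_cast this
        have := pow_le_pow_left₀ hHp.le h1 2
        linarith
    have hfin : ∀ Y : ℝ, 0 ≤ Y → |(z 1 : ℝ)| ≤ Y → |(z 2 : ℝ)| ≤ Y → 8 * ε * X ≤ Y * H ^ (-η) := by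
      intro Y hY0 h1 h2
      have h3 : X ≤ 2 * (H * Y) := by
        have := mul_le_mul_of_nonneg_left h1 hHp.le
        have := mul_le_mul_of_nonneg_left h2 hHp.le
        linarith
      have h4 : ε * X ≤ Y * (1 / T) / 8 := by
        rw [hεX]
        have e : Y * (1 / T) / 8 * (H * T ^ 4) = H * Y * T ^ 3 / 8 := by field_simp
        rw [e]
        have hT3 : (32:ℝ) ≤ T ^ 3 := by
          have : (32:ℝ)^3 ≤ T ^ 3 := pow_le_pow_left₀ (by norm_num) hT32 3
          linarith
        have : H * Y * 32 ≤ H * Y * T ^ 3 := mul_le_mul_of_nonneg_left hT3 (by positivity)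
        linarith
      rw [hTη]
      linarith
    rcases le_total |z 1| |z 2| with hle | hle
    · have hler : |(z 1 : ℝ)| ≤ |(z 2 : ℝ)| := by exact_mod_cast hle
      have hz20 : z 2 ≠ 0 := by
        intro h
        rw [h, abs_zero] at hle
        rcases hz0 with h' | h'
        · exact h' (abs_eq_zero.1 (le_antisymm hle (abs_nonneg _)))
        · exact h' h
      exact hH1 H hHH1 ε z b v t hzb hv ht hb0 hz20 hle hb1 hb2 hHε hε1 hz2r hX3 hXκ
        (hfin _ (abs_nonneg _) hler le_rfl)
    · have hler : |(z 2 : ℝ)| ≤ |(z 1 : ℝ)| := by exact_mod_cast hle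
      have hz20 : z 1 ≠ 0 := by
        intro h
        rw [h, abs_zero] at hle
        rcases hz0 with h' | h'
        · exact h' h
        · exact h' (abs_eq_zero.1 (le_antisymm hle (abs_nonneg _)))
      refine hH2 H hHH2 ε ![z 0, z 2, z 1] ![b 0, b 2, b 1] ![v 0, v 2, v 1] ![t 0, t 2, t 1] ?_ ?_ ?_
        hb0 hz20 hle hb2 hb1 hHε hε1 hz1r hX3 hXκ (hfin _ (abs_nonneg _) le_rfl hler)
      · show z 0 * b 0 + z 2 * b 2 + z 1 * b 1 = 0
        linarith
      · show z 0 * v 0 + z 2 * v 2 + z 1 * v 1 = 1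
        linarith
      · show b 0 * t 0 + b 2 * t 2 + b 1 * t 1 = 1
        linarith
end Sub6

namespace Sub6

lemma liou (θ : ℝ) (hθ : Irrational θ) (hi : IsIntegral ℤ θ) :
    ∃ D : ℕ, 0 < D ∧ ∃ c : ℝ, 0 < c ∧ ∀ p q : ℤ, q ≠ 0 → c ≤ |(q:ℝ)| ^ D * |p - θ * q| := by
  obtain ⟨f, hf, hr⟩ := hi
  obtain ⟨A, hA, h⟩ := Liouville.exists_pos_real_of_irrational_root hθ hf.ne_zero
    (by rw [Polynomial.eval_map]; exact hr)
  refine ⟨f.natDegree + 1, by omega, 1 / A, by positivity, ?_⟩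
  intro p q hq
  have key : ∀ (p : ℤ) (n : ℕ), 1 / A ≤ ((n:ℝ) + 1) ^ (f.natDegree + 1) * |p - θ * (n + 1)| := by
    intro p n
    have h1 := h p n
    have hn : (0:ℝ) < n + 1 := by positivity
    have e : |θ - p / (n + 1)| = |p - θ * (n + 1)| / (n + 1) := by
      rw [← abs_of_pos hn, ← abs_div, abs_of_pos hn, abs_sub_comm]
      congr 1; field_simp
    rw [e] at h1
    rw [div_le_iff₀ hA]
    refine h1.trans ?_
    rw [pow_succ]
    have h2 : |p - θ * (n + 1)| / (n + 1) ≤ (n + 1) * |p - θ * (n + 1)| := by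
      rw [div_le_iff₀ hn]
      have : 1 * |p - θ * (n + 1)| ≤ ((n:ℝ) + 1) ^ 2 * |p - θ * (n + 1)| := by
        refine mul_le_mul_of_nonneg_right ?_ (abs_nonneg _)
        exact one_le_pow₀ (by linarith [show (0:ℝ) ≤ n by positivity])
      linarith
    have := mul_le_mul_of_nonneg_left (mul_le_mul_of_nonneg_right h2 hA.le)
      (show 0 ≤ ((n:ℝ) + 1) ^ f.natDegree by positivity)
    linarith
  obtain ⟨n, hn⟩ : ∃ n : ℕ, q.natAbs = n + 1 := Nat.exists_eq_succ_of_ne_zero (Int.natAbs_ne_zero.2 hq)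
  rcases Int.natAbs_eq q with h2 | h2
  · have h3 : (q : ℝ) = n + 1 := by rw [h2, hn]; push_cast; ring
    rw [h3, abs_of_pos (by positivity)]
    exact key p n
  · have h3 : (q : ℝ) = -(n + 1) := by rw [h2, hn]; push_cast; ring
    rw [h3, abs_neg, abs_of_pos (by positivity)]
    have := key (-p) n
    have e : |((-p : ℤ) : ℝ) - θ * (n + 1)| = |p - θ * -(n + 1)| := by
      rw [← abs_neg]; congr 1; push_cast; ring
    rwa [e] at this

lemma aux_all (β : ℝ) (hβ : IsIntegral ℤ β) : AuxGood (Gdu β (β^2)) ∧ AuxGood (Gdu (β^2) β) ∧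
    AuxGood (Gp β (β^2)) ∧ AuxGood (Gp (β^2) β) := by
  obtain ⟨f, hf, hr⟩ := hβ
  have hr' : Polynomial.aeval β f = 0 := hr
  refine ⟨?_, ?_, ?_, ?_⟩
  · have := auxGood f hf β hr' (fun i j => (!![1, -Polynomial.X, -Polynomial.X^2; 0, 1, 0; 0, 0, 1] : Matrix (Fin 3) (Fin 3) (Polynomial ℤ)) i j)
    convert this using 1
    ext i j; fin_cases i <;> fin_cases j <;> simp [Gdu]
  · have := auxGood f hf β hr' (fun i j => (!![1, -Polynomial.X^2, -Polynomial.X; 0, 1, 0; 0, 0, 1] : Matrix (Fin 3) (Fin 3) (Polynomial ℤ)) i j)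
    convert this using 1
    ext i j; fin_cases i <;> fin_cases j <;> simp [Gdu]
  · have := auxGood f hf β hr' (fun i j => (!![1, 0, 0; Polynomial.X, 1, 0; Polynomial.X^2, 0, 1] : Matrix (Fin 3) (Fin 3) (Polynomial ℤ)) i j)
    convert this using 1
    ext i j; fin_cases i <;> fin_cases j <;> simp [Gp]
  · have := auxGood f hf β hr' (fun i j => (!![1, 0, 0; Polynomial.X^2, 1, 0; Polynomial.X, 0, 1] : Matrix (Fin 3) (Fin 3) (Polynomial ℤ)) i j)
    convert this using 1
    ext i j; fin_cases i <;> fin_cases j <;> simp [Gp]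

def mx (a b : ℤ) : ℝ := max 1 (max |(a:ℝ)| |(b:ℝ)|)
lemma one_le_mx (a b : ℤ) : 1 ≤ mx a b := le_max_left _ _

lemma mx_anti (δ : ℝ) (hδ : 0 < δ) {s t : ℝ} (hs : 0 < s) (h : s ≤ t) : t ^ (-2 - δ) ≤ s ^ (-2 - δ) :=
  Real.rpow_le_rpow_of_nonpos hs h (by linarith)

theorem schmidt_int (β : ℝ) (hβ : IsIntegral ℤ β)
    (hind : ∀ a b c : ℤ, (a:ℝ) + b * β + c * β^2 = 0 → a = 0 ∧ b = 0 ∧ c = 0)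
    (δ : ℝ) (hδ : 0 < δ) (hδ1 : δ ≤ 1) :
    ∃ c : ℝ, 0 < c ∧ ∀ y : Fin 3 → ℤ, (∃ j, y j ≠ 0) → 
      c * mx (y 1) (y 2) ^ (-2 - δ) ≤ |(y 0 : ℝ) + y 1 * β + y 2 * β^2| := by
  have hirr1 : Irrational β := by
    rintro ⟨q, hq⟩
    have := (hind (-q.num) q.den 0 (by
      rw [← hq]
      have : (q.den : ℚ) * q = q.num := by rw [mul_comm]; exact Rat.mul_den_eq_num q
      have : (q.den : ℝ) * (q:ℝ) = q.num := by exact_mod_cast this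
      push_cast; linarith)).2.1
    have h := q.den_pos
    omega
  have hirr2 : Irrational (β^2) := by
    rintro ⟨q, hq⟩
    have := (hind (-q.num) 0 q.den (by
      rw [← hq]
      have : (q.den : ℚ) * q = q.num := by rw [mul_comm]; exact Rat.mul_den_eq_num q
      have : (q.den : ℝ) * (q:ℝ) = q.num := by exact_mod_cast this
      push_cast; linarith)).2.2
    have h := q.den_pos
    omega
  obtain ⟨g1, g2, g3, g4⟩ := aux_all β hβ
  obtain ⟨H1, h11, hH1⟩ := schmidt_ord β (β^2) g1 g2 g3 (liou β hirr1 hβ) δ hδ hδ1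
  obtain ⟨H2, h21, hH2⟩ := schmidt_ord (β^2) β g2 g1 g4 (liou _ hirr2 (hβ.pow 2)) δ hδ hδ1
  set M : ℤ := ⌈max H1 H2⌉ with hM
  have hM1 : H1 ≤ M := (le_max_left _ _).trans (Int.le_ceil _)
  have hM2 : H2 ≤ M := (le_max_right _ _).trans (Int.le_ceil _)
  set N : ℤ := ⌈1 + M * |β| + M * β^2⌉ with hN
  have hNle : 1 + M * |β| + M * β^2 ≤ N := Int.le_ceil _
  have hMr : (1:ℝ) < M := by linarith
  have hMN : 1 ≤ N := by
    have : (1:ℝ) ≤ N := by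
      have : 0 ≤ M * |β| + M * β^2 := by positivity
      linarith
    exact_mod_cast this
  let S : Set (Fin 3 → ℤ) := {y | (∃ j, y j ≠ 0) ∧ y ∈ Set.Icc (fun _ => -(max M N)) (fun _ => max M N)}
  have hS : S.Finite := (Set.finite_Icc _ _).subset fun y hy => hy.2
  have hpos : ∀ y : Fin 3 → ℤ, (∃ j, y j ≠ 0) → 0 < |(y 0 : ℝ) + y 1 * β + y 2 * β^2| := by
    rintro y ⟨j, hj⟩
    rw [abs_pos]
    intro h
    obtain ⟨h0, h1, h2⟩ := hind _ _ _ h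
    apply hj
    fin_cases j
    · exact h0
    · exact h1
    · exact h2
  obtain ⟨Bd, hBd⟩ := (hS.image fun y => 1 / |(y 0 : ℝ) + y 1 * β + y 2 * β^2|).bddAbove
  have hprim : ∀ y u : Fin 3 → ℤ, y 0 * u 0 + y 1 * u 1 + y 2 * u 2 = 1 → (∃ j, y j ≠ 0) →
      1 / (1 + |Bd|) * mx (y 1) (y 2) ^ (-2 - δ) ≤ |(y 0 : ℝ) + y 1 * β + y 2 * β^2| := by
    intro y u hu hy
    have hc1 : 1 / (1 + |Bd|) ≤ 1 := by
      rw [div_le_one (by positivity)]; linarith [abs_nonneg Bd]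
    have hmx1 : mx (y 1) (y 2) ^ (-2 - δ) ≤ 1 := by
      have := mx_anti δ hδ one_pos (one_le_mx (y 1) (y 2))
      rwa [Real.one_rpow] at this
    have hmx0 : 0 ≤ mx (y 1) (y 2) ^ (-2 - δ) := Real.rpow_nonneg (by linarith [one_le_mx (y 1) (y 2)]) _
    have hred : ∀ x : ℝ, mx (y 1) (y 2) ^ (-2 - δ) ≤ x → 1 / (1 + |Bd|) * mx (y 1) (y 2) ^ (-2 - δ) ≤ x := by
      intro x hx
      have := mul_le_mul_of_nonneg_right hc1 hmx0
      linarith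
    by_cases hb1 : (M:ℝ) ≤ max |(y 1 : ℝ)| |(y 2 : ℝ)|
    · apply hred
      have em : mx (y 1) (y 2) = max |(y 1 : ℝ)| |(y 2 : ℝ)| := max_eq_right (by linarith)
      rw [em]
      rcases le_total |y 1| |y 2| with h | h
      · have hr : |(y 1 : ℝ)| ≤ |(y 2 : ℝ)| := by exact_mod_cast h
        rw [max_eq_right hr] at hb1 ⊢
        exact hH1 y u hu h (by linarith)
      · have hr : |(y 2 : ℝ)| ≤ |(y 1 : ℝ)| := by exact_mod_cast h
        rw [max_eq_left hr] at hb1 ⊢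
        have := hH2 ![y 0, y 2, y 1] ![u 0, u 2, u 1]
          (by show y 0 * u 0 + y 2 * u 2 + y 1 * u 1 = 1
              linarith) h (hM2.trans hb1)
        have e : (y 0 : ℝ) + y 1 * β + y 2 * β^2 = y 0 + y 2 * β^2 + y 1 * β := by ring
        rw [e]
        exact this
    · push Not at hb1
      by_cases hL : 1 ≤ |(y 0 : ℝ) + y 1 * β + y 2 * β^2|
      · exact hred _ (hmx1.trans hL)
      · push Not at hL
        have hy1 : |(y 1 : ℝ)| ≤ M := (le_max_left _ _).trans hb1.le
        have hy2 : |(y 2 : ℝ)| ≤ M := (le_max_right _ _).trans hb1.le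
        have hy0 : |(y 0 : ℝ)| ≤ N := by
          have e : (y 0 : ℝ) = ((y 0 : ℝ) + y 1 * β + y 2 * β^2) - y 1 * β - y 2 * β^2 := by ring
          rw [e]
          refine (abs_sub _ _).trans ?_
          have h1 := abs_sub ((y 0 : ℝ) + y 1 * β + y 2 * β^2) (y 1 * β)
          have h2 : |(y 1 : ℝ) * β| ≤ M * |β| := by
            rw [abs_mul]; exact mul_le_mul_of_nonneg_right hy1 (abs_nonneg _)
          have h3 : |(y 2 : ℝ) * β^2| ≤ M * β^2 := by
            rw [abs_mul, abs_of_nonneg (sq_nonneg β)]; exact mul_le_mul_of_nonneg_right hy2 (sq_nonneg _)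
          linarith
        have hy1z : |y 1| ≤ M := by exact_mod_cast hy1
        have hy2z : |y 2| ≤ M := by exact_mod_cast hy2
        have hy0z : |y 0| ≤ N := by exact_mod_cast hy0
        have hmem : y ∈ S := by
          refine ⟨hy, ?_, ?_⟩
          · intro i
            show -(max M N) ≤ y i
            fin_cases i
            · exact (neg_le_neg (le_max_right _ _)).trans (abs_le.1 hy0z).1
            · exact (neg_le_neg (le_max_left _ _)).trans (abs_le.1 hy1z).1
            · exact (neg_le_neg (le_max_left _ _)).trans (abs_le.1 hy2z).1
          · intro i
            show y i ≤ max M N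
            fin_cases i
            · exact (abs_le.1 hy0z).2.trans (le_max_right _ _)
            · exact (abs_le.1 hy1z).2.trans (le_max_left _ _)
            · exact (abs_le.1 hy2z).2.trans (le_max_left _ _)
        have h1 : 1 / |(y 0 : ℝ) + y 1 * β + y 2 * β^2| ≤ Bd := hBd ⟨y, hmem, rfl⟩
        have hp := hpos y hy
        have h2 : 1 / (1 + |Bd|) ≤ |(y 0 : ℝ) + y 1 * β + y 2 * β^2| := by
          rw [div_le_iff₀ (by positivity)]
          rw [div_le_iff₀ hp] at h1
          have := mul_le_mul_of_nonneg_right (le_abs_self Bd) hp.le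
          linarith
        have h3 := mul_le_mul_of_nonneg_left hmx1 (show 0 ≤ 1 / (1 + |Bd|) by positivity)
        linarith
  refine ⟨1 / (1 + |Bd|), by positivity, ?_⟩
  rintro y ⟨j, hj⟩
  obtain ⟨d, z, t, hd, hdz, ht⟩ := prim3 y j hj
  have hzj : z j ≠ 0 := by intro h; rw [hdz j, h, mul_zero] at hj; exact hj rfl
  have h1 := hprim z t ht ⟨j, hzj⟩
  have hdr : (1:ℝ) ≤ d := by exact_mod_cast hd
  have hle : ∀ i, |(z i : ℝ)| ≤ |(y i : ℝ)| := by
    intro i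
    rw [hdz i]; push_cast
    rw [abs_mul, abs_of_nonneg (by linarith : (0:ℝ) ≤ d)]
    exact le_mul_of_one_le_left (abs_nonneg _) hdr
  have h2 : mx (z 1) (z 2) ≤ mx (y 1) (y 2) := max_le_max le_rfl (max_le_max (hle 1) (hle 2))
  have h3 := mx_anti δ hδ (by linarith [one_le_mx (z 1) (z 2)]) h2
  have h4 := mul_le_mul_of_nonneg_left h3 (show 0 ≤ 1 / (1 + |Bd|) by positivity)
  refine h4.trans (h1.trans ?_)
  have e : (y 0 : ℝ) + y 1 * β + y 2 * β^2 = d * ((z 0 : ℝ) + z 1 * β + z 2 * β^2) := by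
    rw [hdz 0, hdz 1, hdz 2]; push_cast; ring
  rw [e, abs_mul, abs_of_nonneg (by linarith : (0:ℝ) ≤ d)]
  exact le_mul_of_one_le_left (abs_nonneg _) hdr

lemma indep3 (α : ℝ) (ha : IsAlgebraic ℚ α) (h3 : 3 ≤ (minpoly ℚ α).natDegree) :
    ∀ a b c : ℤ, (a:ℝ) + b * α + c * α^2 = 0 → a = 0 ∧ b = 0 ∧ c = 0 := by
  intro a b c h
  set p : Polynomial ℚ := Polynomial.C (c:ℚ) * Polynomial.X^2 + Polynomial.C (b:ℚ) * Polynomial.X + Polynomial.C (a:ℚ) with hp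
  have hpr : Polynomial.aeval α p = 0 := by
    rw [hp]; simp; linarith
  have hp0 : p = 0 := by
    by_contra hne
    have h1 := Polynomial.natDegree_le_natDegree (minpoly.degree_le_of_ne_zero ℚ α hne hpr)
    have h2 : p.natDegree ≤ 2 := Polynomial.natDegree_quadratic_le
    omega
  have h0 := congrArg (fun q => Polynomial.coeff q 0) hp0
  have h1 := congrArg (fun q => Polynomial.coeff q 1) hp0
  have h2 := congrArg (fun q => Polynomial.coeff q 2) hp0
  simp only [hp, Polynomial.coeff_add, Polynomial.coeff_C_mul, Polynomial.coeff_X_pow, Polynomial.coeff_X,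
    Polynomial.coeff_C, Polynomial.coeff_zero] at h0 h1 h2
  norm_num at h0 h1 h2
  exact ⟨h0, h1, h2⟩

theorem schmidt (α : ℝ) (ha : IsAlgebraic ℚ α) (h3 : 3 ≤ (minpoly ℚ α).natDegree)
    (δ : ℝ) (hδ : 0 < δ) (hδ1 : δ ≤ 1) :
    ∃ c : ℝ, 0 < c ∧ ∀ a b d : ℤ, (a ≠ 0 ∨ b ≠ 0 ∨ d ≠ 0) →
      c * mx b d ^ (-2 - δ) ≤ |(a : ℝ) + b * α + d * α^2| := by
  have hind := indep3 α ha h3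
  have haZ : IsAlgebraic ℤ α := (IsFractionRing.isAlgebraic_iff ℤ ℚ ℝ).2 ha
  obtain ⟨D, hD, hDi⟩ := haZ.exists_integral_multiple
  set β : ℝ := D • α with hβ
  have hβ' : β = D * α := by rw [hβ, zsmul_eq_mul]
  have hDr : (1:ℝ) ≤ |(D:ℝ)| := by
    have := Int.one_le_abs hD
    exact_mod_cast this
  have hindβ : ∀ a b c : ℤ, (a:ℝ) + b * β + c * β^2 = 0 → a = 0 ∧ b = 0 ∧ c = 0 := by
    intro a b c h
    obtain ⟨h1, h2, h3⟩ := hind a (b * D) (c * D^2) (by push_cast; rw [← h, hβ']; ring)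
    refine ⟨h1, (mul_eq_zero.1 h2).resolve_right hD, (mul_eq_zero.1 h3).resolve_right (pow_ne_zero _ hD)⟩
  obtain ⟨c, hc, hmain⟩ := schmidt_int β hDi hindβ δ hδ hδ1
  refine ⟨c * |(D:ℝ)| ^ (-2 - δ) / (D:ℝ)^2, ?_, ?_⟩
  · have : 0 < |(D:ℝ)| := by linarith
    have hD' : (D:ℝ) ≠ 0 := by exact_mod_cast hD
    positivity
  intro a b d habd
  have h1 := hmain ![D^2 * a, D * b, d] (by
    rcases habd with h | h | h
    · exact ⟨0, mul_ne_zero (pow_ne_zero _ hD) h⟩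
    · exact ⟨1, mul_ne_zero hD h⟩
    · exact ⟨2, h⟩)
  have h2 : c * mx (D * b) d ^ (-2 - δ) ≤ |((D^2 * a : ℤ) : ℝ) + ((D * b : ℤ) : ℝ) * β + d * β^2| := h1
  have e : ((D^2 * a : ℤ) : ℝ) + ((D * b : ℤ) : ℝ) * β + d * β^2 = (D:ℝ)^2 * (a + b * α + d * α^2) := by
    rw [hβ']; push_cast; ring
  have hD2 : (0:ℝ) < (D:ℝ)^2 := by
    have hD' : (D:ℝ) ≠ 0 := by exact_mod_cast hD
    positivity
  rw [e, abs_mul, abs_of_pos hD2] at h2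
  have h4 : mx (D * b) d ≤ |(D:ℝ)| * mx b d := by
    refine max_le ?_ (max_le ?_ ?_)
    · exact (one_le_mx b d).trans (le_mul_of_one_le_left (by linarith [one_le_mx b d]) hDr)
    · push_cast
      rw [abs_mul]
      exact mul_le_mul_of_nonneg_left ((le_max_left _ _).trans (le_max_right _ _)) (abs_nonneg _)
    · have : |(d:ℝ)| ≤ mx b d := (le_max_right _ _).trans (le_max_right _ _)
      exact this.trans (le_mul_of_one_le_left (by linarith [one_le_mx b d]) hDr)
  have h5 := mx_anti δ hδ (by linarith [one_le_mx (D * b) d]) h4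
  rw [Real.mul_rpow (abs_nonneg _) (by linarith [one_le_mx b d])] at h5
  have h6 := mul_le_mul_of_nonneg_left h5 hc.le
  rw [div_mul_eq_mul_div, div_le_iff₀ hD2]
  linarith
end Sub6

namespace Sub6

def K (x : ℕ → ℕ) (i n : ℕ) : ℕ := cfQ (fun t => x (i + t)) n

section
variable {x : ℕ → ℕ}
lemma K_zero (x : ℕ → ℕ) (i : ℕ) : K x i 0 = 1 := rfl
lemma K_one (x : ℕ → ℕ) (i : ℕ) : K x i 1 = x i := rfl
lemma K_succ (x : ℕ → ℕ) (i n : ℕ) : K x i (n+2) = x (i + (n+1)) * K x i (n+1) + K x i n := rfl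

lemma K_pos (hx : ∀ n, 0 < x n) (i n : ℕ) : 0 < K x i n := by
  induction n using Nat.strong_induction_on with
  | _ n ih =>
    match n with
    | 0 => exact one_pos
    | 1 => exact hx _
    | n + 2 => rw [K_succ]; have := ih n (by omega); omega

lemma K_mono1 (hx : ∀ n, 0 < x n) (i n : ℕ) : K x i n ≤ K x i (n+1) := by
  match n with
  | 0 => exact hx _
  | n + 1 =>
    rw [K_succ]
    have := Nat.le_mul_of_pos_left (K x i (n+1)) (hx (i + (n+1)))
    omega

lemma K_mono (hx : ∀ n, 0 < x n) (i : ℕ) {n m : ℕ} (h : n ≤ m) : K x i n ≤ K x i m :=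
  monotone_nat_of_le_succ (K_mono1 hx i) h

lemma K_cat (x : ℕ → ℕ) (i m n : ℕ) :
    K x i (m + 1 + (n + 1)) = K x i (m+1) * K x (i+m+1) (n+1) + K x i m * K x (i+m+2) n := by
  induction n using Nat.strong_induction_on with
  | _ n ih =>
    match n with
    | 0 => rw [show m + 1 + (0 + 1) = m + 2 by ring, K_succ, K_one, K_zero]; 
           rw [show i + (m+1) = i + m + 1 by ring]; ring
    | 1 =>
      have e := ih 0 (by omega)
      rw [show m + 1 + (1 + 1) = (m + 1) + 2 by ring, K_succ, show m + 1 + 1 = m + 1 + (0 + 1) by ring, e]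
      rw [show i + (m + 1 + (0+1)) = i + m + 2 by ring, show (1 + 1) = 0 + 2 by ring, K_succ]
      rw [zero_add, K_one, K_zero, K_zero, K_one, show i + m + 1 + 1 = i + m + 2 by ring]
      ring
    | n + 2 =>
      have e1 := ih (n+1) (by omega)
      have e0 := ih n (by omega)
      rw [show m + 1 + (n + 2 + 1) = (m + 1 + n + 1) + 2 by ring, K_succ,
        show m + 1 + n + 1 + 1 = m + 1 + (n + 1 + 1) by ring, e1, show m + 1 + n + 1 = m + 1 + (n + 1) by ring, e0]
      rw [show n + 2 + 1 = (n + 1) + 2 by ring, K_succ x (i+m+1) (n+1), K_succ x (i+m+2) n]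
      rw [show i + (m + 1 + (n + 1 + 1)) = i + m + 1 + (n + 1 + 1) by ring,
        show i + m + 2 + (n + 1) = i + m + 1 + (n + 1 + 1) by ring]
      ring

lemma K_left (x : ℕ → ℕ) (i n : ℕ) : K x i (n+2) = x i * K x (i+1) (n+1) + K x (i+2) n := by
  have := K_cat x i 0 n
  rw [show 0 + 1 + (n+1) = n + 2 by ring, zero_add, K_one, K_zero, add_zero, one_mul] at this
  exact this

lemma K_leftmono (hx : ∀ n, 0 < x n) (i n : ℕ) : K x (i+1) n ≤ K x i (n+1) := by
  match n with
  | 0 => exact hx _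
  | n + 1 =>
    rw [K_left]
    have := Nat.le_mul_of_pos_left (K x (i+1) (n+1)) (hx i)
    omega

lemma K_mul_le (hx : ∀ n, 0 < x n) (i m n : ℕ) : K x i m * K x (i+m) n ≤ K x i (m+n) := by
  match m, n with
  | 0, n => simp [K_zero]
  | m, 0 => simp [K_zero]
  | m+1, n+1 => rw [K_cat, show i + (m+1) = i + m + 1 by ring]; exact Nat.le_add_right _ _

lemma K_le_mul (hx : ∀ n, 0 < x n) (i m n : ℕ) : K x i (m+n) ≤ 2 * (K x i m * K x (i+m) n) := by
  match m, n with
  | 0, n => simp [K_zero]; omega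
  | m, 0 => simp [K_zero]; omega
  | m+1, n+1 =>
    rw [K_cat, show i + (m+1) = i + m + 1 by ring]
    have h1 := Nat.mul_le_mul (K_mono1 hx i m) (K_leftmono hx (i+m+1) n)
    rw [show i + m + 1 + 1 = i + m + 2 by ring] at h1
    omega

lemma K_step (hx : ∀ n, 0 < x n) {M : ℕ} (hM : ∀ n, x n ≤ M) (i n : ℕ) :
    K x i (n+1) ≤ (M+1) * K x i n := by
  match n with
  | 0 => rw [zero_add, K_one, K_zero]; have := hM i; omega
  | n+1 =>
    rw [K_succ, add_mul, one_mul]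
    exact Nat.add_le_add (Nat.mul_le_mul_right _ (hM _)) (K_mono1 hx i n)

lemma K_steps (hx : ∀ n, 0 < x n) {M : ℕ} (hM : ∀ n, x n ≤ M) (i n k : ℕ) :
    K x i (n+k) ≤ (M+1)^k * K x i n := by
  induction k with
  | zero => simp
  | succ k ih =>
    rw [← add_assoc, pow_succ]
    refine (K_step hx hM i (n+k)).trans ?_
    calc (M+1) * K x i (n+k) ≤ (M+1) * ((M+1)^k * K x i n) := Nat.mul_le_mul_left _ ih
      _ = _ := by ring

lemma K_ge (hx : ∀ n, 0 < x n) (i n : ℕ) : n ≤ K x i n := by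
  induction n using Nat.strong_induction_on with
  | _ n ih =>
    match n with
    | 0 => omega
    | 1 => exact hx _
    | n + 2 =>
      rw [K_succ]
      have h1 := ih (n+1) (by omega)
      have h2 := K_pos hx i n
      have := Nat.le_mul_of_pos_left (K x i (n+1)) (hx (i + (n+1)))
      omega

lemma K_congr {i j n : ℕ} (h : ∀ t < n, x (i+t) = x (j+t)) : K x i n = K x j n := by
  induction n using Nat.strong_induction_on with
  | _ n ih =>
    match n with
    | 0 => rfl
    | 1 => have := h 0 (by omega); simpa [K_one] using this
    | n + 2 =>
      rw [K_succ, K_succ, ih (n+1) (by omega) (fun t ht => h t (by omega)),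
        ih n (by omega) (fun t ht => h t (by omega)), h (n+1) (by omega)]

lemma K_sub (hx : ∀ n, 0 < x n) (i m n l : ℕ) (h : m + n ≤ l) : K x (i+m) n ≤ K x i l := by
  have h1 := K_mul_le hx i m n
  have h2 := K_pos hx i m
  have h3 := Nat.le_mul_of_pos_left (K x (i+m) n) h2
  exact h3.trans (h1.trans (K_mono hx i h))

lemma K0 (x : ℕ → ℕ) (n : ℕ) : K x 0 n = cfQ x n := by simp [K]
end

lemma cfQ_pos {x : ℕ → ℕ} (hx : ∀ n, 0 < x n) (n : ℕ) : 0 < cfQ x n := by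
  rw [← K0]; exact K_pos hx 0 n

lemma cfP_le {x : ℕ → ℕ} (hx : ∀ n, 0 < x n) (n : ℕ) : cfP x n ≤ cfQ x n := by
  induction n using Nat.strong_induction_on with
  | _ n ih =>
    match n with
    | 0 => simp [cfP, cfQ]
    | 1 => have := hx 0; simp only [cfP, cfQ]; omega
    | n + 2 =>
      simp only [cfP, cfQ]
      exact Nat.add_le_add (Nat.mul_le_mul_left _ (ih (n+1) (by omega))) (ih n (by omega))

lemma cfP_succ (x : ℕ → ℕ) (n : ℕ) : cfP x (n+2) = x (n+1)*cfP x (n+1)+cfP x n := rfl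
lemma cfQ_succ (x : ℕ → ℕ) (n : ℕ) : cfQ x (n+2) = x (n+1)*cfQ x (n+1)+cfQ x n := rfl

/-- `(-1)^n (q_n p_m - p_n q_m)` -/
lemma cf_det (x : ℕ → ℕ) (n : ℕ) :
    (-1:ℤ)^n * ((cfQ x n : ℤ) * cfP x (n+1) - cfP x n * cfQ x (n+1)) = 1 := by
  induction n with
  | zero => simp [cfP, cfQ]
  | succ n ih =>
    rw [show n + 1 + 1 = n + 2 by ring]
    rw [cfP_succ, cfQ_succ]
    push_cast
    rw [pow_succ]; linear_combination ih

lemma cf_f (x : ℕ → ℕ) (hx : ∀ n, 0 < x n) (n k : ℕ) :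
    1 ≤ (-1:ℤ)^n * ((cfQ x n : ℤ) * cfP x (n+(k+1)) - cfP x n * cfQ x (n+(k+1))) := by
  induction k using Nat.strong_induction_on with
  | _ k ih =>
    match k with
    | 0 => rw [zero_add, cf_det]
    | 1 =>
      have h1 := cf_det x n
      have hx1 : (1:ℤ) ≤ x (n+1) := by exact_mod_cast hx (n+1)
      rw [show n + (1 + 1) = n + 2 by ring]
      rw [cfP_succ, cfQ_succ]
      push_cast
      have e : (-1:ℤ)^n * ((cfQ x n : ℤ) * (x (n+1) * cfP x (n+1) + cfP x n) - cfP x n * (x (n+1) * cfQ x (n+1) + cfQ x n))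
        = x (n+1) * ((-1:ℤ)^n * ((cfQ x n : ℤ) * cfP x (n+1) - cfP x n * cfQ x (n+1))) := by ring
      rw [e, h1]; linarith
    | k + 2 =>
      have h1 := ih (k+1) (by omega)
      have h0 := ih k (by omega)
      have hx1 : (1:ℤ) ≤ x (n+(k+2)) := by exact_mod_cast hx (n+(k+2))
      rw [show n + (k + 2 + 1) = (n + k + 1) + 2 by ring]
      rw [cfP_succ, cfQ_succ]
      rw [show n + k + 1 + 1 = n + (k + 1 + 1) by ring, show n + k + 1 = n + (k + 1) by ring]
      push_cast
      set A := (cfP x (n+(k+1+1)) : ℤ)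
      set B := (cfQ x (n+(k+1+1)) : ℤ)
      set A' := (cfP x (n+(k+1)) : ℤ)
      set B' := (cfQ x (n+(k+1)) : ℤ)
      rw [show n + (k + 1 + 1) = n + (k + 2) by ring]
      have e : (-1:ℤ)^n * ((cfQ x n : ℤ) * (x (n+(k+2)) * A + A') - cfP x n * (x (n+(k+2)) * B + B'))
        = x (n+(k+2)) * ((-1:ℤ)^n * ((cfQ x n : ℤ) * A - cfP x n * B)) + (-1:ℤ)^n * ((cfQ x n : ℤ) * A' - cfP x n * B') := by ring
      rw [e]
      nlinarith
end Sub6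

namespace Sub6
open Filter Topology

noncomputable def ee (x : ℕ → ℕ) (α : ℝ) (n : ℕ) : ℝ := (-1)^n * ((cfQ x n : ℝ) * α - cfP x n)

lemma ee_rec (x : ℕ → ℕ) (α : ℝ) (n : ℕ) :
    ee x α n = x (n+1) * ee x α (n+1) + ee x α (n+2) := by
  unfold ee
  rw [cfP_succ, cfQ_succ]
  push_cast
  ring

lemma ee_det (x : ℕ → ℕ) (α : ℝ) (n : ℕ) :
    cfQ x (n+1) * ee x α n + cfQ x n * ee x α (n+1) = 1 := by
  have h := cf_det x n
  have h' : (-1:ℝ)^n * ((cfQ x n : ℝ) * cfP x (n+1) - cfP x n * cfQ x (n+1)) = 1 := by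
    exact_mod_cast h
  unfold ee
  rw [pow_succ]
  linear_combination h'

lemma ee_nonneg {x : ℕ → ℕ} (hx : ∀ n, 0 < x n) {α : ℝ}
    (hα : Tendsto (fun l => (cfP x l : ℝ) / (cfQ x l : ℝ)) atTop (𝓝 α)) (n : ℕ) : 0 ≤ ee x α n := by
  have h : Tendsto (fun l => (-1:ℝ)^n * ((cfQ x n : ℝ) * ((cfP x l : ℝ) / (cfQ x l : ℝ)) - cfP x n)) atTop
      (𝓝 (ee x α n)) := ((hα.const_mul _).sub_const _).const_mul _
  refine ge_of_tendsto h ?_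
  filter_upwards [eventually_ge_atTop (n+1)] with m hm
  obtain ⟨k, rfl⟩ := Nat.exists_eq_add_of_le hm
  have h1 := cf_f x hx n k
  rw [show n + 1 + k = n + (k+1) by ring]
  have h1' : (1:ℝ) ≤ (-1:ℝ)^n * ((cfQ x n : ℝ) * cfP x (n+(k+1)) - cfP x n * cfQ x (n+(k+1))) := by
    exact_mod_cast h1
  have hq : (0:ℝ) < cfQ x (n+(k+1)) := by exact_mod_cast cfQ_pos hx _
  have e : (-1:ℝ)^n * ((cfQ x n : ℝ) * ((cfP x (n+(k+1)) : ℝ) / (cfQ x (n+(k+1)) : ℝ)) - cfP x n)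
    = ((-1:ℝ)^n * ((cfQ x n : ℝ) * cfP x (n+(k+1)) - cfP x n * cfQ x (n+(k+1)))) / cfQ x (n+(k+1)) := by
    field_simp
  rw [e]
  apply div_nonneg _ hq.le
  linarith

lemma ee_anti {x : ℕ → ℕ} (hx : ∀ n, 0 < x n) {α : ℝ} (he : ∀ n, 0 ≤ ee x α n) (n : ℕ) :
    ee x α (n+1) ≤ ee x α n := by
  rw [ee_rec x α n]
  have h1 : (1:ℝ) ≤ x (n+1) := by exact_mod_cast hx (n+1)
  nlinarith [he (n+1), he (n+2)]

lemma ee_le {x : ℕ → ℕ} (hx : ∀ n, 0 < x n) {α : ℝ} (he : ∀ n, 0 ≤ ee x α n) (n : ℕ) :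
    ee x α n ≤ 1 / cfQ x (n+1) := by
  have hq : (0:ℝ) < cfQ x (n+1) := by exact_mod_cast cfQ_pos hx _
  rw [le_div_iff₀ hq]
  have := ee_det x α n
  have h2 : (0:ℝ) ≤ cfQ x n * ee x α (n+1) := mul_nonneg (by positivity) (he _)
  linarith

lemma ee_D {x : ℕ → ℕ} {α : ℝ} (v p L : ℕ)
    (hper : ∀ t < L, x (v+1+t) = x (v+1+p+t)) :
    |ee x α v * ee x α (v+1+p) - ee x α (v+1) * ee x α (v+p)| =
    |ee x α (v+L) * ee x α (v+1+p+L) - ee x α (v+1+L) * ee x α (v+p+L)| := by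
  induction L with
  | zero => simp
  | succ L ih =>
    rw [ih (fun t ht => hper t (by omega))]
    have h1 := ee_rec x α (v+L)
    have h2 := ee_rec x α (v+p+L)
    have h3 := hper L (by omega)
    rw [show v + L + 1 = v+1+L by ring, show v + L + 2 = v+1+(L+1) by ring] at h1
    rw [show v + p + L + 1 = v+1+p+L by ring, show v + p + L + 2 = v+1+p+(L+1) by ring, ← h3] at h2
    rw [show v + (L+1) = v+1+L by ring, show v+p+(L+1) = v+1+p+L by ring, h1, h2, ← abs_neg]
    congr 1
    ring

lemma K_period {x : ℕ → ℕ} (hx : ∀ n, 0 < x n) (α : ℝ)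
    (hα : Tendsto (fun l => (cfP x l : ℝ) / (cfQ x l : ℝ)) atTop (𝓝 α)) (v p L : ℕ)
    (hper : ∀ t < L, x (v+1+t) = x (v+1+p+t)) :
    |ee x α v * ee x α (v+1+p) - ee x α (v+1) * ee x α (v+p)| *
      ((cfQ x (v+1) * cfQ x (v+1+p) : ℕ) * (K x (v+1) L : ℝ)^2) ≤ 1 := by
  have he := ee_nonneg hx hα
  rw [ee_D v p L hper]
  have a1 := ee_le hx he (v+L)
  have a2 := ee_le hx he (v+p+L)
  have b1 := ee_anti hx he (v+L)
  have b2 := ee_anti hx he (v+p+L)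
  rw [show v + L + 1 = v+1+L by ring] at a1 b1
  rw [show v + p + L + 1 = v+1+p+L by ring] at a2 b2
  have c1 : cfQ x (v+1) * K x (v+1) L ≤ cfQ x (v+1+L) := by
    have := K_mul_le hx 0 (v+1) L
    rwa [K0, K0, zero_add] at this
  have c2 : cfQ x (v+1+p) * K x (v+1) L ≤ cfQ x (v+1+p+L) := by
    have := K_mul_le hx 0 (v+1+p) L
    rwa [K0, K0, zero_add, ← K_congr hper] at this
  have c1' : (cfQ x (v+1) * K x (v+1) L : ℝ) ≤ cfQ x (v+1+L) := by exact_mod_cast c1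
  have c2' : (cfQ x (v+1+p) * K x (v+1) L : ℝ) ≤ cfQ x (v+1+p+L) := by exact_mod_cast c2
  have q1 : (0:ℝ) < cfQ x (v+1+L) := by exact_mod_cast cfQ_pos hx _
  have q2 : (0:ℝ) < cfQ x (v+1+p+L) := by exact_mod_cast cfQ_pos hx _
  have hD : |ee x α (v+L) * ee x α (v+1+p+L) - ee x α (v+1+L) * ee x α (v+p+L)| ≤
      ee x α (v+L) * ee x α (v+p+L) := by
    have m1 : ee x α (v+L) * ee x α (v+1+p+L) ≤ ee x α (v+L) * ee x α (v+p+L) :=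
      mul_le_mul_of_nonneg_left b2 (he _)
    have m2 : ee x α (v+1+L) * ee x α (v+p+L) ≤ ee x α (v+L) * ee x α (v+p+L) :=
      mul_le_mul_of_nonneg_right b1 (he _)
    have m3 := mul_nonneg (he (v+L)) (he (v+1+p+L))
    have m4 := mul_nonneg (he (v+1+L)) (he (v+p+L))
    rw [abs_le]; constructor <;> linarith
  have hE : ee x α (v+L) * ee x α (v+p+L) ≤ 1 / cfQ x (v+1+L) * (1 / cfQ x (v+1+p+L)) :=
    mul_le_mul a1 a2 (he _) (by positivity)
  calc _ ≤ (1 / (cfQ x (v+1+L):ℝ) * (1 / cfQ x (v+1+p+L))) * ((cfQ x (v+1+L):ℝ) * cfQ x (v+1+p+L)) := by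
        refine mul_le_mul (hD.trans hE) ?_ (by positivity) (by positivity)
        push_cast
        calc (cfQ x (v+1) * cfQ x (v+1+p) * (K x (v+1) L)^2 : ℝ)
            = (cfQ x (v+1) * K x (v+1) L) * (cfQ x (v+1+p) * K x (v+1) L) := by ring
          _ ≤ _ := mul_le_mul c1' c2' (by positivity) (by positivity)
    _ = 1 := by field_simp

theorem crit12 {x : ℕ → ℕ} (hx : ∀ n, 0 < x n) (α : ℝ)
    (hα : Tendsto (fun l => (cfP x l : ℝ) / (cfQ x l : ℝ)) atTop (𝓝 α))
    (ha : IsAlgebraic ℚ α) (h3 : 3 ≤ (minpoly ℚ α).natDegree) :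
    ∃ C : ℝ, 0 < C ∧ ∀ v p L, 1 ≤ p → (∀ t < L, x (v+1+t) = x (v+1+p+t)) →
      (K x (v+1) L : ℝ)^12 ≤ C * ((cfQ x (v+1) * cfQ x (v+1+p) : ℕ):ℝ)^7 := by
  obtain ⟨c, hc, hS⟩ := schmidt α ha h3 (1/6) (by norm_num) (by norm_num)
  refine ⟨2^13 / c^6, by positivity, ?_⟩
  intro v p L hp hper
  have hK := K_period hx α hα v p L hper
  obtain ⟨p', rfl⟩ := Nat.exists_eq_add_of_le hp
  have hmq : ∀ m n, m ≤ n → (cfQ x m:ℝ) ≤ cfQ x n := by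
    intro m n h
    have := K_mono hx 0 h
    rw [K0, K0] at this; exact_mod_cast this
  have hpq : ∀ m, (cfP x m:ℝ) ≤ cfQ x m := fun m => by exact_mod_cast cfP_le hx m
  have hd1 := cf_det x v
  have hd2 := cf_f x hx (v+1) p'
  rw [show v + 1 + (p'+1) = v+1+(1+p') by ring] at hd2
  have s := hS ((cfP x v : ℤ) * cfP x (v+1+(1+p')) - cfP x (v+1) * cfP x (v+(1+p')))
    (-((cfQ x v : ℤ) * cfP x (v+1+(1+p')) + cfP x v * cfQ x (v+1+(1+p')))
      + (cfQ x (v+1) * cfP x (v+(1+p')) + cfP x (v+1) * cfQ x (v+(1+p'))))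
    ((cfQ x v : ℤ) * cfQ x (v+1+(1+p')) - cfQ x (v+1) * cfQ x (v+(1+p'))) (by
      by_contra hcon
      push Not at hcon
      obtain ⟨e1, e2, e3⟩ := hcon
      have key : ((cfQ x v : ℤ) * cfP x (v+1) - cfP x v * cfQ x (v+1)) *
         ((cfQ x (v+1) : ℤ) * cfP x (v+1+(1+p')) - cfP x (v+1) * cfQ x (v+1+(1+p'))) = 0 := by
        linear_combination (-(cfQ x (v+1) : ℤ)^2) * e1 - (cfQ x (v+1) * cfP x (v+1) : ℤ) * e2 - (cfP x (v+1) : ℤ)^2 * e3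
      rcases mul_eq_zero.1 key with h | h
      · rw [h] at hd1; simp at hd1
      · rw [h] at hd2; simp at hd2)
  set Q : ℝ := ((cfQ x (v+1) * cfQ x (v+1+(1+p')) : ℕ):ℝ) with hQ
  have hQ1 : 1 ≤ Q := by
    rw [hQ]; exact_mod_cast Nat.mul_pos (cfQ_pos hx _) (cfQ_pos hx _)
  have eqy : |ee x α v * ee x α (v+1+(1+p')) - ee x α (v+1) * ee x α (v+(1+p'))| =
     |(((cfP x v : ℤ) * cfP x (v+1+(1+p')) - cfP x (v+1) * cfP x (v+(1+p')) : ℤ):ℝ) +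
      ((-((cfQ x v : ℤ) * cfP x (v+1+(1+p')) + cfP x v * cfQ x (v+1+(1+p')))
      + (cfQ x (v+1) * cfP x (v+(1+p')) + cfP x (v+1) * cfQ x (v+(1+p'))) : ℤ):ℝ) * α +
      (((cfQ x v : ℤ) * cfQ x (v+1+(1+p')) - cfQ x (v+1) * cfQ x (v+(1+p')) : ℤ):ℝ) * α^2| := by
    rw [← one_mul (abs (_ + _ + _)), ← show |(-1:ℝ)^(v+(v+1+(1+p')))| = 1 by simp [abs_pow], ← abs_mul]
    congr 1
    unfold ee
    push_cast
    ring
  rw [eqy] at hK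
  have hmx : mx (-((cfQ x v : ℤ) * cfP x (v+1+(1+p')) + cfP x v * cfQ x (v+1+(1+p')))
      + (cfQ x (v+1) * cfP x (v+(1+p')) + cfP x (v+1) * cfQ x (v+(1+p'))))
    ((cfQ x v : ℤ) * cfQ x (v+1+(1+p')) - cfQ x (v+1) * cfQ x (v+(1+p'))) ≤ 2 * Q := by
    have i1 := hmq v (v+1) (by omega)
    have i2 := hmq (v+(1+p')) (v+1+(1+p')) (by omega)
    have j1 := hpq v
    have j2 := hpq (v+1)
    have j3 := hpq (v+(1+p'))
    have j4 := hpq (v+1+(1+p'))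
    have hQ' : Q = (cfQ x (v+1):ℝ) * cfQ x (v+1+(1+p')) := by rw [hQ]; push_cast; ring
    have P : ∀ a b : ℝ, 0 ≤ b → a ≤ cfQ x (v+1) → b ≤ cfQ x (v+1+(1+p')) → a * b ≤ Q := by
      intro a b hb h1 h2
      rw [hQ']; exact mul_le_mul h1 h2 hb (by positivity)
    have t1 := P (cfQ x v) (cfP x (v+1+(1+p'))) (by positivity) i1 j4
    have t2 := P (cfP x v) (cfQ x (v+1+(1+p'))) (by positivity) (j1.trans i1) le_rfl
    have t3 := P (cfQ x (v+1)) (cfP x (v+(1+p'))) (by positivity) le_rfl (j3.trans i2)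
    have t4 := P (cfP x (v+1)) (cfQ x (v+(1+p'))) (by positivity) j2 i2
    have t5 := P (cfQ x v) (cfQ x (v+1+(1+p'))) (by positivity) i1 le_rfl
    have t6 := P (cfQ x (v+1)) (cfQ x (v+(1+p'))) (by positivity) le_rfl i2
    have n1 : (0:ℝ) ≤ (cfQ x v) * (cfP x (v+1+(1+p'))) := by positivity
    have n2 : (0:ℝ) ≤ (cfP x v) * (cfQ x (v+1+(1+p'))) := by positivity
    have n3 : (0:ℝ) ≤ (cfQ x (v+1)) * (cfP x (v+(1+p'))) := by positivity
    have n4 : (0:ℝ) ≤ (cfP x (v+1)) * (cfQ x (v+(1+p'))) := by positivity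
    have n5 : (0:ℝ) ≤ (cfQ x v) * (cfQ x (v+1+(1+p'))) := by positivity
    have n6 : (0:ℝ) ≤ (cfQ x (v+1)) * (cfQ x (v+(1+p'))) := by positivity
    unfold mx
    refine max_le (by linarith) (max_le ?_ ?_)
    · push_cast; rw [abs_le]; constructor <;> linarith
    · push_cast; rw [abs_le]; constructor <;> linarith
  set M := mx (-((cfQ x v : ℤ) * cfP x (v+1+(1+p')) + cfP x v * cfQ x (v+1+(1+p')))
      + (cfQ x (v+1) * cfP x (v+(1+p')) + cfP x (v+1) * cfQ x (v+(1+p'))))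
    ((cfQ x v : ℤ) * cfQ x (v+1+(1+p')) - cfQ x (v+1) * cfQ x (v+(1+p'))) with hM
  have hM1 : 1 ≤ M := one_le_mx _ _
  have h1 : (2*Q)^(-2-1/6:ℝ) ≤ M^(-2-1/6:ℝ) :=
    Real.rpow_le_rpow_of_nonpos (by linarith) hmx (by norm_num)
  have h2 : c * (2*Q)^(-2-1/6:ℝ) * (Q * (K x (v+1) L : ℝ)^2) ≤ 1 := by
    refine le_trans ?_ hK
    refine mul_le_mul_of_nonneg_right ?_ (by positivity)
    exact (mul_le_mul_of_nonneg_left h1 hc.le).trans s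
  have h3' : ((2*Q)^(-2-1/6:ℝ))^6 = ((2*Q)^13)⁻¹ := by
    rw [← Real.rpow_natCast, ← Real.rpow_mul (by positivity), ← Real.rpow_natCast, ← Real.rpow_neg (by positivity)]
    norm_num
  have h4 : (c * (2*Q)^(-2-1/6:ℝ) * (Q * (K x (v+1) L : ℝ)^2))^6 ≤ 1 := pow_le_one₀ (by positivity) h2
  rw [mul_pow, mul_pow, h3'] at h4
  have hQp : 0 < Q := by linarith
  have h5 : c^6 * ((2*Q)^13)⁻¹ * (Q * (K x (v+1) L : ℝ)^2)^6 = c^6 / (2^13 * Q^7) * (K x (v+1) L : ℝ)^12 := by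
    field_simp
  rw [h5] at h4
  have h6 : 0 < c^6 / (2^13 * Q^7) := by positivity
  rw [mul_comm, ← le_div_iff₀ h6] at h4
  refine h4.trans (le_of_eq ?_)
  field_simp

theorem crit {x : ℕ → ℕ} (hx : ∀ n, 0 < x n) (α : ℝ)
    (hα : Tendsto (fun l => (cfP x l : ℝ) / (cfQ x l : ℝ)) atTop (𝓝 α))
    (ha : IsAlgebraic ℚ α) (h3 : 3 ≤ (minpoly ℚ α).natDegree) (C0 : ℕ) :
    ∃ K0 : ℕ, ∀ u p L, 1 ≤ u → 1 ≤ p → (∀ t < L, x (u+t) = x (u+p+t)) →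
      (cfQ x u * cfQ x (u+p))^2 ≤ C0 * (K x u L)^3 → K x u L ≤ K0 := by
  obtain ⟨C, hC, h⟩ := crit12 hx α hα ha h3
  obtain ⟨K0, hK0⟩ := exists_nat_ge (C^2 * (C0:ℝ)^7)
  refine ⟨K0, ?_⟩
  intro u p L hu hp hper hle
  obtain ⟨v, rfl⟩ := Nat.exists_eq_add_of_le' hu
  have h1 := h v p L hp hper
  set Q : ℝ := ((cfQ x (v+1) * cfQ x (v+1+p) : ℕ):ℝ) with hQ
  have hk : (1:ℝ) ≤ K x (v+1) L := by exact_mod_cast K_pos hx (v+1) L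
  have hle' : Q^2 ≤ C0 * (K x (v+1) L:ℝ)^3 := by rw [hQ]; exact_mod_cast hle
  set k : ℝ := ((K x (v+1) L : ℕ) : ℝ) with hkdef
  have a1 : (k^12)^2 ≤ (C * Q^7)^2 := pow_le_pow_left₀ (by positivity) h1 2
  have a2 : (Q^2)^7 ≤ (C0 * k^3)^7 := pow_le_pow_left₀ (by positivity) hle' 7
  have a3 : k^21 * k^3 ≤ k^21 * (C^2 * C0^7) := by
    calc k^21 * k^3 = (k^12)^2 := by ring
      _ ≤ (C*Q^7)^2 := a1
      _ = C^2 * (Q^2)^7 := by ring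
      _ ≤ C^2 * (C0 * k^3)^7 := mul_le_mul_of_nonneg_left a2 (by positivity)
      _ = _ := by ring
  have a4 : k^3 ≤ C^2 * C0^7 := le_of_mul_le_mul_left a3 (by positivity)
  have a5 : k ≤ k^3 := le_self_pow₀ hk (by norm_num)
  have : k ≤ K0 := by linarith
  rw [hkdef] at this
  exact_mod_cast this
end Sub6

namespace Sub6

/-- windows of length `n` at `i` and `j` agree -/
def eqv (y : ℕ → ℕ) (i j n : ℕ) : Prop := ∀ t < n, y (i+t) = y (j+t)

section eqv
variable {y : ℕ → ℕ} {i j k n m : ℕ}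
lemma eqv.symm (h : eqv y i j n) : eqv y j i n := fun t ht => (h t ht).symm
lemma eqv.trans (h : eqv y i j n) (h' : eqv y j k n) : eqv y i k n := fun t ht => (h t ht).trans (h' t ht)
lemma eqv_refl (y : ℕ → ℕ) (i n : ℕ) : eqv y i i n := fun _ _ => rfl
lemma eqv.mono (h : eqv y i j n) (hm : m ≤ n) : eqv y i j m := fun t ht => h t (by omega)
lemma eqv.shift (h : eqv y i j n) (s : ℕ) (hm : s + m ≤ n) : eqv y (i+s) (j+s) m := by
  intro t ht
  have := h (s+t) (by omega)
  rwa [← add_assoc, ← add_assoc] at this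
lemma eqv.snoc (h : eqv y i j n) (h' : y (i+n) = y (j+n)) : eqv y i j (n+1) := by
  intro t ht
  rcases Nat.lt_succ_iff_lt_or_eq.1 ht with h1 | h1
  · exact h t h1
  · rw [h1]; exact h'
lemma eqv.cons (h : eqv y (i+1) (j+1) n) (h' : y i = y j) : eqv y i j (n+1) := by
  intro t ht
  rcases t with _ | t
  · simpa using h'
  · have := h t (by omega)
    rwa [show i + 1 + t = i + (t+1) by ring, show j + 1 + t = j + (t+1) by ring] at this
end eqv

/-- abstract combinatorial hypotheses -/
structure Hyp (y : ℕ → ℕ) (d n0 : ℕ) (RS : ℕ → ℕ → Prop) : Prop where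
  rec' : ∀ j n i, ∃ j', i ≤ j' ∧ eqv y j j' n
  cnt : ∀ n (s : Finset ℕ), (∀ a ∈ s, ∀ b ∈ s, eqv y a b n → a = b) → s.card ≤ n + d
  nper : ∀ g, 1 ≤ g → ¬ ∀ t, y t = y (t+g)
  cong : ∀ n i j, n0 ≤ n → RS n i → (RS n j ↔ eqv y i j n)
  U : ∀ n i j, n0 ≤ n → eqv y i j n → y (i+n) ≠ y (j+n) → RS n i
  E : ∀ n, n0 ≤ n → ∃ i j, RS n i ∧ RS n j ∧ y (i+n) ≠ y (j+n)
  T : ∀ n i j k, n0 ≤ n → RS n i → RS n j → RS n k → y (i+n) = y (j+n) ∨ y (i+n) = y (k+n) ∨ y (j+n) = y (k+n)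

section H
variable {y : ℕ → ℕ} {d n0 : ℕ} {RS : ℕ → ℕ → Prop}

lemma Hyp.ex (H : Hyp y d n0 RS) {n : ℕ} (hn : n0 ≤ n) (j : ℕ) : ∃ m, RS n (j+m) := by
  obtain ⟨i, _, hi, _, _⟩ := H.E n hn
  obtain ⟨j', hj', he⟩ := H.rec' i n j
  obtain ⟨m, rfl⟩ := Nat.exists_eq_add_of_le hj'
  exact ⟨m, (H.cong n i _ hn hi).2 he⟩

open Classical in
noncomputable def Hyp.nx (H : Hyp y d n0 RS) {n : ℕ} (hn : n0 ≤ n) (j : ℕ) : ℕ := Nat.find (H.ex hn j)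

lemma Hyp.nx_spec (H : Hyp y d n0 RS) {n : ℕ} (hn : n0 ≤ n) (j : ℕ) : RS n (j + H.nx hn j) := by
  classical
  unfold Hyp.nx
  exact Nat.find_spec (H.ex hn j)

lemma Hyp.nx_min (H : Hyp y d n0 RS) {n : ℕ} (hn : n0 ≤ n) (j m : ℕ) (hm : m < H.nx hn j) : ¬ RS n (j + m) := by
  classical
  unfold Hyp.nx at hm
  exact Nat.find_min (H.ex hn j) hm

lemma Hyp.nx_le (H : Hyp y d n0 RS) {n : ℕ} (hn : n0 ≤ n) (j m : ℕ) (hm : RS n (j+m)) : H.nx hn j ≤ m := by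
  by_contra h
  exact H.nx_min hn j m (by omega) hm

lemma Hyp.nx_eq (H : Hyp y d n0 RS) {n : ℕ} (hn : n0 ≤ n) (j m : ℕ) (hm : RS n (j+m))
    (h : ∀ s < m, ¬ RS n (j+s)) : H.nx hn j = m := by
  apply le_antisymm (H.nx_le hn j m hm)
  by_contra h'
  exact h _ (by omega) (H.nx_spec hn j)

lemma Hyp.det (H : Hyp y d n0 RS) {n : ℕ} (hn : n0 ≤ n) {i j : ℕ} (h : eqv y i j n) (m : ℕ)
    (hm : ∀ s < m, ¬ RS n (i+s)) : eqv y i j (n+m) := by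
  induction m with
  | zero => simpa using h
  | succ m ih =>
    have ih := ih (fun s hs => hm s (by omega))
    rw [← add_assoc]
    apply ih.snoc
    by_contra hne
    apply hm m (by omega)
    refine H.U n (i+m) (j+m) hn (ih.shift m (by omega)) ?_
    rwa [show i + m + n = i + (n+m) by ring, show j + m + n = j + (n+m) by ring]

lemma Hyp.hit (H : Hyp y d n0 RS) {n : ℕ} (hn : n0 ≤ n) {i j : ℕ} (h : eqv y i j n) :
    H.nx hn i = H.nx hn j ∧ eqv y i j (n + H.nx hn i) := by
  have key : ∀ i j, eqv y i j n → H.nx hn j ≤ H.nx hn i ∧ eqv y i j (n + H.nx hn i) := by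
    intro i j h
    have h1 := H.det hn h (H.nx hn i) (fun s hs => H.nx_min hn i s hs)
    refine ⟨?_, h1⟩
    apply H.nx_le
    exact (H.cong n _ _ hn (H.nx_spec hn i)).2 (h1.shift _ (by omega))
  exact ⟨le_antisymm (key j i h.symm).1 (key i j h).1, (key i j h).2⟩

/-- for occurrences with the same next letter -/
lemma Hyp.same (H : Hyp y d n0 RS) {n : ℕ} (hn : n0 ≤ n) {i j : ℕ} (hi : RS n i) (hj : RS n j)
    (h : y (i+n) = y (j+n)) : H.nx hn (i+1) = H.nx hn (j+1) ∧ eqv y i j (n + (H.nx hn (i+1) + 1)) := by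
  have h0 := ((H.cong n i j hn hi).1 hj).snoc h
  obtain ⟨h1, h2⟩ := H.hit hn (h0.shift 1 (m := n) (by omega))
  refine ⟨h1, ?_⟩
  have := h2.cons (h0 0 (by omega))
  simpa [add_assoc] using this

lemma Hyp.suffix (H : Hyp y d n0 RS) {n : ℕ} (hn : n0 ≤ n) {j : ℕ} (hj : RS (n+1) j) : RS n (j+1) := by
  obtain ⟨k, k', hk, hk', hne⟩ := H.E (n+1) (by omega)
  have e1 := (H.cong _ _ _ (by omega) hk).1 hk'
  have h1 : RS n (k+1) := by
    refine H.U n (k+1) (k'+1) hn (e1.shift 1 (by omega)) ?_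
    rwa [show k + 1 + n = k + (n+1) by ring, show k' + 1 + n = k' + (n+1) by ring]
  have e2 := (H.cong _ _ _ (by omega) hk).1 hj
  exact (H.cong _ _ _ hn h1).2 (e2.shift 1 (by omega))

lemma Hyp.bisp (H : Hyp y d n0 RS) (N : ℕ) (hN : n0 ≤ N) :
    ∃ n, N ≤ n ∧ ∃ w w', RS n (w+1) ∧ RS n (w'+1) ∧ y w ≠ y w' := by
  by_contra hcon
  push Not at hcon
  have step : ∀ n z, N ≤ n → RS n (z+1) → RS (n+1) z := by
    intro n z hn hz
    obtain ⟨k, _, hk, _, _⟩ := H.E (n+1) (by omega)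
    have h1 := H.suffix (by omega) hk
    have h2 := hcon n hn k z h1 hz
    exact (H.cong _ _ _ (by omega) hk).2 (((H.cong _ _ _ (by omega) h1).1 hz).cons h2)
  have claim : ∀ k z, RS N (z+k) → RS (N+k) z := by
    intro k
    induction k with
    | zero => intro z hz; simpa using hz
    | succ k ih =>
      intro z hz
      rw [← add_assoc]
      apply step _ _ (by omega)
      apply ih
      rwa [show z + 1 + k = z + (k+1) by ring]
  -- two occurrences
  obtain ⟨m0, hm0⟩ := H.ex hN 0
  rw [zero_add] at hm0
  obtain ⟨m1, hm1⟩ := H.ex hN (m0+1)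
  set g := m1 + 1 with hg
  have hm1' : RS N (m0 + g) := by rw [hg, show m0 + (m1+1) = m0+1+m1 by ring]; exact hm1
  apply H.nper g (by omega)
  intro t
  obtain ⟨w, hw⟩ := H.ex hN (t+g+1)
  set W := t + g + 1 + w with hW
  obtain ⟨j, hj, hje⟩ := H.rec' m0 (g+N) W
  have a1 : RS N j := (H.cong _ _ _ hN hm0).2 (hje.mono (by omega))
  have a2 : RS N (j+g) := (H.cong _ _ _ hN hm1').2 (hje.shift g (by omega))
  obtain ⟨v, rfl⟩ := Nat.exists_eq_add_of_le hj
  have b0 : RS (N+W) 0 := claim W 0 (by simpa using hw)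
  have b1 : RS (N+W) v := claim W v (by rw [add_comm]; exact a1)
  have b2 : RS (N+W) (v+g) := claim W (v+g) (by rw [show v+g+W = W+v+g by ring]; exact a2)
  have e1 := (H.cong _ _ _ (by omega) b0).1 b1
  have e2 := (H.cong _ _ _ (by omega) b1).1 b2
  have c1 := e1 t (by omega)
  have c3 := e2 t (by omega)
  have c2 := e1 (t+g) (by omega)
  rw [zero_add] at c1 c2
  rw [c1, c2, c3]; congr 1; ring

/-- the letter preceding the next occurrence -/
lemma Hyp.prevocc (H : Hyp y d n0 RS) {n : ℕ} (hn : n0 ≤ n) {i P : ℕ} (hi : RS n i) (hP : i < P) :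
    ∃ z0, RS n z0 ∧ z0 < P ∧ P ≤ z0 + 1 + H.nx hn (z0+1) := by
  classical
  let s := (Finset.range P).filter (fun z => RS n z)
  have hs : s.Nonempty := ⟨i, by simp [s, hi, hP]⟩
  have hm := Finset.max'_mem s hs
  set z0 := s.max' hs with hz0
  have hm' : z0 < P ∧ RS n z0 := by simpa [s] using hm
  refine ⟨z0, hm'.2, hm'.1, ?_⟩
  by_contra hlt
  have h1 : z0 + 1 + H.nx hn (z0+1) ∈ s := by
    simp only [s, Finset.mem_filter, Finset.mem_range]
    exact ⟨by omega, H.nx_spec hn _⟩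
  have := Finset.le_max' s _ h1
  rw [← hz0] at this
  omega

lemma Hyp.nx_mid (H : Hyp y d n0 RS) {n : ℕ} (hn : n0 ≤ n) {z t : ℕ} (h1 : z < t) (h2 : t ≤ z + 1 + H.nx hn (z+1)) :
    H.nx hn t = z + 1 + H.nx hn (z+1) - t := by
  apply H.nx_eq
  · rw [Nat.add_sub_cancel' h2]; exact H.nx_spec hn _
  · intro s hs
    have := H.nx_min hn (z+1) (t + s - (z+1)) (by omega)
    rwa [show z + 1 + (t + s - (z+1)) = t + s by omega] at this

lemma Hyp.main (H : Hyp y d n0 RS) (N : ℕ) : ∃ n, N ≤ n ∧ ∀ T, ∃ P z0 p' s p,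
    eqv y 0 P T ∧ 1 ≤ p ∧ 1 ≤ p' ∧ s ≤ p' ∧ P + s = z0 + p' ∧
    eqv y z0 (z0+p') n ∧ eqv y (z0+p') (z0+p'+p) n ∧
    ((p = p' ∧ p ≤ n + d ∧ eqv y z0 (z0+p') (n+p)) ∨ p' + p ≤ n + d + 1) := by
  obtain ⟨n, hn', w, w', hw, hw', hne⟩ := H.bisp (max N n0) (by omega)
  have hn : n0 ≤ n := by omega
  refine ⟨n, by omega, ?_⟩
  intro T
  obtain ⟨i, hi⟩ := H.ex hn 0
  rw [zero_add] at hi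
  obtain ⟨P, hP, hPe⟩ := H.rec' 0 T (i+1)
  obtain ⟨z0, hz0, hz0P, hPz⟩ := H.prevocc hn hi (show i < P by omega)
  set a := H.nx hn (z0+1) with ha
  set z1 := z0 + 1 + a with hz1
  have hz1' : RS n z1 := H.nx_spec hn _
  set b := H.nx hn (z1+1) with hb
  set z2 := z1 + 1 + b with hz2
  have hz2' : RS n z2 := H.nx_spec hn _
  have q1 : z0 + (a+1) = z1 := by omega
  have q2 : z1 + (b+1) = z2 := by omega
  refine ⟨P, z0, a+1, z1 - P, b+1, hPe, by omega, by omega, by omega, by omega, ?_, ?_, ?_⟩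
  · rw [q1]; exact (H.cong _ _ _ hn hz0).1 hz1'
  · rw [q1, q2]; exact (H.cong _ _ _ hn hz1').1 hz2'
  · by_cases hty : y (z0+n) = y (z1+n)
    · left
      obtain ⟨s1, s2⟩ := H.same hn hz0 hz1' hty
      rw [← ha, ← hb] at s1
      rw [← ha] at s2
      refine ⟨by omega, ?_, ?_⟩
      · have := H.cnt n (Finset.Ioc z0 z1) (by
          intro t ht t' ht' he
          rw [Finset.mem_Ioc] at ht ht'
          have h1 := (H.hit hn he).1
          rw [H.nx_mid hn ht.1 ht.2, H.nx_mid hn ht'.1 ht'.2] at h1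
          omega)
        rw [Nat.card_Ioc] at this
        omega
      · rw [q1, ← s1]; exact s2
    · right
      -- deep copies
      have deep : ∀ w, RS n (w+1) → ∃ v, RS n v ∧ y (v + H.nx hn (v+1)) = y w := by
        intro w hw
        obtain ⟨j, hj, hje⟩ := H.rec' w (n+1) (i+1)
        have r1 : RS n (j+1) := (H.cong _ _ _ hn hw).2 (hje.shift 1 (by omega))
        obtain ⟨v, hv, hvP, hvP'⟩ := H.prevocc hn hi (show i < j + 1 by omega)
        refine ⟨v, hv, ?_⟩
        have := H.nx_le hn (v+1) (j - v) (by rw [show v + 1 + (j-v) = j+1 by omega]; exact r1)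
        rw [show v + H.nx hn (v+1) = j by omega]
        exact (hje 0 (by omega)).symm
      obtain ⟨v, hv, hvy⟩ := deep w hw
      obtain ⟨v', hv', hvy'⟩ := deep w' hw'
      have lastl : ∀ i j, RS n i → RS n j → y (i+n) = y (j+n) →
          y (i + H.nx hn (i+1)) = y (j + H.nx hn (j+1)) := by
        intro i j hi hj h
        obtain ⟨e1, e2⟩ := H.same hn hi hj h
        rw [← e1]
        exact e2 _ (by omega)
      have t0 := H.T n z0 v v' hn hz0 hv hv'
      have t1 := H.T n z1 v v' hn hz1' hv hv'
      have hvv : y (v+n) ≠ y (v'+n) := by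
        intro h
        have := lastl v v' hv hv' h
        rw [hvy, hvy'] at this
        exact hne this
      have l0 : y (z1 - 1) ≠ y (z2 - 1) := by
        rw [show z1 - 1 = z0 + H.nx hn (z0+1) by omega, show z2 - 1 = z1 + H.nx hn (z1+1) by omega]
        rcases t0 with t0 | t0 | t0
        · rcases t1 with t1 | t1 | t1
          · exact absurd (t0.trans t1.symm) hty
          · rw [lastl z0 v hz0 hv t0, lastl z1 v' hz1' hv' t1, hvy, hvy']; exact hne
          · exact absurd t1 hvv
        · rcases t1 with t1 | t1 | t1
          · rw [lastl z0 v' hz0 hv' t0, lastl z1 v hz1' hv t1, hvy, hvy']; exact hne.symm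
          · exact absurd (t0.trans t1.symm) hty
          · exact absurd t1 hvv
        · exact absurd t0 hvv
      have cross : ∀ t t', z0 < t → t ≤ z1 → z1 < t' → t' < z2 → ¬ eqv y t t' n := by
        intro t t' h1 h2 h3 h4 he
        obtain ⟨e1, e2⟩ := H.hit hn he
        rw [H.nx_mid hn h1 h2] at e1 e2
        rw [H.nx_mid hn h3 h4.le] at e1
        have := e2 (z1 - t - 1) (by omega)
        rw [show t + (z1 - t - 1) = z1 - 1 by omega, show t' + (z1 - t - 1) = z2 - 1 by omega] at this
        exact l0 this
      have := H.cnt n (Finset.Ioo z0 z2) (by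
          intro t ht t' ht' he
          rw [Finset.mem_Ioo] at ht ht'
          rcases le_or_gt t z1 with h1 | h1 <;> rcases le_or_gt t' z1 with h2 | h2
          · have h3 := (H.hit hn he).1
            rw [H.nx_mid hn ht.1 h1, H.nx_mid hn ht'.1 h2] at h3
            omega
          · exact absurd he (cross t t' ht.1 h1 h2 ht'.2)
          · exact absurd he.symm (cross t' t ht'.1 h2 h1 ht.2)
          · have h3 := (H.hit hn he).1
            rw [H.nx_mid hn h1 ht.2.le, H.nx_mid hn h2 ht'.2.le] at h3
            omega)
      rw [Nat.card_Ioo] at this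
      omega
end H
end Sub6

namespace Sub6

def win (y : ℕ → ℕ) (n j : ℕ) : Fin n → ℕ := fun t => y (j + t)
def Fc (y : ℕ → ℕ) (n : ℕ) : Set (Fin n → ℕ) := Set.range (win y n)
def Npr (y : ℕ → ℕ) : Prop := ∀ i g, 1 ≤ g → ¬ ∀ t, y (i+t) = y (i+t+g)
def sh (y : ℕ → ℕ) (i : ℕ) : ℕ → ℕ := fun t => y (i+t)
def rs (n : ℕ) (f : Fin (n+1) → ℕ) : Fin n → ℕ := fun t => f t.castSucc

lemma win_eq {y : ℕ → ℕ} {n i j : ℕ} : win y n i = win y n j ↔ eqv y i j n := by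
  constructor
  · intro h t ht
    exact congrFun h ⟨t, ht⟩
  · intro h; funext t; exact h t t.2

lemma rs_win (y : ℕ → ℕ) (n j : ℕ) : rs n (win y (n+1) j) = win y n j := by
  funext t; simp [rs, win]

lemma rs_Fc (y : ℕ → ℕ) (n : ℕ) : rs n '' Fc y (n+1) = Fc y n := by
  unfold Fc
  rw [← Set.range_comp]
  congr 1

lemma Npr.sh {y : ℕ → ℕ} (h : Npr y) (i : ℕ) : Npr (sh y i) := by
  intro j g hg hc
  apply h (i+j) g hg
  intro t
  have := hc t
  simp only [Sub6.sh] at this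
  rw [show i + j + t = i + (j+t) by ring, this]; congr 1; ring

lemma Fc_sh_sub (y : ℕ → ℕ) (i n : ℕ) : Fc (sh y i) n ⊆ Fc y n := by
  rintro _ ⟨j, rfl⟩
  refine ⟨i + j, ?_⟩
  funext t; simp [win, sh, add_assoc]

lemma MH {y : ℕ → ℕ} (h : Npr y) (hf : ∀ n, (Fc y n).Finite) (n : ℕ) :
    (Fc y n).ncard < (Fc y (n+1)).ncard := by
  by_contra hle
  push Not at hle
  have hinj : Set.InjOn (rs n) (Fc y (n+1)) := by
    apply Set.injOn_of_ncard_image_eq _ (hf _)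
    apply le_antisymm (Set.ncard_image_le (hf _))
    rw [rs_Fc]; exact hle
  have hd : ∀ i j, eqv y i j n → eqv y i j (n+1) := by
    intro i j he
    rw [← win_eq] at he ⊢
    apply hinj ⟨i, rfl⟩ ⟨j, rfl⟩
    rw [rs_win, rs_win, he]
  have hni : ¬ Function.Injective (win y n) := fun hi => Set.infinite_range_of_injective hi (hf n)
  have : ∃ i j, i < j ∧ eqv y i j n := by
    rw [Function.Injective] at hni
    push Not at hni
    obtain ⟨i, j, hij, hne⟩ := hni
    rcases lt_or_gt_of_ne hne with hl | hl
    · exact ⟨i, j, hl, win_eq.1 hij⟩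
    · exact ⟨j, i, hl, win_eq.1 hij.symm⟩
  obtain ⟨i, j, hij, he⟩ := this
  have hall : ∀ m, eqv y (i+m) (j+m) n := by
    intro m
    induction m with
    | zero => simpa using he
    | succ m ih =>
      have := (hd _ _ ih).shift 1 (m := n) (by omega)
      simpa [add_assoc] using this
  apply h i (j-i) (by omega)
  intro t
  have := hd _ _ (hall t) 0 (by omega)
  rw [show i + t + (j-i) = j + t by omega]
  simpa using this

lemma MH2 {y : ℕ → ℕ} (h : Npr y) (hf : ∀ n, (Fc y n).Finite) (n k : ℕ) :
    (Fc y n).ncard + k ≤ (Fc y (n+k)).ncard := by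
  induction k with
  | zero => simp
  | succ k ih => have := MH h hf (n+k); rw [← add_assoc, ← add_assoc]; omega

lemma sec {α β : Type*} (r : α → β) (A : Set α) (hA : A.Finite) (h : A.ncard = (r '' A).ncard + 1) :
    ∃ e ∈ A, ∃ e' ∈ A, e' ≠ e ∧ r e' = r e ∧ Set.InjOn r (A \ {e}) := by
  have hni : ¬ Set.InjOn r A := by
    intro hi
    have := Set.ncard_image_of_injOn hi
    omega
  rw [Set.InjOn] at hni
  push Not at hni
  obtain ⟨e, he, e', he', hr, hne⟩ := hni
  refine ⟨e, he, e', he', hne.symm, hr.symm, ?_⟩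
  have himg : r '' (A \ {e}) = r '' A := by
    apply Set.Subset.antisymm (Set.image_mono Set.diff_subset)
    rintro _ ⟨a, ha, rfl⟩
    by_cases hae : a = e
    · exact ⟨e', ⟨he', hne.symm⟩, by rw [hae, hr]⟩
    · exact ⟨a, ⟨ha, hae⟩, rfl⟩
  apply Set.injOn_of_ncard_image_eq _ (hA.subset Set.diff_subset)
  rw [himg]
  have := Set.ncard_diff_singleton_add_one he hA
  omega

lemma exists_hyp {x : ℕ → ℕ} (h : Npr x) (hf : ∀ n, (Fc x n).Finite) (C : ℕ)
    (hC : ∀ n, (Fc x n).ncard ≤ n + C) : ∃ i0 d n0 RS, Hyp (sh x i0) d n0 RS := by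
  classical
  have hE : ∃ d i, ∀ n, (Fc (sh x i) n).ncard ≤ n + d :=
    ⟨C, 0, fun n => (Set.ncard_le_ncard (Fc_sh_sub x 0 n) (hf n)).trans (hC n)⟩
  set d := Nat.find hE with hd
  obtain ⟨i0, hi0⟩ := Nat.find_spec hE
  rw [← hd] at hi0
  set y := sh x i0 with hy
  have hyf : ∀ n, (Fc y n).Finite := fun n => (hf n).subset (Fc_sh_sub x i0 n)
  have hyN : Npr y := h.sh i0
  have hyif : ∀ i n, (Fc (sh y i) n).Finite := fun i n => (hyf n).subset (Fc_sh_sub y i n)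
  have hsub : ∀ i n, (Fc (sh y i) n).ncard ≤ (Fc y n).ncard := fun i n =>
    Set.ncard_le_ncard (Fc_sh_sub y i n) (hyf n)
  have hst : ∀ i, ∃ ni, ∀ n, ni ≤ n → n + d ≤ (Fc (sh y i) n).ncard := by
    intro i
    have : ∃ n, n + d ≤ (Fc (sh y i) n).ncard := by
      by_contra hcon
      push Not at hcon
      have h0 := hcon 0
      have hlt : d - 1 < Nat.find hE := by omega
      apply Nat.find_min hE hlt
      refine ⟨i0 + i, fun n => ?_⟩
      have e : sh x (i0+i) = sh y i := by funext t; simp [sh, hy, add_assoc]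
      rw [e]
      have := hcon n
      omega
    obtain ⟨ni, hni⟩ := this
    refine ⟨ni, fun n hn => ?_⟩
    obtain ⟨k, rfl⟩ := Nat.exists_eq_add_of_le hn
    have := MH2 (hyN.sh i) (hyif i) ni k
    omega
  obtain ⟨n0, hn0⟩ := hst 0
  have hcard : ∀ n, n0 ≤ n → (Fc y n).ncard = n + d := by
    intro n hn
    exact le_antisymm (hi0 n) ((hn0 n hn).trans (hsub 0 n))
  have key : ∀ n, ∃ ρ, n0 ≤ n → (∀ i j, eqv y i j n → y (i+n) ≠ y (j+n) → eqv y ρ i n) ∧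
      (∃ j, eqv y ρ j n ∧ y (ρ+n) ≠ y (j+n)) ∧
      (∀ i j k, eqv y ρ i n → eqv y ρ j n → eqv y ρ k n →
        y (i+n) = y (j+n) ∨ y (i+n) = y (k+n) ∨ y (j+n) = y (k+n)) := by
    intro n
    by_cases hn : n0 ≤ n
    swap
    · exact ⟨0, fun h => absurd h hn⟩
    obtain ⟨e, ⟨ρ, rfl⟩, e', ⟨ρ', rfl⟩, hne, hr, hinj⟩ := sec (rs n) (Fc y (n+1)) (hyf _) (by
      rw [rs_Fc, hcard n hn, hcard (n+1) (by omega)]; ring)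
    have hdis : ∀ i j, y (i+n) ≠ y (j+n) → win y (n+1) i ≠ win y (n+1) j := by
      intro i j hne he
      exact hne (win_eq.1 he n (by omega))
    have hin : ∀ i j, eqv y i j n → y (i+n) ≠ y (j+n) →
        win y (n+1) i = win y (n+1) ρ ∨ win y (n+1) j = win y (n+1) ρ := by
      intro i j he hne
      by_contra hcon
      push Not at hcon
      refine hdis i j hne (hinj ⟨⟨i, rfl⟩, hcon.1⟩ ⟨⟨j, rfl⟩, hcon.2⟩ ?_)
      rw [rs_win, rs_win, win_eq]; exact he
    refine ⟨ρ, fun _ => ⟨?_, ?_, ?_⟩⟩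
    · intro i j he hne
      rcases hin i j he hne with h1 | h1
      · exact ((win_eq.1 h1).mono (by omega)).symm
      · exact (he.trans ((win_eq.1 h1).mono (by omega))).symm
    · rw [rs_win, rs_win, win_eq] at hr
      refine ⟨ρ', hr.symm, fun hc => hne ?_⟩
      rw [win_eq]
      exact hr.snoc hc.symm
    · intro i j k hi hj hk
      by_contra hcon
      push Not at hcon
      obtain ⟨h1, h2, h3⟩ := hcon
      have a1 := hin i j (hi.symm.trans hj) h1
      have a2 := hin i k (hi.symm.trans hk) h2
      have a3 := hin j k (hj.symm.trans hk) h3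
      have b1 := hdis _ _ h1
      have b2 := hdis _ _ h2
      have b3 := hdis _ _ h3
      rcases a1 with a1 | a1
      · rcases a3 with a3 | a3
        · exact b1 (a1.trans a3.symm)
        · exact b2 (a1.trans a3.symm)
      · rcases a2 with a2 | a2
        · exact b1 (a2.trans a1.symm)
        · exact b3 (a1.trans a2.symm)
  choose ρ hρ using key
  refine ⟨i0, d, n0, fun n j => eqv y (ρ n) j n, ?_⟩
  refine ⟨?_, ?_, ?_, ?_, ?_, ?_, ?_⟩
  · intro j n i
    obtain ⟨ni, hni⟩ := hst i
    set m := max n (max ni n0)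
    have heq : Fc (sh y i) m = Fc y m := by
      apply Set.eq_of_subset_of_ncard_le (Fc_sh_sub y i m) _ (hyf m)
      rw [hcard m (by omega)]
      exact hni m (by omega)
    have hm : win y m j ∈ Fc (sh y i) m := by rw [heq]; exact ⟨j, rfl⟩
    obtain ⟨k, hk⟩ := hm
    refine ⟨i + k, by omega, ?_⟩
    intro t ht
    have := congrFun hk ⟨t, by omega⟩
    simp only [win, sh] at this
    rw [← hy, ← this, add_assoc]
  · intro n s hs
    have h1 : ((win y n) '' (s : Set ℕ)).ncard = s.card := by
      rw [Set.ncard_image_of_injOn, Set.ncard_coe_finset]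
      intro a ha b hb hab
      exact hs a ha b hb (win_eq.1 hab)
    rw [← h1]
    refine (Set.ncard_le_ncard ?_ (hyf n)).trans (hi0 n)
    rintro _ ⟨a, _, rfl⟩
    exact ⟨a, rfl⟩
  · intro g hg hc
    apply hyN 0 g hg
    intro t
    rw [zero_add]; exact hc t
  · intro n i j hn hi
    exact ⟨fun hj => hi.symm.trans hj, fun hij => hi.trans hij⟩
  · intro n i j hn he hne
    exact (hρ n hn).1 i j he hne
  · intro n hn
    obtain ⟨j, hj, hne⟩ := (hρ n hn).2.1
    exact ⟨ρ n, j, eqv_refl _ _ _, hj, hne⟩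
  · intro n i j k hn
    exact (hρ n hn).2.2 i j k
end Sub6

namespace Sub6

/-- consequence of the subspace criterion for a sequence -/
def CritX (x : ℕ → ℕ) : Prop := ∀ C0 : ℕ, ∃ K0 : ℕ, ∀ u p L, 1 ≤ u → 1 ≤ p → (∀ t < L, x (u+t) = x (u+p+t)) →
      (cfQ x u * cfQ x (u+p))^2 ≤ C0 * (K x u L)^3 → K x u L ≤ K0

def CritY (y : ℕ → ℕ) : Prop := ∀ C0 : ℕ, ∃ K0 : ℕ, ∀ u p L, 1 ≤ p → eqv y u (u+p) L →
      (K y 0 u * K y 0 (u+p))^2 ≤ C0 * (K y u L)^3 → K y u L ≤ K0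

lemma CritX.npr {x : ℕ → ℕ} (hx : ∀ n, 0 < x n) (H : CritX x) : Npr x := by
  intro i g hg hc
  obtain ⟨K0, hK0⟩ := H ((cfQ x (i+1) * cfQ x (i+1+g))^2)
  have h1 := hK0 (i+1) g (K0+1) (by omega) hg (by
    intro t ht
    have := hc (1+t)
    rw [← add_assoc] at this
    rw [this]; congr 1; ring) (by
    have := K_pos hx (i+1) (K0+1)
    exact Nat.le_mul_of_pos_right _ (pow_pos this 3))
  have h2 := K_ge hx (i+1) (K0+1)
  omega

lemma K_sh (x : ℕ → ℕ) (w i n : ℕ) : K (sh x w) i n = K x (w+i) n := by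
  unfold K sh
  congr 1
  funext t; rw [add_assoc]

lemma CritX.critY {x : ℕ → ℕ} (hx : ∀ n, 0 < x n) (H : CritX x) (w : ℕ) (hw : 1 ≤ w) : CritY (sh x w) := by
  intro C0
  obtain ⟨K0, hK0⟩ := H (C0 * (2 * cfQ x w)^4)
  refine ⟨K0, ?_⟩
  intro u p L hp he hle
  rw [K_sh, K_sh, K_sh, add_zero] at hle
  rw [K_sh]
  apply hK0 (w+u) p L (by omega) hp
  · intro t ht
    have := he t ht
    simp only [sh] at this
    rw [add_assoc, this]; congr 1; ring
  · have h1 : ∀ m, cfQ x (w+m) ≤ (2 * cfQ x w) * K x w m := by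
      intro m
      have := K_le_mul hx 0 w m
      rw [Sub6.K0, Sub6.K0, zero_add] at this
      rw [mul_assoc]; exact this
    calc (cfQ x (w+u) * cfQ x (w+u+p))^2 ≤ (((2 * cfQ x w) * K x w u) * ((2 * cfQ x w) * K x w (u+p)))^2 := by
          rw [add_assoc w u p]
          exact Nat.pow_le_pow_left (Nat.mul_le_mul (h1 u) (h1 (u+p))) 2
      _ = (2 * cfQ x w)^4 * (K x w u * K x w (u+p))^2 := by ring
      _ ≤ (2 * cfQ x w)^4 * (C0 * (K x (w+u) L)^3) := Nat.mul_le_mul_left _ hle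
      _ = _ := by ring

lemma K_l1 {y : ℕ → ℕ} (hy : ∀ n, 0 < y n) {M : ℕ} (hM : ∀ n, y n ≤ M) {i j m n c : ℕ} (h : eqv y i j m)
    (hn : n ≤ m + c) : K y i n ≤ (M+1)^c * K y j n := by
  rcases le_or_gt n m with hl | hl
  · rw [K_congr (h.mono hl)]
    exact Nat.le_mul_of_pos_left _ (by positivity)
  · obtain ⟨k, rfl⟩ := Nat.exists_eq_add_of_lt hl
    calc K y i (m+k+1) ≤ (M+1)^(k+1) * K y i m := K_steps hy hM i m (k+1)
      _ = (M+1)^(k+1) * K y j m := by rw [K_congr h]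
      _ ≤ _ := Nat.mul_le_mul (Nat.pow_le_pow_right (by omega) (by omega)) (K_mono hy j (by omega))

lemma K_l2 {y : ℕ → ℕ} (hy : ∀ n, 0 < y n) {M : ℕ} (hM : ∀ n, y n ≤ M) {i m n c : ℕ}
    (hn : n ≤ m + c) : K y i n ≤ (M+1)^c * K y i m :=
  (K_mono hy i hn).trans (K_steps hy hM i m c)

theorem contra {y : ℕ → ℕ} (hy : ∀ n, 0 < y n) {M : ℕ} (hM : ∀ n, y n ≤ M) (HC : CritY y)
    {d n0 : ℕ} {RS : ℕ → ℕ → Prop} (H : Hyp y d n0 RS) : False := by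
  set B := (M+1)^(d+1) with hB
  have hB1 : 1 ≤ B := Nat.one_le_pow _ _ (by omega)
  obtain ⟨K0, hK0⟩ := HC (16 * B^5)
  obtain ⟨n, hn, hmain⟩ := H.main (K0 + (B*K0)^4 + B*K0 + 1)
  obtain ⟨P, z0, p', s, p, hP, hp, hp', hs, hPs, e1, e2, hor⟩ := hmain (10*(n+d+2))
  have crP : ∀ u p L, 1 ≤ p → u + p + L ≤ 10*(n+d+2) → eqv y (P+u) (P+u+p) L →
      (K y P u * K y P (u+p))^2 ≤ (16*B^5) * (K y (P+u) L)^3 → K y (P+u) L ≤ K0 := by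
    intro u p L hp hT he hle
    have c1 : K y 0 u = K y P u := K_congr (hP.mono (by omega))
    have c2 : K y 0 (u+p) = K y P (u+p) := K_congr (hP.mono (by omega))
    have c3 : K y u L = K y (P+u) L := by
      have := hP.shift u (m := L) (by omega)
      rw [zero_add] at this
      exact K_congr this
    rw [← c3]
    apply hK0 u p L hp
    · have f1 := hP.shift u (m := L) (by omega)
      have f2 := hP.shift (u+p) (m := L) (by omega)
      rw [zero_add] at f1 f2
      refine (f1.trans he).trans ?_
      rw [add_assoc]; exact f2.symm
    · rw [c1, c2, c3]; exact hle
  rcases hor with ⟨rfl, hpn, he⟩ | hpp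
  · -- same type
    have eP : eqv y (P+0) (P+0+p) (n+s) := by
      have := he.shift (p-s) (m := n+s) (by omega)
      rw [show P + 0 + p = z0 + p + (p-s) by omega, show P + 0 = z0 + (p-s) by omega]
      exact this
    have hb := crP 0 p (n+s) hp (by omega) eP (by
      rw [K_zero, one_mul, zero_add, add_zero]
      have h1 : K y P p ≤ B * K y P (n+s) := K_l2 hy hM (by omega)
      have h2 := K_pos hy P (n+s)
      set k := K y P (n+s)
      calc (K y P p)^2 ≤ (B*k)^2 := Nat.pow_le_pow_left h1 2
        _ = B^2 * k^2 := by ring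
        _ ≤ (16 * B^5) * k^3 := by
          apply Nat.mul_le_mul
          · calc B^2 ≤ B^5 := Nat.pow_le_pow_right hB1 (by omega)
              _ ≤ 16 * B^5 := by omega
          · exact Nat.pow_le_pow_right h2 (by omega))
    have := K_ge hy (P+0) (n+s)
    omega
  · -- different types
    obtain ⟨z1, hz1⟩ : ∃ z1, z1 = z0 + p' := ⟨_, rfl⟩
    rw [← hz1] at e1 e2 hPs
    set L := n + s - p' with hL
    have e02 : eqv y z0 (z1+p) n := e1.trans e2
    have g1 : eqv y (P+0) (P+0+p') L := by
      intro t ht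
      have := e1 (p'-s+t) (by omega)
      rw [show P + 0 + p' + t = z1 + (p'-s+t) by omega, show P + 0 + t = z0 + (p'-s+t) by omega]
      exact this
    have g2 : eqv y (P+0) (P+0+(p'+p)) L := by
      intro t ht
      have := e02 (p'-s+t) (by omega)
      rw [show P + 0 + (p'+p) + t = z1 + p + (p'-s+t) by omega, show P + 0 + t = z0 + (p'-s+t) by omega]
      exact this
    have aa := K_mul_le hy z0 (p'-s) s
    rw [show z0 + (p'-s) = P by omega, show p' - s + s = p' by omega] at aa
    have bb := K_le_mul hy P s (p'-s)
    rw [show s + (p'-s) = p' by omega, hPs] at bb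
    have cc := K_mul_le hy P s p
    rw [hPs] at cc
    have dd := K_le_mul hy P s p
    rw [hPs] at dd
    have ff := K_le_mul hy P (s+p) (p'-s)
    rw [show s + p + (p'-s) = p'+p by omega, show P + (s+p) = z1 + p by omega] at ff
    have gg := K_mul_le hy z0 p' p
    rw [← hz1] at gg
    have l1 : K y z1 (p'-s) ≤ B * K y z0 (p'-s) := K_l1 hy hM e1.symm (by omega)
    have l2 : K y (z1+p) (p'-s) ≤ B * K y z0 (p'-s) := K_l1 hy hM e02.symm (by omega)
    have l3 : K y P (s+p) ≤ B * K y P L := K_l2 hy hM (by omega)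
    have l4 : K y z0 (p'+p) ≤ B * K y z0 n := K_l2 hy hM (by omega)
    have l5 : K y z0 n = K y z1 n := K_congr e1
    have m1 : p' ≤ K y z0 p' := K_ge hy _ _
    have m2 : L ≤ K y P L := K_ge hy _ _
    have m3 : n ≤ K y z1 n := K_ge hy _ _
    have n1 : 1 ≤ K y z0 p' := K_pos hy _ _
    have n2 : 1 ≤ K y z1 p := K_pos hy _ _
    have n3 : 1 ≤ K y P s := K_pos hy _ _
    have n4 : 1 ≤ K y P L := K_pos hy _ _
    have c0 := crP 0 p' L hp' (by omega) g1
    have c1 := crP s p n hp (by omega) (by rw [hPs]; exact e2)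
    have c2 := crP 0 (p'+p) L (by omega) (by omega) g2
    rw [K_zero, one_mul, zero_add, add_zero] at c0 c2
    rw [hPs] at c1
    generalize K y z0 p' = a at *
    generalize K y z1 p = b at *
    generalize K y P s = S at *
    generalize K y P L = k at *
    generalize K y z0 (p'-s) = r at *
    generalize K y z1 n = Z at *
    generalize K y P p' = Q1 at *
    generalize K y P (p'+p) = Q3 at *
    generalize K y P (s+p) = Q2 at *
    generalize K y z1 (p'-s) = r1 at *
    generalize K y (z1+p) (p'-s) = r2 at *
    have F1 : S * b ≤ B * k := cc.trans l3
    have F2 : Q1 ≤ 2 * B * a := by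
      calc Q1 ≤ 2 * (S * r1) := bb
        _ ≤ 2 * (S * (B * r)) := by gcongr
        _ = 2 * B * (r * S) := by ring
        _ ≤ _ := by gcongr
    have F3 : Q3 ≤ 4 * B * (a * b) := by
      calc Q3 ≤ 2 * (Q2 * r2) := ff
        _ ≤ 2 * ((2 * (S * b)) * (B * r)) := by gcongr
        _ = 4 * B * ((r * S) * b) := by ring
        _ ≤ _ := by gcongr
    have F4 : a * b ≤ B * Z := by rw [← l5]; exact gg.trans l4
    have hbS : b ≤ S * b := Nat.le_mul_of_pos_left _ n3
    have hSb : S ≤ S * b := Nat.le_mul_of_pos_right _ n2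
    rcases le_or_gt a b with hab | hab
    · have hk := c0 (by
        calc Q1^2 ≤ (2 * B * a)^2 := by gcongr
          _ ≤ (2 * B * (B * k))^2 := by
            gcongr; exact hab.trans (hbS.trans F1)
          _ = 4 * B^4 * k^2 := by ring
          _ ≤ 16 * B^5 * k^3 := by
            gcongr <;> omega)
      have h1 : a ≤ B * K0 := hab.trans (hbS.trans (F1.trans (Nat.mul_le_mul_left _ hk)))
      omega
    · rcases le_or_gt (S^4) (a^3) with hS | hS
      · have hk := c1 (by
          calc (S * Q2)^2 ≤ (S * (2 * (S * b)))^2 := by gcongr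
            _ = 4 * S^4 * b^2 := by ring
            _ ≤ 4 * a^3 * b^3 := by
              gcongr <;> omega
            _ = 4 * (a*b)^3 := by ring
            _ ≤ 4 * (B*Z)^3 := by gcongr
            _ = 4 * B^3 * Z^3 := by ring
            _ ≤ 16 * B^5 * Z^3 := by
              gcongr <;> omega)
        omega
      · have ha2 : a^2 ≤ S^3 := by
          have h4 : (a^2)^4 ≤ (S^3)^4 := by
            calc (a^2)^4 = a^8 := by ring
              _ ≤ a^9 := Nat.pow_le_pow_right n1 (by omega)
              _ = (a^3)^3 := by ring
              _ ≤ (S^4)^3 := by gcongr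
              _ = _ := by ring
          exact (Nat.pow_le_pow_iff_left (by omega)).1 h4
        have hk := c2 (by
          calc Q3^2 ≤ (4 * B * (a*b))^2 := by gcongr
            _ = 16 * B^2 * (a^2 * b^2) := by ring
            _ ≤ 16 * B^2 * (S^3 * b^3) := by
              gcongr <;> omega
            _ = 16 * B^2 * (S*b)^3 := by ring
            _ ≤ 16 * B^2 * (B*k)^3 := by gcongr
            _ = _ := by ring)
        have h1 : S ≤ B * K0 := hSb.trans (F1.trans (Nat.mul_le_mul_left _ hk))
        have h2 : a ≤ (B*K0)^4 := by
          calc a ≤ a^3 := Nat.le_self_pow (by omega) a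
            _ ≤ S^4 := hS.le
            _ ≤ _ := by gcongr
        omega
end Sub6

namespace Sub6
open Filter Topology

lemma Fc_fin_down {x : ℕ → ℕ} (m k : ℕ) (h : (Fc x (m+k)).Finite) : (Fc x m).Finite := by
  induction k with
  | zero => simpa using h
  | succ k ih =>
    apply ih
    rw [← rs_Fc]
    exact h.image _

lemma Fc_blocks {X : Set (ℕ → ℕ)} {x : ℕ → ℕ} (hx : x ∈ X) {n B : ℕ}
    (h : Cardinal.mk {W : List ℕ | W.length = n ∧ ∃ x ∈ X, ∃ i, Occurs x W i} < (B : Cardinal)) :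
    (Fc x n).Finite ∧ (Fc x n).ncard < B := by
  have hfin : {W : List ℕ | W.length = n ∧ ∃ x ∈ X, ∃ i, Occurs x W i}.Finite := by
    rw [← Set.finite_coe_iff, ← Cardinal.lt_aleph0_iff_finite]
    exact h.trans (Cardinal.natCast_lt_aleph0)
  have hsub : List.ofFn '' (Fc x n) ⊆ {W : List ℕ | W.length = n ∧ ∃ x ∈ X, ∃ i, Occurs x W i} := by
    rintro _ ⟨_, ⟨j, rfl⟩, rfl⟩
    refine ⟨by simp, x, hx, j, ?_⟩
    intro t ht
    rw [List.length_ofFn] at ht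
    simp [win, ht]
  have hinj : Function.Injective (List.ofFn : (Fin n → ℕ) → List ℕ) := List.ofFn_injective
  constructor
  · exact Set.Finite.of_finite_image (hfin.subset hsub) hinj.injOn
  · rw [← Set.ncard_image_of_injective _ hinj]
    refine (Set.ncard_le_ncard hsub hfin).trans_lt ?_
    rw [← Set.cast_ncard hfin] at h
    exact_mod_cast h

theorem final (X : Set (ℕ → ℕ))
    (hposX : ∀ x ∈ X, ∀ n, 0 < x n)
    (hex : ∃ x ∈ X, ∃ α : ℝ, α ∈ Set.Ioo (0 : ℝ) 1 ∧
      Tendsto (fun l => (cfP x l : ℝ) / (cfQ x l : ℝ)) atTop (𝓝 α) ∧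
      IsAlgebraic ℚ α ∧ 3 ≤ (minpoly ℚ α).natDegree) :
    ∀ C : ℕ, ∃ N : ℕ, ∀ n, N ≤ n →
      ((n + C : ℕ) : Cardinal) ≤
        Cardinal.mk {W : List ℕ | W.length = n ∧ ∃ x ∈ X, ∃ i, Occurs x W i} := by
  obtain ⟨x, hxX, α, _, hα, ha, h3⟩ := hex
  have hx := hposX x hxX
  intro C
  by_contra hcon
  push Not at hcon
  have HX : CritX x := fun C0 => crit hx α hα ha h3 C0
  have hN : Npr x := HX.npr hx
  have hbig : ∀ m, ∃ k, (Fc x (m+k)).Finite ∧ (Fc x (m+k)).ncard < m + k + C := by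
    intro m
    obtain ⟨n, hn, hlt⟩ := hcon m
    obtain ⟨k, rfl⟩ := Nat.exists_eq_add_of_le hn
    exact ⟨k, Fc_blocks hxX hlt⟩
  have hf : ∀ n, (Fc x n).Finite := fun n => by
    obtain ⟨k, hk, _⟩ := hbig n
    exact Fc_fin_down n k hk
  have hC : ∀ n, (Fc x n).ncard ≤ n + C := fun n => by
    obtain ⟨k, _, hk⟩ := hbig n
    have := MH2 hN hf n k
    omega
  obtain ⟨M, hM⟩ : ∃ M, ∀ n, x n ≤ M := by
    have h1 : (Set.range x).Finite := by
      have : Set.range x = (fun f : Fin 1 → ℕ => f 0) '' Fc x 1 := by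
        unfold Fc
        rw [← Set.range_comp]
        congr 1
      rw [this]
      exact (hf 1).image _
    obtain ⟨M, hM⟩ := h1.bddAbove
    exact ⟨M, fun n => hM ⟨n, rfl⟩⟩
  obtain ⟨i0, d, n0, RS, H⟩ := exists_hyp (hN.sh 1) (fun n => (hf n).subset (Fc_sh_sub x 1 n)) C
    (fun n => (Set.ncard_le_ncard (Fc_sh_sub x 1 n) (hf n)).trans (hC n))
  have e : sh (sh x 1) i0 = sh x (1+i0) := by funext t; simp [sh, add_assoc]
  rw [e] at H
  exact contra (y := sh x (1+i0)) (fun n => hx _) (M := M) (fun n => hM _) (HX.critY hx (1+i0) (by omega)) H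
end Sub6

/-- Theorem 4: let `X` be a subshift on the alphabet of positive integers
(encoded as a shift-invariant set of sequences of positive natural numbers).
If the set `C_X` contains a real algebraic number of degree at least three,
then the complexity function of `X` satisfies `p_X(n) - n → +∞`: for every
constant `C` there is `N` such that for all `n ≥ N` the set of blocks of `n`
consecutive letters occurring in elements of `X` has at least `n + C` elements. -/
theorem statement6 (X : Set (ℕ → ℕ))
    (hposX : ∀ x ∈ X, ∀ n, 0 < x n)
    (hshift : ∀ x ∈ X, (fun n => x (n + 1)) ∈ X)
    (hex : ∃ x ∈ X, ∃ α : ℝ, α ∈ Set.Ioo (0 : ℝ) 1 ∧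
      Tendsto (fun ℓ => (cfP x ℓ : ℝ) / (cfQ x ℓ : ℝ)) atTop (𝓝 α) ∧
      IsAlgebraic ℚ α ∧ 3 ≤ (minpoly ℚ α).natDegree) :
    ∀ C : ℕ, ∃ N : ℕ, ∀ n, N ≤ n →
      ((n + C : ℕ) : Cardinal) ≤
        Cardinal.mk {W : List ℕ | W.length = n ∧ ∃ x ∈ X, ∃ i, Occurs x W i} := by
  exact Sub6.final X hposX hex
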